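/- Let σ ∈ 𝔖_s and let (Λ,t) ∈ E(r,s) be σ-stable (i.e. σ·Λ = Λ). Then (Λ,t) lies in 𝒦(r,s)^σ if and only if the following two conditions hold: (1) T(Λ) = r·t; (2) for every d ∈ [r−1] and every σ-stable s-tuple 𝐉 ∈ Subsets(d,r,s) such that (Γ(𝐉), r−d) ∈ 𝒦(d,s)^σ, one has T_𝐉(Λ) ≤ d·t. -/

import Mathlib

open Module

noncomputable section

/-- A complete flag on `ℂ^m`: an increasing family of subspaces with
`dim (F i) = i + 1` (`0`-based indexing, so `F i` is the `i+1`-st step). -/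
structure Flagg (m : ℕ) where
  F : Fin m → Submodule ℂ (Fin m → ℂ)
  mono : Monotone F
  rank_eq : ∀ i : Fin m, finrank ℂ (F i) = (i : ℕ) + 1

/-- An `s`-tuple `J` of (strictly increasing) maps `[d] → [r]` is *intersecting* if
for every `s`-tuple of complete flags on `ℂ^r` the corresponding intersection of
Schubert varieties in the Grassmannian `Gr(d, ℂ^r)` is nonempty. -/
def Intersecting {s d r : ℕ} (J : Fin s → Fin d → Fin r) : Prop :=
  ∀ F : Fin s → Flagg r, ∃ V : Submodule ℂ (Fin r → ℂ), finrank ℂ V = d ∧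
    ∀ (l : Fin s) (k : Fin d), (k : ℕ) + 1 ≤ finrank ℂ ↥(V ⊓ (F l).F (J l k))

/-- `dim I = ∑_j (I(j) - j)`. -/
def dimI {d r : ℕ} (J : Fin d → Fin r) : ℤ := ∑ k, ((J k : ℤ) - (k : ℤ))

/-- Expected dimension of a tuple `J ∈ Subsets(d,r,s)`. -/
def edim {s d r : ℕ} (J : Fin s → Fin d → Fin r) : ℤ :=
  (d : ℤ) * ((r : ℤ) - (d : ℤ)) - ∑ l, ((d : ℤ) * ((r : ℤ) - (d : ℤ)) - dimI (J l))

/-- `dim` for raw `ℕ`-valued increasing sequences. -/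
def dimN {d : ℕ} (f : Fin d → ℕ) : ℤ := ∑ k, ((f k : ℤ) - (k : ℤ))

/-- Expected dimension for raw `ℕ`-valued tuples, with ambient dimension `n` explicit. -/
def edimN {s d : ℕ} (n : ℕ) (f : Fin s → Fin d → ℕ) : ℤ :=
  (d : ℤ) * ((n : ℤ) - (d : ℤ)) - ∑ l, ((d : ℤ) * ((n : ℤ) - (d : ℤ)) - dimN (f l))

/-- `T(Λ) = ∑_l ∑_j Λ_l(j)`. -/
def TT {s r : ℕ} (Λ : Fin s → Fin r → ℝ) : ℝ := ∑ l, ∑ j, Λ l j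

/-- `T_J(Λ) = ∑_l ∑_{j ∈ J_l} Λ_l(j)`. -/
def TJ {s d r : ℕ} (J : Fin s → Fin d → Fin r) (Λ : Fin s → Fin r → ℝ) : ℝ :=
  ∑ l, ∑ k, Λ l (J l k)

/-- `Γ(J)_l(k) = k - J_l(k) + (r - d)`, a weakly decreasing real `d`-tuple. -/
def GammaT {s d r : ℕ} (J : Fin s → Fin d → Fin r) : Fin s → Fin d → ℝ :=
  fun l k => (k : ℝ) - (J l k : ℝ) + ((r : ℝ) - (d : ℝ))

/-- Membership of `(Λ, t)` in the Kirwan cone `𝒦(r,s)`: each `Λ_l` is weakly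
decreasing and there are Hermitian matrices `A_1, …, A_s` summing to `t·I_r`
whose decreasingly-ordered spectra are the `Λ_l`. -/
def KirwanMem {s r : ℕ} (Λ : Fin s → Fin r → ℝ) (t : ℝ) : Prop :=
  (∀ l, Antitone (Λ l)) ∧
  ∃ (A : Fin s → Matrix (Fin r) (Fin r) ℂ) (hA : ∀ l, (A l).IsHermitian),
    (∑ l, A l) = (t : ℂ) • (1 : Matrix (Fin r) (Fin r) ℂ) ∧
    ∀ l, ∃ e : Equiv.Perm (Fin r), ∀ i, Λ l i = (hA l).eigenvalues (e i)

/-- The subspace of a flag with `k` elements (so `flagAt G 0 = ⊥`). -/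
def flagAt {m : ℕ} (G : Flagg m) : ℕ → Submodule ℂ (Fin m → ℂ)
  | 0 => ⊥
  | (k + 1) => if h : k < m then G.F ⟨k, h⟩ else ⊤

/-- The space `ℒ_I(F,G)` of linear maps `φ : ℂ^r → ℂ^q` with
`φ(F_l(j)) ⊆ G_l(I_l(j) - j)` for all `l, j`. -/
def LSpace {s r q : ℕ} (I : Fin s → Fin r → ℕ) (F : Fin s → Flagg r) (G : Fin s → Flagg q) :
    Submodule ℂ ((Fin r → ℂ) →ₗ[ℂ] (Fin q → ℂ)) where
  carrier := {φ | ∀ (l : Fin s) (j : Fin r), ∀ v ∈ (F l).F j,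
    φ v ∈ flagAt (G l) (I l j - (j : ℕ))}
  add_mem' := by
    intro a b ha hb l j v hv
    simpa using add_mem (ha l j v hv) (hb l j v hv)
  zero_mem' := by
    intro l j v hv
    simp
  smul_mem' := by
    intro c a ha l j v hv
    simpa using Submodule.smul_mem _ c (ha l j v hv)

/-- The true dimension `tdim I`, for a raw tuple `I ∈ Subsets(r, r + q, s)`
(here `q = n - r`). -/
def tdim {s : ℕ} (r q : ℕ) (I : Fin s → Fin r → ℕ) : ℕ :=
  sInf {m : ℕ | ∃ (F : Fin s → Flagg r) (G : Fin s → Flagg q), finrank ℂ (LSpace I F G) = m}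

/-- The kernel dimension `kdim I`. -/
def kdim {s : ℕ} (r q : ℕ) (I : Fin s → Fin r → ℕ) : ℕ :=
  sInf {m : ℕ | ∃ (F : Fin s → Flagg r) (G : Fin s → Flagg q)
      (φ : (Fin r → ℂ) →ₗ[ℂ] (Fin q → ℂ)), φ ∈ LSpace I F G ∧
      finrank ℂ (LSpace I F G) = tdim r q I ∧ finrank ℂ (LinearMap.ker φ) = m}

/-- The (`0`-based) Schubert position of a subspace `W` w.r.t. a flag:
`posN Fl W k` is the least `j` with `dim (Fl(j) ⊓ W) = k + 1`. -/
def posN {m : ℕ} (Fl : Flagg m) (W : Submodule ℂ (Fin m → ℂ)) (k : ℕ) : ℕ :=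
  sInf {j : ℕ | ∃ h : j < m, finrank ℂ ↥(Fl.F ⟨j, h⟩ ⊓ W) = k + 1}

/-- The (`0`-based, `ℕ`-valued) kernel position `kPos(I)_l(k)`. -/
def kPosFun {s : ℕ} (r q : ℕ) (I : Fin s → Fin r → ℕ) (l : Fin s) (k : ℕ) : ℕ :=
  sInf {p : ℕ | ∃ (F : Fin s → Flagg r) (G : Fin s → Flagg q)
      (φ : (Fin r → ℂ) →ₗ[ℂ] (Fin q → ℂ)), φ ∈ LSpace I F G ∧
      finrank ℂ (LSpace I F G) = tdim r q I ∧
      finrank ℂ (LinearMap.ker φ) = kdim r q I ∧ posN (F l) (LinearMap.ker φ) k = p}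

/-- Apply an `r`-tuple of reals at a natural index (junk value `0` out of range). -/
def applyI {r : ℕ} (f : Fin r → ℝ) (j : ℕ) : ℝ := if h : j < r then f ⟨j, h⟩ else 0

/-- Apply an `r`-tuple of naturals at a natural index (junk value `0` out of range). -/
def applyN {r : ℕ} (f : Fin r → ℕ) (j : ℕ) : ℕ := if h : j < r then f ⟨j, h⟩ else 0

/-- The slope `slope_θ(J) = (1/d) ∑_l ∑_{j ∈ J_l} θ_l(j)` of a tuple. -/
def slopeT {s d r : ℕ} (θ : Fin s → Fin r → ℝ) (J : Fin s → Fin d → Fin r) : ℝ :=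
  ((d : ℝ))⁻¹ * ∑ l, ∑ k, θ l (J l k)

/-- The slope `slope_θ(W, F) = slope_θ(Pos(W, F))` of a (nonzero) subspace. -/
def slopeW {s r : ℕ} (θ : Fin s → Fin r → ℝ) (F : Fin s → Flagg r)
    (W : Submodule ℂ (Fin r → ℂ)) : ℝ :=
  ((finrank ℂ W : ℝ))⁻¹ * ∑ l, ∑ k ∈ Finset.range (finrank ℂ W), applyI (θ l) (posN (F l) W k)

end

open Module

set_option linter.all false

namespace KC

section flags
variable {V : Type} [AddCommGroup V] [Module ℂ V] [FiniteDimensional ℂ V]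

/-- A complete flag indexed by `ℕ`. -/
structure IsFlag (r : ℕ) (F : ℕ → Submodule ℂ V) : Prop where
  mono : Monotone F
  rank : ∀ j, finrank ℂ (F j) = min j r
  dim : finrank ℂ V = r

/-- dimension function of a subspace relative to a filtration -/
noncomputable def dm (F : ℕ → Submodule ℂ V) (S : Submodule ℂ V) (j : ℕ) : ℕ :=
  finrank ℂ ↥(S ⊓ F j)

/-- position at most `J` -/
def Pos {d r : ℕ} (F : ℕ → Submodule ℂ V) (S : Submodule ℂ V) (J : Fin d → Fin r) : Prop :=
  ∀ k : Fin d, (k : ℕ) + 1 ≤ dm F S (J k + 1)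

/-- degree of a subspace -/
noncomputable def deg {r : ℕ} (F : ℕ → Submodule ℂ V) (lam : Fin r → ℝ) (S : Submodule ℂ V) : ℝ :=
  ∑ j : Fin r, lam j * ((dm F S (j + 1) : ℝ) - dm F S j)

/-- exact type of a subspace -/
structure IsType {d r : ℕ} (F : ℕ → Submodule ℂ V) (S : Submodule ℂ V) (J : Fin d → Fin r) : Prop where
  sm : StrictMono J
  cnt : ∀ j, dm F S j = (Finset.univ.filter (fun k : Fin d => (J k : ℕ) < j)).card
  ex : ∀ k, ∃ v ∈ S, v ∈ F (J k + 1) ∧ v ∉ F (J k)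

variable {r : ℕ} {F : ℕ → Submodule ℂ V}

theorem IsFlag.top (hF : IsFlag r F) {j : ℕ} (hj : r ≤ j) : F j = ⊤ := by
  apply Submodule.eq_top_of_finrank_eq
  rw [hF.rank, hF.dim, min_eq_right hj]

theorem IsFlag.bot (hF : IsFlag r F) : F 0 = ⊥ := by
  have := hF.rank 0
  simpa using this

theorem dm_mono (hF : IsFlag r F) (S : Submodule ℂ V) : Monotone (dm F S) := fun _ _ h =>
  Submodule.finrank_mono (inf_le_inf_left _ (hF.mono h))

theorem dm_succ_le (hF : IsFlag r F) (S : Submodule ℂ V) (j : ℕ) : dm F S (j+1) ≤ dm F S j + 1 := by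
  have h1 := Submodule.finrank_sup_add_finrank_inf_eq (S ⊓ F (j+1)) (F j)
  have h2 : S ⊓ F (j+1) ⊓ F j = S ⊓ F j := by
    rw [inf_assoc, inf_eq_right.mpr (hF.mono (Nat.le_succ j))]
  have h3 : finrank ℂ ↥(S ⊓ F (j+1) ⊔ F j) ≤ finrank ℂ (F (j+1)) :=
    Submodule.finrank_mono (sup_le inf_le_right (hF.mono (Nat.le_succ j)))
  rw [h2, hF.rank] at h1
  rw [hF.rank] at h3
  unfold dm
  have : min (j+1) r ≤ min j r + 1 := by omega
  omega

theorem dm_zero (hF : IsFlag r F) (S : Submodule ℂ V) : dm F S 0 = 0 := by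
  simp [dm, hF.bot]

theorem dm_top (hF : IsFlag r F) (S : Submodule ℂ V) {j : ℕ} (hj : r ≤ j) :
    dm F S j = finrank ℂ S := by
  rw [dm, hF.top hj, inf_top_eq]

theorem dm_full (hF : IsFlag r F) (j : ℕ) : dm F ⊤ j = min j r := by
  rw [dm, top_inf_eq, hF.rank]

theorem exists_type (hF : IsFlag r F) (S : Submodule ℂ V) {d : ℕ} (hd : finrank ℂ S = d) :
    ∃ J : Fin d → Fin r, IsType F S J := by
  classical
  set A : Finset (Fin r) := Finset.univ.filter (fun j : Fin r => dm F S j < dm F S (j+1)) with hA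
  have hcnt : ∀ j : ℕ, dm F S j = (A.filter (fun i : Fin r => (i : ℕ) < j)).card := by
    intro j
    induction j with
    | zero => simp [dm_zero hF]
    | succ j ih =>
      by_cases hj : j < r
      · by_cases hm : dm F S j < dm F S (j+1)
        · have : A.filter (fun i : Fin r => (i : ℕ) < j + 1) = insert ⟨j, hj⟩ (A.filter (fun i : Fin r => (i : ℕ) < j)) := by
            ext i
            simp only [Finset.mem_filter, Finset.mem_insert, hA, Finset.mem_univ, true_and, Fin.ext_iff]
            constructor
            · rintro ⟨h1, h2⟩
              rcases Nat.lt_succ_iff_lt_or_eq.mp h2 with h | h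
              · right; exact ⟨h1, h⟩
              · left; exact h
            · rintro (h | ⟨h1, h2⟩)
              · simp only [h]; exact ⟨hm, by omega⟩
              · exact ⟨h1, by omega⟩
          rw [this, Finset.card_insert_of_notMem (by simp), ← ih]
          have := dm_succ_le hF S j
          omega
        · have : A.filter (fun i : Fin r => (i : ℕ) < j + 1) = A.filter (fun i : Fin r => (i : ℕ) < j) := by
            ext i
            simp only [Finset.mem_filter, hA, Finset.mem_univ, true_and]
            constructor
            · rintro ⟨h1, h2⟩
              refine ⟨h1, ?_⟩
              rcases Nat.lt_succ_iff_lt_or_eq.mp h2 with h | h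
              · exact h
              · rw [h] at h1; exact absurd h1 hm
            · rintro ⟨h1, h2⟩
              exact ⟨h1, by omega⟩
          rw [this, ← ih]
          have := dm_mono hF S (Nat.le_succ j)
          simp only [Nat.succ_eq_add_one] at this
          omega
      · rw [dm_top hF S (by omega), ← dm_top hF S (by omega : r ≤ j), ih]
        congr 1
        ext i
        have := i.2
        simp only [Finset.mem_filter]
        constructor <;> rintro ⟨h1, h2⟩ <;> exact ⟨h1, by omega⟩
  have hcard : A.card = d := by
    have := hcnt r
    rw [dm_top hF S le_rfl, hd] at this
    rw [this, Finset.filter_true_of_mem (fun i _ => i.2)]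
  refine ⟨fun k => A.orderEmbOfFin hcard k, (A.orderEmbOfFin hcard).strictMono, ?_, ?_⟩
  · intro j
    rw [hcnt]
    symm
    apply Finset.card_bij (fun k _ => A.orderEmbOfFin hcard k)
    · intro k hk
      simp only [Finset.mem_filter, Finset.mem_univ, true_and] at hk ⊢
      exact ⟨Finset.orderEmbOfFin_mem _ _ _, hk⟩
    · intro a _ b _ h
      exact (A.orderEmbOfFin hcard).injective h
    · intro i hi
      simp only [Finset.mem_filter] at hi
      have : i ∈ Set.range (A.orderEmbOfFin hcard) := by
        rw [Finset.range_orderEmbOfFin]; exact hi.1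
      obtain ⟨k, hk⟩ := this
      exact ⟨k, by simp [hk, hi.2], hk⟩
  · intro k
    have hm : A.orderEmbOfFin hcard k ∈ A := Finset.orderEmbOfFin_mem _ _ _
    replace hm := (Finset.mem_filter.mp hm)
    by_contra hcon
    push Not at hcon
    have : S ⊓ F (A.orderEmbOfFin hcard k + 1) ≤ S ⊓ F (A.orderEmbOfFin hcard k) := by
      intro v hv
      exact ⟨hv.1, hcon v hv.1 hv.2⟩
    have := Submodule.finrank_mono this
    have h2 := hm.2
    unfold dm at h2
    omega

theorem IsType.deg_eq {d : ℕ} {S : Submodule ℂ V} {J : Fin d → Fin r} (hJ : IsType F S J) (lam : Fin r → ℝ) :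
    deg F lam S = ∑ k, lam (J k) := by
  classical
  have h : ∀ j : Fin r, (dm F S (j + 1) : ℝ) - dm F S j =
      ((Finset.univ.filter (fun k : Fin d => J k = j)).card : ℝ) := by
    intro j
    rw [hJ.cnt, hJ.cnt]
    have : Finset.univ.filter (fun k : Fin d => (J k : ℕ) < j + 1) =
       Finset.univ.filter (fun k : Fin d => (J k : ℕ) < j) ∪ Finset.univ.filter (fun k : Fin d => J k = j) := by
      ext k; simp [Fin.ext_iff]; omega
    rw [this, Finset.card_union_of_disjoint]
    · push_cast; ring
    · rw [Finset.disjoint_filter]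
      intro k _ h1 h2
      rw [h2] at h1; exact lt_irrefl _ h1
  unfold deg
  simp only [h]
  rw [← Finset.sum_fiberwise (s := Finset.univ) (g := J)]
  apply Finset.sum_congr rfl
  intro j _
  rw [Finset.sum_congr rfl (g := fun _ => lam j)]
  · simp [mul_comm]
  · intro k hk; simp at hk; rw [hk]

theorem IsType.pos {d : ℕ} {S : Submodule ℂ V} {J : Fin d → Fin r} (hJ : IsType F S J) : Pos F S J := by
  intro k
  rw [hJ.cnt]
  have : (Finset.Iic k).card ≤ (Finset.univ.filter (fun k' : Fin d => (J k' : ℕ) < J k + 1)).card := by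
    apply Finset.card_le_card
    intro i hi
    simp at hi ⊢
    have := hJ.sm.monotone hi
    exact this
  simpa using this

theorem IsType.le_of_le_dm {d : ℕ} {S : Submodule ℂ V} {J : Fin d → Fin r} (hJ : IsType F S J)
    {k : Fin d} {j : ℕ} (h : (k : ℕ) + 1 ≤ dm F S j) : (J k : ℕ) < j := by
  by_contra hcon
  rw [hJ.cnt] at h
  have : (Finset.univ.filter (fun k' : Fin d => (J k' : ℕ) < j)).card ≤ (Finset.Iio k).card := by
    apply Finset.card_le_card
    intro i hi
    simp at hi ⊢
    have : J i < J k := by rw [Fin.lt_def]; omega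
    exact hJ.sm.lt_iff_lt.mp this
  simp at this
  omega

theorem IsType.le_of_pos {d : ℕ} {S : Submodule ℂ V} {J J' : Fin d → Fin r} (hJ : IsType F S J)
    (h : Pos F S J') (k : Fin d) : J k ≤ J' k := by
  have := hJ.le_of_le_dm (h k)
  rw [Fin.le_def]; omega

theorem IsType.unique {d : ℕ} {S : Submodule ℂ V} {J J' : Fin d → Fin r} (hJ : IsType F S J)
    (hJ' : IsType F S J') : J = J' := by
  funext k
  exact le_antisymm (hJ.le_of_pos hJ'.pos k) (hJ'.le_of_pos hJ.pos k)

theorem sum_le_deg_of_pos (hF : IsFlag r F) {d : ℕ} {S : Submodule ℂ V} (hd : finrank ℂ S = d)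
    {J' : Fin d → Fin r} (h : Pos F S J') {lam : Fin r → ℝ} (hl : Antitone lam) :
    ∑ k, lam (J' k) ≤ deg F lam S := by
  obtain ⟨J, hJ⟩ := exists_type hF S hd
  rw [hJ.deg_eq]
  exact Finset.sum_le_sum fun k _ => hl (hJ.le_of_pos h k)

/-- vectors in echelon position are linearly independent -/
theorem linearIndependent_of_echelon (hm : Monotone F) {d : ℕ} (J : Fin d → ℕ) (hJ : StrictMono J)
    (b : Fin d → V) (h1 : ∀ k, b k ∈ F (J k + 1)) (h2 : ∀ k, b k ∉ F (J k)) : LinearIndependent ℂ b := by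
  induction d with
  | zero => exact linearIndependent_empty_type
  | succ d ih =>
    rw [← Fin.snoc_init_self b]
    rw [linearIndependent_finSnoc]
    constructor
    · exact ih (fun k => J k.castSucc) (fun a b h => hJ (by simpa using h)) _ (fun k => h1 _) (fun k => h2 _)
    · intro hcon
      apply h2 (Fin.last d)
      have : Submodule.span ℂ (Set.range (Fin.init b)) ≤ F (J (Fin.last d)) := by
        rw [Submodule.span_le]
        rintro _ ⟨k, rfl⟩
        apply hm _ (h1 k.castSucc)
        exact hJ (Fin.castSucc_lt_last k)
      exact this hcon

/-- A complete flag comes from a basis; moreover we can prescribe the basis vectors. -/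
theorem flag_basis (hF : IsFlag r F) (b : Fin r → V) (h1 : ∀ k : Fin r, b k ∈ F (k + 1))
    (h2 : ∀ k : Fin r, b k ∉ F k) : ∃ B : Basis (Fin r) ℂ V, (∀ k, B k = b k) ∧
      ∀ j v, v ∈ F j ↔ ∀ i : Fin r, j ≤ i → B.repr v i = 0 := by
  have hli := linearIndependent_of_echelon hF.mono (fun k : Fin r => (k : ℕ)) (fun a b h => h) b h1 h2
  let B := basisOfLinearIndependentOfCardEqFinrank' b hli (by simp [hF.dim])
  have hB : ∀ k, B k = b k := fun k => by simp [B]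
  refine ⟨B, hB, ?_⟩
  intro j v
  constructor
  · intro hv
    -- dimension count
    by_contra hcon
    push Not at hcon
    obtain ⟨i, hij, hi⟩ := hcon
    -- take the largest such i
    obtain ⟨i, ⟨hij, hi⟩, hmax⟩ : ∃ i : Fin r, (j ≤ i ∧ B.repr v i ≠ 0) ∧ ∀ i', i < i' → B.repr v i' = 0 := by
      classical
      set T := Finset.univ.filter (fun i : Fin r => j ≤ i ∧ B.repr v i ≠ 0) with hT
      have hne : T.Nonempty := ⟨i, by simp [hT, hij, hi]⟩
      refine ⟨T.max' hne, ?_, ?_⟩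
      · have := T.max'_mem hne
        exact (Finset.mem_filter.mp this).2
      · intro i' hi'
        by_contra hc
        have hm := T.max'_mem hne
        replace hm := Finset.mem_filter.mp hm
        have : i' ∈ T := by
          rw [hT, Finset.mem_filter]
          refine ⟨Finset.mem_univ _, ?_, hc⟩
          exact hm.2.1.trans (le_of_lt hi')
        exact absurd (T.le_max' i' this) (not_le.mpr hi')
    have hsum := B.sum_repr v
    rw [← Finset.add_sum_erase _ _ (Finset.mem_univ i)] at hsum
    apply h2 i
    have hin : B.repr v i • B i ∈ F i := by
      rw [← eq_sub_iff_add_eq] at hsum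
      rw [hsum]
      apply Submodule.sub_mem
      · exact hF.mono hij hv
      · apply Submodule.sum_mem
        intro i' hi'
        simp at hi'
        rcases lt_trichotomy i' i with h | h | h
        · apply Submodule.smul_mem
          rw [hB]
          exact hF.mono (Nat.succ_le_of_lt h) (h1 i')
        · exact absurd h hi'
        · rw [hmax i' h]; simp
    rw [← hB]
    exact (Submodule.smul_mem_iff _ hi).mp hin
  · intro h
    rw [← B.sum_repr v]
    apply Submodule.sum_mem
    intro i _
    by_cases hij : j ≤ i
    · rw [h i hij]; simp
    · apply Submodule.smul_mem
      rw [hB]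
      exact hF.mono (by omega) (h1 i)

theorem flag_ex (hF : IsFlag r F) (k : Fin r) : ∃ v ∈ F (k+1), v ∉ F k := by
  by_contra hcon
  push Not at hcon
  have : F (k+1) ≤ F k := hcon
  have := Submodule.finrank_mono this
  rw [hF.rank, hF.rank] at this
  have := k.2
  omega

theorem exists_flag_basis (hF : IsFlag r F) : ∃ B : Basis (Fin r) ℂ V,
      ∀ j v, v ∈ F j ↔ ∀ i : Fin r, j ≤ i → B.repr v i = 0 := by
  choose b h1 h2 using flag_ex hF
  obtain ⟨B, _, hB⟩ := flag_basis hF b h1 h2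
  exact ⟨B, hB⟩

/-- the flag of a basis -/
def bflag (B : Basis (Fin r) ℂ V) (j : ℕ) : Submodule ℂ V where
  carrier := {v | ∀ i : Fin r, j ≤ i → B.repr v i = 0}
  add_mem' := by intro a b ha hb i hi; simp [ha i hi, hb i hi]
  zero_mem' := by intro i hi; simp
  smul_mem' := by intro c a ha i hi; simp [ha i hi]

theorem mem_bflag (B : Basis (Fin r) ℂ V) (j : ℕ) (v : V) :
  v ∈ bflag B j ↔ ∀ i : Fin r, j ≤ i → B.repr v i = 0 := Iff.rfl

theorem bflag_eq_span (B : Basis (Fin r) ℂ V) (j : ℕ) :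
    bflag B j = Submodule.span ℂ (Set.range (fun i : {i : Fin r // (i : ℕ) < j} => B i)) := by
  apply le_antisymm
  · intro v hv
    rw [← B.sum_repr v]
    apply Submodule.sum_mem
    intro i _
    by_cases hij : j ≤ i
    · rw [hv i hij]; simp
    · apply Submodule.smul_mem
      apply Submodule.subset_span
      exact ⟨⟨i, by omega⟩, rfl⟩
  · rw [Submodule.span_le]
    rintro _ ⟨⟨i, hi⟩, rfl⟩ i' hi'
    simp only [Basis.repr_self]
    rw [Finsupp.single_eq_of_ne]
    rintro rfl
    omega

theorem isFlag_bflag (B : Basis (Fin r) ℂ V) : IsFlag r (bflag B) where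
  mono := fun _ _ h _ hv i hi => hv i (h.trans hi)
  rank := by
    intro j
    rw [bflag_eq_span, finrank_span_eq_card]
    · rw [Fintype.card_subtype]
      rw [Fin.card_filter_val_lt, min_comm]
    · exact B.linearIndependent.comp _ Subtype.val_injective
  dim := by simpa using Module.finrank_eq_card_basis B

/-- adapted linearly independent choice -/
theorem exists_adapted {d : ℕ} (U : Fin d → Submodule ℂ V) (hU : ∀ k : Fin d, (k : ℕ) + 1 ≤ finrank ℂ (U k)) :
    ∃ b : Fin d → V, LinearIndependent ℂ b ∧ ∀ k, b k ∈ U k := by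
  induction d with
  | zero => exact ⟨fun k => 0, linearIndependent_empty_type, fun k => k.elim0⟩
  | succ d ih =>
    obtain ⟨b, hb, hbU⟩ := ih (fun k => U k.castSucc) (fun k => hU k.castSucc)
    have : ∃ v ∈ U (Fin.last d), v ∉ Submodule.span ℂ (Set.range b) := by
      by_contra hcon
      push Not at hcon
      have h1 := Submodule.finrank_mono (R := ℂ) (M := V) hcon
      rw [finrank_span_eq_card hb] at h1
      have := hU (Fin.last d)
      simp at this h1
      omega
    obtain ⟨v, hv, hvn⟩ := this
    refine ⟨Fin.snoc b v, ?_, ?_⟩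
    · rw [linearIndependent_finSnoc]; exact ⟨hb, hvn⟩
    · intro k
      refine Fin.lastCases ?_ (fun k => ?_) k
      · simpa using hv
      · simpa using hbU k

end flags

end KC

open Module

set_option linter.all false

namespace KC

open Matrix ComplexOrder

theorem exists_adapted_on {r d : ℕ} (U : Fin d → Submodule ℂ (Fin r → ℂ))
    (hU : ∀ k : Fin d, (k : ℕ) + 1 ≤ finrank ℂ (U k)) :
    ∃ b : Fin d → (Fin r → ℂ), (∀ i j, star (b i) ⬝ᵥ b j = if i = j then 1 else 0) ∧ ∀ k, b k ∈ U k := by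
  induction d with
  | zero => exact ⟨fun k => 0, fun i => i.elim0, fun k => k.elim0⟩
  | succ d ih =>
    obtain ⟨b, hb, hbU⟩ := ih (fun k => U k.castSucc) (fun k => hU k.castSucc)
    let f : U (Fin.last d) →ₗ[ℂ] (Fin d → ℂ) :=
      (Matrix.mulVecLin (Matrix.of fun i => star (b i))).comp (U (Fin.last d)).subtype
    have hf : ∀ v i, f v i = star (b i) ⬝ᵥ v.1 := fun v i => rfl
    have hlt : finrank ℂ (Fin d → ℂ) < finrank ℂ (U (Fin.last d)) := by
      have := hU (Fin.last d)
      simp at this ⊢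
      omega
    obtain ⟨v, hv, hv0⟩ := Submodule.exists_mem_ne_zero_of_ne_bot
      (LinearMap.ker_ne_bot_of_finrank_lt (f := f) hlt)
    have hv1 : ∀ i, star (b i) ⬝ᵥ v.1 = 0 := by
      intro i; rw [← hf, LinearMap.mem_ker.mp hv]; rfl
    have hv2 : v.1 ≠ 0 := fun h => hv0 (Subtype.ext h)
    have hpos : 0 < (star v.1 ⬝ᵥ v.1) := by
      exact dotProduct_star_self_pos_iff.mpr hv2
    obtain ⟨x, hx, hxe⟩ : ∃ x : ℝ, 0 < x ∧ star v.1 ⬝ᵥ v.1 = (x : ℂ) := by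
      rw [Complex.pos_iff] at hpos
      exact ⟨(star v.1 ⬝ᵥ v.1).re, hpos.1, Complex.ext rfl (by simp [← hpos.2])⟩
    set c : ℂ := (((Real.sqrt x)⁻¹ : ℝ) : ℂ) with hc
    refine ⟨Fin.snoc b (c • v.1), ?_, ?_⟩
    · intro i j
      refine Fin.lastCases ?_ (fun i => ?_) i <;> refine Fin.lastCases ?_ (fun j => ?_) j
      · simp only [Fin.snoc_last, star_smul, smul_dotProduct, dotProduct_smul, hxe, smul_eq_mul, if_true]
        rw [hc]
        simp only [Complex.star_def, Complex.conj_ofReal]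
        norm_cast
        have := Real.mul_self_sqrt hx.le
        have h2 := (Real.sqrt_pos.mpr hx).ne'
        field_simp
        nlinarith
      · simp only [Fin.snoc_last, Fin.snoc_castSucc, star_smul, smul_dotProduct]
        have : star v.1 ⬝ᵥ b j = 0 := by
          rw [star_dotProduct, hv1 j, star_zero]
        rw [this, if_neg (Fin.castSucc_lt_last j).ne']
        simp
      · simp only [Fin.snoc_last, Fin.snoc_castSucc, dotProduct_smul, hv1]
        rw [if_neg (Fin.castSucc_lt_last i).ne]
        simp
      · simp only [Fin.snoc_castSucc, hb]
        simp
    · intro k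
      refine Fin.lastCases ?_ (fun k => ?_) k
      · simpa using Submodule.smul_mem _ _ v.2
      · simpa using hbU k

/-- flag attached to a matrix (kernel form) -/
def Fl {r : ℕ} (g : Matrix (Fin r) (Fin r) ℂ) (j : ℕ) : Submodule ℂ (Fin r → ℂ) where
  carrier := {v | ∀ i : Fin r, j ≤ i → (g *ᵥ v) i = 0}
  add_mem' := by intro a b ha hb i hi; simp [mulVec_add, ha i hi, hb i hi]
  zero_mem' := by intro i hi; simp
  smul_mem' := by intro c a ha i hi; simp [mulVec_smul, ha i hi]

theorem mem_Fl {r : ℕ} (g : Matrix (Fin r) (Fin r) ℂ) (j : ℕ) (v : Fin r → ℂ) :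
    v ∈ Fl g j ↔ ∀ i : Fin r, j ≤ i → (g *ᵥ v) i = 0 := Iff.rfl

theorem Fl_mono {r : ℕ} (g : Matrix (Fin r) (Fin r) ℂ) : Monotone (Fl g) :=
  fun _ _ h _ hv i hi => hv i (h.trans hi)

/-- set of tuples of flags for which there is a subspace of position at most `J` -/
def Zset {s d r : ℕ} (J : Fin s → Fin d → Fin r) : Set (Fin s → Matrix (Fin r) (Fin r) ℂ) :=
  {g | ∃ S : Submodule ℂ (Fin r → ℂ), finrank ℂ S = d ∧ ∀ l, Pos (Fl (g l)) S (J l)}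

/-- the tuple `J` is generic -/
def Gen {s d r : ℕ} (J : Fin s → Fin d → Fin r) : Prop := Zset J = Set.univ

theorem card_le_finrank_of_col {r d : ℕ} {U : Submodule ℂ (Fin r → ℂ)} {v : Fin d → (Fin r → ℂ)}
    (hv : LinearIndependent ℂ v) (k : Fin d) (h : ∀ k' ≤ k, v k' ∈ U) : (k : ℕ) + 1 ≤ finrank ℂ U := by
  have hli : LinearIndependent ℂ (fun i : {i // i ≤ k} => v i) := hv.comp _ Subtype.val_injective
  have h1 := finrank_span_eq_card hli
  have h2 : Submodule.span ℂ (Set.range (fun i : {i // i ≤ k} => v i)) ≤ U := by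
    rw [Submodule.span_le]
    rintro _ ⟨i, rfl⟩
    exact h i.1 i.2
  have h3 := Submodule.finrank_mono h2
  rw [h1, Fintype.card_subtype] at h3
  have : (Finset.univ.filter (fun i : Fin d => i ≤ k)).card = k + 1 := by
    rw [← Fin.card_Iic k]; congr 1; ext; simp
  omega

theorem linInd_col {r d : ℕ} {Y : Matrix (Fin r) (Fin d) ℂ} {W : Matrix (Fin d) (Fin r) ℂ}
    (h : W * Y = 1) : LinearIndependent ℂ (fun k => Y.col k) := by
  rw [← Matrix.mulVec_injective_iff]
  intro a b hab
  have := congrArg (fun v => W *ᵥ v) hab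
  simpa [Matrix.mulVec_mulVec, h] using this

theorem mul_col {r d e : ℕ} (A : Matrix (Fin r) (Fin e) ℂ) (B : Matrix (Fin e) (Fin d) ℂ) (k : Fin d) :
    (A * B).col k = A *ᵥ (B.col k) := rfl

theorem frame_mem {s d r : ℕ} {J : Fin s → Fin d → Fin r} (hJ : ∀ l, StrictMono (J l))
    {g : Fin s → Matrix (Fin r) (Fin r) ℂ} {Y : Matrix (Fin r) (Fin d) ℂ} {W : Matrix (Fin d) (Fin r) ℂ}
    {C D : Fin s → Matrix (Fin d) (Fin d) ℂ} (hY : W * Y = 1) (hC : ∀ l, D l * C l = 1)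
    (hz : ∀ l i k, J l k < i → (g l * (Y * C l)) i k = 0) :
    finrank ℂ (LinearMap.range Y.mulVecLin) = d ∧
      ∀ l, Pos (Fl (g l)) (LinearMap.range Y.mulVecLin) (J l) := by
  constructor
  · rw [LinearMap.finrank_range_of_inj]
    · simp
    · exact Matrix.mulVec_injective_iff.mpr (linInd_col hY)
  · intro l k
    have hli : LinearIndependent ℂ (fun k => (Y * C l).col k) := by
      apply linInd_col (W := D l * W)
      rw [Matrix.mul_assoc, ← Matrix.mul_assoc W, hY, Matrix.one_mul, hC]
    apply card_le_finrank_of_col hli k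
    intro k' hk'
    refine ⟨⟨(C l).col k', rfl⟩, ?_⟩
    intro i hi
    have : (g l * (Y * C l)) i k' = 0 := by
      apply hz
      have := (hJ l).monotone hk'
      rw [Fin.lt_def]
      rw [Fin.le_def] at this
      omega
    exact this

theorem mem_Zset_of_frame {s d r : ℕ} {J : Fin s → Fin d → Fin r} (hJ : ∀ l, StrictMono (J l))
    {g : Fin s → Matrix (Fin r) (Fin r) ℂ} {Y : Matrix (Fin r) (Fin d) ℂ} {W : Matrix (Fin d) (Fin r) ℂ}
    {C D : Fin s → Matrix (Fin d) (Fin d) ℂ} (hY : W * Y = 1) (hC : ∀ l, D l * C l = 1)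
    (hz : ∀ l i k, J l k < i → (g l * (Y * C l)) i k = 0) : g ∈ Zset J :=
  ⟨_, frame_mem hJ hY hC hz⟩

/-- orthonormal frames -/
structure Frame {s d r : ℕ} (J : Fin s → Fin d → Fin r) (g : Fin s → Matrix (Fin r) (Fin r) ℂ)
    (Y : Matrix (Fin r) (Fin d) ℂ) (C : Fin s → Matrix (Fin d) (Fin d) ℂ) : Prop where
  hY : Yᴴ * Y = 1
  hC : ∀ l, (C l)ᴴ * C l = 1
  hz : ∀ l i k, J l k < i → (g l * (Y * C l)) i k = 0

theorem exists_frame {s d r : ℕ} {J : Fin s → Fin d → Fin r}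
    {g : Fin s → Matrix (Fin r) (Fin r) ℂ} {S : Submodule ℂ (Fin r → ℂ)} (hS : finrank ℂ S = d)
    (hp : ∀ l, Pos (Fl (g l)) S (J l)) :
    ∃ Y C, Frame J g Y C ∧ LinearMap.range Y.mulVecLin = S := by
  obtain ⟨b0, hb0, hb0S⟩ := exists_adapted_on (fun _ : Fin d => S) (fun k => by rw [hS]; exact k.2)
  have hl : ∀ l, ∃ b : Fin d → (Fin r → ℂ), (∀ i j, star (b i) ⬝ᵥ b j = if i = j then 1 else 0) ∧
      ∀ k, b k ∈ S ⊓ Fl (g l) (J l k + 1) := fun l => exists_adapted_on _ (hp l)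
  choose b hb hbS using hl
  have key : ∀ b : Fin d → (Fin r → ℂ), (∀ i j, star (b i) ⬝ᵥ b j = if i = j then 1 else 0) →
     (Matrix.of fun i k => b k i)ᴴ * (Matrix.of fun i k => b k i) = 1 := by
    intro b hb
    ext i j
    rw [Matrix.mul_apply, Matrix.one_apply, ← hb]
    rfl
  set Y : Matrix (Fin r) (Fin d) ℂ := Matrix.of fun i k => b0 k i with hYdef
  have hYY := key b0 hb0
  rw [← hYdef] at hYY
  have hrange : LinearMap.range Y.mulVecLin = S := by
    apply Submodule.eq_of_le_of_finrank_eq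
    · rw [Matrix.range_mulVecLin, Submodule.span_le]
      rintro _ ⟨k, rfl⟩
      exact hb0S k
    · rw [hS, LinearMap.finrank_range_of_inj]
      · simp
      · exact Matrix.mulVec_injective_iff.mpr (linInd_col hYY)
  have hproj : ∀ v ∈ S, (Y * Yᴴ) *ᵥ v = v := by
    intro v hv
    rw [← hrange] at hv
    obtain ⟨c, rfl⟩ := hv
    rw [Matrix.mulVecLin_apply, Matrix.mulVec_mulVec, Matrix.mul_assoc, hYY, Matrix.mul_one]
  let B : Fin s → Matrix (Fin r) (Fin d) ℂ := fun l => Matrix.of fun i k => b l k i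
  have hYB : ∀ l, Y * (Yᴴ * B l) = B l := by
    intro l
    rw [← Matrix.mul_assoc]
    ext i k
    have := hproj (b l k) (hbS l k).1
    exact congrFun this i
  refine ⟨Y, fun l => Yᴴ * B l, ⟨hYY, ?_, ?_⟩, hrange⟩
  · intro l
    rw [Matrix.conjTranspose_mul, Matrix.conjTranspose_conjTranspose, Matrix.mul_assoc, hYB]
    exact key _ (hb l)
  · intro l i k hik
    rw [hYB]
    exact (hbS l k).2 i hik

theorem Frame.mem {s d r : ℕ} {J : Fin s → Fin d → Fin r} (hJ : ∀ l, StrictMono (J l))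
    {g : Fin s → Matrix (Fin r) (Fin r) ℂ} {Y C} (h : Frame J g Y C) :
    finrank ℂ (LinearMap.range Y.mulVecLin) = d ∧
      ∀ l, Pos (Fl (g l)) (LinearMap.range Y.mulVecLin) (J l) :=
  frame_mem hJ h.hY h.hC h.hz

theorem isCompact_isometries (r d : ℕ) : IsCompact {Y : Matrix (Fin r) (Fin d) ℂ | Yᴴ * Y = 1} := by
  have hK : IsCompact (Set.univ.pi fun _ : Fin r => Set.univ.pi fun _ : Fin d => Metric.closedBall (0:ℂ) 1) :=
    isCompact_univ_pi fun _ => isCompact_univ_pi fun _ => isCompact_closedBall _ _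
  refine IsCompact.of_isClosed_subset (X := Matrix (Fin r) (Fin d) ℂ) hK ?_ ?_
  · exact isClosed_eq (by fun_prop) (by fun_prop)
  · intro Y hY i _ k _
    have h1 : (Yᴴ * Y) k k = 1 := by rw [show Yᴴ * Y = 1 from hY]; simp
    rw [Matrix.mul_apply] at h1
    have h2 : ∑ j, ‖Y j k‖^2 = 1 := by
      have : ∀ j, Yᴴ k j * Y j k = ((‖Y j k‖^2 : ℝ) : ℂ) := by
        intro j
        rw [Matrix.conjTranspose_apply, Complex.star_def, Complex.conj_mul']
        push_cast; rfl
      simp only [this] at h1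
      exact_mod_cast h1
    have h3 : ‖Y i k‖^2 ≤ 1 := by
      rw [← h2]
      exact Finset.single_le_sum (f := fun j => ‖Y j k‖^2) (fun j _ => sq_nonneg _) (Finset.mem_univ i)
    simp only [Metric.mem_closedBall, dist_zero_right]
    nlinarith [norm_nonneg (Y i k)]

instance matFC (m n : ℕ) : FirstCountableTopology (Matrix (Fin m) (Fin n) ℂ) :=
  inferInstanceAs (FirstCountableTopology (Fin m → Fin n → ℂ))

open Filter Topology in
theorem frame_limit {s d r : ℕ} {J : Fin s → Fin d → Fin r}
    {g : ℕ → Fin s → Matrix (Fin r) (Fin r) ℂ} {g0 : Fin s → Matrix (Fin r) (Fin r) ℂ}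
    (hg : Tendsto g atTop (𝓝 g0)) {Y : ℕ → Matrix (Fin r) (Fin d) ℂ}
    {C : ℕ → Fin s → Matrix (Fin d) (Fin d) ℂ} (hf : ∀ n, Frame J (g n) (Y n) (C n)) :
    ∃ (φ : ℕ → ℕ) (Y0 : _) (C0 : _), StrictMono φ ∧ Tendsto (Y ∘ φ) atTop (𝓝 Y0) ∧
      Tendsto (C ∘ φ) atTop (𝓝 C0) ∧ Frame J g0 Y0 C0 := by
  have hK : IsCompact ({Y : Matrix (Fin r) (Fin d) ℂ | Yᴴ * Y = 1} ×ˢ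
      (Set.univ.pi fun _ : Fin s => {Y : Matrix (Fin d) (Fin d) ℂ | Yᴴ * Y = 1})) :=
    (isCompact_isometries r d).prod (isCompact_univ_pi fun _ => isCompact_isometries d d)
  obtain ⟨⟨Y0, C0⟩, hmem, φ, hφ, hlim⟩ := hK.tendsto_subseq (x := fun n => (Y n, C n))
    (fun n => ⟨(hf n).hY, fun l _ => (hf n).hC l⟩)
  rw [Prod.tendsto_iff] at hlim
  refine ⟨φ, Y0, C0, hφ, hlim.1, hlim.2, ⟨hmem.1, fun l => hmem.2 l (Set.mem_univ _), ?_⟩⟩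
  intro l i k hik
  have hg' := hg.comp hφ.tendsto_atTop
  have hcont : Continuous (fun p : (Fin s → Matrix (Fin r) (Fin r) ℂ) × Matrix (Fin r) (Fin d) ℂ ×
      (Fin s → Matrix (Fin d) (Fin d) ℂ) => (p.1 l * (p.2.1 * p.2.2 l)) i k) := by
    fun_prop
  have ht := (hcont.tendsto (g0, Y0, C0)).comp (hg'.prodMk_nhds (hlim.1.prodMk_nhds hlim.2))
  have hz : ∀ n, ((fun p : (Fin s → Matrix (Fin r) (Fin r) ℂ) × Matrix (Fin r) (Fin d) ℂ ×
      (Fin s → Matrix (Fin d) (Fin d) ℂ) => (p.1 l * (p.2.1 * p.2.2 l)) i k) ∘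
      fun x => ((g ∘ φ) x, ((fun n => (Y n, C n)) ∘ φ) x)) n = 0 := by
    intro n
    exact (hf (φ n)).hz l i k hik
  refine tendsto_nhds_unique ht ?_
  refine tendsto_const_nhds.congr (fun n => (hz n).symm)

open Filter Topology in
theorem isClosed_Zset {s d r : ℕ} {J : Fin s → Fin d → Fin r} (hJ : ∀ l, StrictMono (J l)) :
    IsClosed (Zset J) := by
  apply IsSeqClosed.isClosed
  intro g g0 hg hlim
  choose S hS hp using hg
  have : ∀ n, ∃ Y C, Frame J (g n) Y C := fun n => by
    obtain ⟨Y, C, h, _⟩ := exists_frame (hS n) (hp n)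
    exact ⟨Y, C, h⟩
  choose Y C hf using this
  obtain ⟨φ, Y0, C0, _, _, _, h⟩ := frame_limit hlim hf
  exact ⟨_, h.mem hJ⟩

end KC

open Module

set_option linter.all false

namespace KC

open Matrix

open Polynomial in
theorem cofinite_of_infinite {ι κ : Type} [Finite ι] [Finite κ] (p : κ → MvPolynomial ι ℂ[X])
    (h : {z : ℂ | ∃ y : ι → ℂ, ∀ k, (p k).eval₂ (evalRingHom z) y = 0}.Infinite) :
    {z : ℂ | ∃ y : ι → ℂ, ∀ k, (p k).eval₂ (evalRingHom z) y = 0}ᶜ.Finite := by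
  set E : Set ℂ := {z : ℂ | ∃ y : ι → ℂ, ∀ k, (p k).eval₂ (evalRingHom z) y = 0} with hE
  set I : Ideal (MvPolynomial ι ℂ[X]) := Ideal.span (Set.range p) with hI
  let f : ℂ[X] →+* (MvPolynomial ι ℂ[X] ⧸ I) := (Ideal.Quotient.mk I).comp MvPolynomial.C
  have hfp : RingHom.FinitePresentation (A := ℂ[X]) (B := MvPolynomial ι ℂ[X] ⧸ I) f := by
    have h1 : (MvPolynomial.C : ℂ[X] →+* MvPolynomial ι ℂ[X]).FinitePresentation := by
      have : Algebra.FinitePresentation ℂ[X] (MvPolynomial ι ℂ[X]) := inferInstance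
      exact (RingHom.finitePresentation_algebraMap (A := ℂ[X]) (B := MvPolynomial ι ℂ[X])).mpr this
    have h2 : RingHom.FinitePresentation (A := MvPolynomial ι ℂ[X]) (B := MvPolynomial ι ℂ[X] ⧸ I) (Ideal.Quotient.mk I) := by
      apply RingHom.FinitePresentation.of_surjective _ Ideal.Quotient.mk_surjective
      rw [Ideal.mk_ker]
      exact Submodule.fg_span (Set.finite_range p)
    exact h2.comp h1
  have hinj : Function.Injective f := by
    rw [injective_iff_map_eq_zero]
    intro a ha
    refine Polynomial.eq_zero_of_infinite_isRoot a (h.mono ?_)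
    rintro z ⟨y, hy⟩
    have hmem : MvPolynomial.C a ∈ I := Ideal.Quotient.eq_zero_iff_mem.mp ha
    have hle : I ≤ RingHom.ker (MvPolynomial.eval₂Hom (evalRingHom z) y) := by
      rw [hI, Ideal.span_le]
      rintro _ ⟨k, rfl⟩
      exact hy k
    have := hle hmem
    rw [RingHom.mem_ker, MvPolynomial.coe_eval₂Hom, MvPolynomial.eval₂_C] at this
    exact this
  obtain ⟨C, hC⟩ := PrimeSpectrum.exists_constructibleSetData_iff.mpr
    (PrimeSpectrum.isConstructible_range_comap hfp)
  obtain ⟨P, hP, hPc⟩ := Ideal.exists_comap_eq_of_mem_minimalPrimes_of_injective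
    (R := ℂ[X]) (S := MvPolynomial ι ℂ[X] ⧸ I) (f := f) hinj ⊥
    (by rw [IsDomain.minimalPrimes_eq_singleton_bot]; rfl)
  have hbot : (⟨⊥, Ideal.isPrime_bot⟩ : PrimeSpectrum ℂ[X]) ∈ C.toSet := by
    rw [hC]
    exact ⟨⟨P, hP⟩, PrimeSpectrum.ext hPc⟩
  simp only [PrimeSpectrum.ConstructibleSetData.toSet, Set.mem_iUnion] at hbot
  obtain ⟨B, hB, hBm⟩ := hbot
  have hg : ∀ i, B.g i = 0 := fun i => by
    have := hBm.1 (Set.mem_range_self i)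
    simpa using this
  have hf0 : B.f ≠ 0 := fun h0 => hBm.2 (by
    rintro _ rfl
    simp [h0])
  refine (B.f.rootSet_finite ℂ).subset ?_
  intro z hz
  by_contra hroot
  have hev : B.f.eval z ≠ 0 := by
    intro h0
    apply hroot
    rw [Polynomial.mem_rootSet]
    exact ⟨hf0, by simpa using h0⟩
  apply hz
  have hmem : (⟨RingHom.ker (evalRingHom z), RingHom.ker_isPrime _⟩ : PrimeSpectrum ℂ[X]) ∈ C.toSet := by
    simp only [PrimeSpectrum.ConstructibleSetData.toSet, Set.mem_iUnion]
    refine ⟨B, hB, ?_, ?_⟩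
    · rintro _ ⟨i, rfl⟩
      simp [hg]
    · intro hcon
      have := hcon (Set.mem_singleton _)
      exact hev this
  rw [hC] at hmem
  obtain ⟨⟨Q, hQ⟩, hQc⟩ := hmem
  have hQc' : Q.comap f = RingHom.ker (evalRingHom z) := congrArg PrimeSpectrum.asIdeal hQc
  let Q' : Ideal (MvPolynomial ι ℂ[X]) := Q.comap (Ideal.Quotient.mk I)
  have hQ'p : Q'.IsPrime := Ideal.comap_isPrime _ _
  have hIQ : I ≤ Q' := by
    intro x hx
    show Ideal.Quotient.mk I x ∈ Q
    rw [Ideal.Quotient.eq_zero_iff_mem.mpr hx]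
    exact Q.zero_mem
  let φ : MvPolynomial ι ℂ[X] →+* MvPolynomial ι ℂ := MvPolynomial.map (evalRingHom z)
  have hφs : Function.Surjective φ := MvPolynomial.map_surjective _ (fun c => ⟨Polynomial.C c, by simp⟩)
  have hker : RingHom.ker φ ≤ Q' := by
    rw [MvPolynomial.ker_map, Ideal.map_le_iff_le_comap]
    rw [← hQc']
    intro x hx
    exact hx
  have hne : Q'.map φ ≠ ⊤ := by
    intro htop
    have h1 := Ideal.comap_map_of_surjective φ hφs Q'
    rw [htop, Ideal.comap_top] at h1
    have h2 : Q' ⊔ Ideal.comap φ ⊥ = Q' := sup_eq_left.mpr hker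
    rw [h2] at h1
    exact hQ'p.ne_top h1.symm
  obtain ⟨M, hM, hle⟩ := Ideal.exists_le_maximal _ hne
  obtain ⟨y, hy⟩ := MvPolynomial.isMaximal_iff_eq_vanishingIdeal_singleton.mp hM
  refine ⟨y, fun k => ?_⟩
  have h1 : φ (p k) ∈ M := hle (Ideal.mem_map_of_mem _ (hIQ (Ideal.subset_span ⟨k, rfl⟩)))
  rw [hy, MvPolynomial.mem_vanishingIdeal_singleton_iff] at h1
  simp only [φ] at h1
  rw [MvPolynomial.aeval_def, MvPolynomial.eval₂_map] at h1
  simpa using h1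

open Polynomial in
theorem line_finite {s d r : ℕ} {J : Fin s → Fin d → Fin r} (hJ : ∀ l, StrictMono (J l))
    (g0 g1 : Fin s → Matrix (Fin r) (Fin r) ℂ)
    (h : {z : ℂ | g0 + z • g1 ∈ Zset J}.Infinite) : {z : ℂ | g0 + z • g1 ∈ Zset J}ᶜ.Finite := by
  let ι := (Fin r × Fin d) ⊕ (Fin d × Fin r) ⊕ (Fin s × Fin d × Fin d) ⊕ (Fin s × Fin d × Fin d)
  let κ := (Fin d × Fin d) ⊕ (Fin s × Fin d × Fin d) ⊕ (Fin s × Fin r × Fin d)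
  let Y : Matrix (Fin r) (Fin d) (MvPolynomial ι ℂ[X]) := fun i k => MvPolynomial.X (Sum.inl (i, k))
  let W : Matrix (Fin d) (Fin r) (MvPolynomial ι ℂ[X]) := fun i k => MvPolynomial.X (Sum.inr (Sum.inl (i, k)))
  let C : Fin s → Matrix (Fin d) (Fin d) (MvPolynomial ι ℂ[X]) := fun l i k => MvPolynomial.X (Sum.inr (Sum.inr (Sum.inl (l, i, k))))
  let D : Fin s → Matrix (Fin d) (Fin d) (MvPolynomial ι ℂ[X]) := fun l i k => MvPolynomial.X (Sum.inr (Sum.inr (Sum.inr (l, i, k))))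
  let G : Fin s → Matrix (Fin r) (Fin r) (MvPolynomial ι ℂ[X]) := fun l i k =>
    MvPolynomial.C (Polynomial.C (g0 l i k) + Polynomial.X * Polynomial.C (g1 l i k))
  let p : κ → (MvPolynomial ι ℂ[X]) := Sum.elim (fun x : Fin d × Fin d => (W * Y - 1 : Matrix (Fin d) (Fin d) (MvPolynomial ι ℂ[X])) x.1 x.2) (Sum.elim (fun x => (D x.1 * C x.1 - 1) x.2.1 x.2.2)
    (fun x => if J x.1 x.2.2 < x.2.1 then (G x.1 * (Y * C x.1)) x.2.1 x.2.2 else 0))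
  have key : {z : ℂ | g0 + z • g1 ∈ Zset J} =
      {z : ℂ | ∃ y : ι → ℂ, ∀ k, (p k).eval₂ (evalRingHom z) y = 0} := by
    ext z
    have hG : ∀ (y : ι → ℂ) l, (MvPolynomial.eval₂Hom (evalRingHom z) y).mapMatrix (G l) = (g0 + z • g1) l := by
      intro y l
      ext i k
      show MvPolynomial.eval₂ (evalRingHom z) y (MvPolynomial.C _) = _
      rw [MvPolynomial.eval₂_C]
      simp
      exact mul_comm _ _
    constructor
    · rintro ⟨S, hS, hp⟩
      obtain ⟨Y0, C0, hf, _⟩ := exists_frame hS hp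
      let y : ι → ℂ := Sum.elim (fun x => Y0 x.1 x.2) (Sum.elim (fun x => Y0ᴴ x.1 x.2)
        (Sum.elim (fun x => C0 x.1 x.2.1 x.2.2) (fun x => (C0 x.1)ᴴ x.2.1 x.2.2)))
      refine ⟨y, ?_⟩
      set e := (MvPolynomial.eval₂Hom (evalRingHom z) y) with he
      have hY : Y.map e = Y0 := by ext i k; show e (MvPolynomial.X _) = _; rw [he, MvPolynomial.eval₂Hom_X']; rfl
      have hW : W.map e = Y0ᴴ := by ext i k; show e (MvPolynomial.X _) = _; rw [he, MvPolynomial.eval₂Hom_X']; rfl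
      have hC : ∀ l, (C l).map e = C0 l := fun l => by ext i k; show e (MvPolynomial.X _) = _; rw [he, MvPolynomial.eval₂Hom_X']; rfl
      have hD : ∀ l, (D l).map e = (C0 l)ᴴ := fun l => by ext i k; show e (MvPolynomial.X _) = _; rw [he, MvPolynomial.eval₂Hom_X']; rfl
      have hG' : ∀ l, (G l).map e = (g0 + z • g1) l := hG y
      rintro (⟨i, j⟩ | ⟨l, i, j⟩ | ⟨l, i, k⟩)
      · show e ((W * Y - 1 : Matrix (Fin d) (Fin d) (MvPolynomial ι ℂ[X])) i j) = 0
        have : (W * Y).map e = 1 := by rw [Matrix.map_mul, hY, hW, hf.hY]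
        have h2 := congrFun (congrFun this i) j
        rw [Matrix.map_apply] at h2
        rw [Matrix.sub_apply, map_sub, h2, Matrix.one_apply, Matrix.one_apply]
        split_ifs <;> simp
      · show e ((D l * C l - 1) i j) = 0
        have : (D l * C l).map e = 1 := by rw [Matrix.map_mul, hC, hD, hf.hC]
        have h2 := congrFun (congrFun this i) j
        rw [Matrix.map_apply] at h2
        rw [Matrix.sub_apply, map_sub, h2, Matrix.one_apply, Matrix.one_apply]
        split_ifs <;> simp
      · show e (if J l k < i then (G l * (Y * C l)) i k else 0) = 0
        split_ifs with hlt
        · have h2 := hf.hz l i k hlt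
          rw [← hG' l, ← hY, ← hC l, ← Matrix.map_mul, ← Matrix.map_mul] at h2
          exact h2
        · simp
    · rintro ⟨y, hy⟩
      set e := (MvPolynomial.eval₂Hom (evalRingHom z) y) with he
      have hG' : ∀ l, (G l).map e = (g0 + z • g1) l := hG y
      refine mem_Zset_of_frame hJ (Y := Y.map e) (W := W.map e) (C := fun l => (C l).map e)
        (D := fun l => (D l).map e) ?_ ?_ ?_
      · rw [← Matrix.map_mul]
        ext i j
        have h1 : e ((W * Y - 1 : Matrix (Fin d) (Fin d) (MvPolynomial ι ℂ[X])) i j) = 0 := hy (Sum.inl (i, j))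
        rw [Matrix.sub_apply, map_sub, sub_eq_zero] at h1
        rw [Matrix.map_apply, h1, Matrix.one_apply, Matrix.one_apply]
        split_ifs <;> simp
      · intro l
        rw [← Matrix.map_mul]
        ext i j
        have h1 : e ((D l * C l - 1) i j) = 0 := hy (Sum.inr (Sum.inl (l, i, j)))
        rw [Matrix.sub_apply, map_sub, sub_eq_zero] at h1
        rw [Matrix.map_apply, h1, Matrix.one_apply, Matrix.one_apply]
        split_ifs <;> simp
      · intro l i k hlt
        have h1 : e (if J l k < i then (G l * (Y * C l)) i k else 0) = 0 := hy (Sum.inr (Sum.inr (l, i, k)))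
        rw [if_pos hlt] at h1
        rw [← hG' l, ← Matrix.map_mul, ← Matrix.map_mul]
        exact h1
  rw [key] at h ⊢
  exact cofinite_of_infinite p h

theorem gen_of_interior {s d r : ℕ} {J : Fin s → Fin d → Fin r} (hJ : ∀ l, StrictMono (J l))
    (h : (interior (Zset J)).Nonempty) : Gen J := by
  obtain ⟨g0, hg0⟩ := h
  rw [Gen, Set.eq_univ_iff_forall]
  intro g1
  have hc : Continuous (fun z : ℂ => g0 + z • (g1 - g0)) := by fun_prop
  have hopen : IsOpen ((fun z : ℂ => g0 + z • (g1 - g0)) ⁻¹' interior (Zset J)) := isOpen_interior.preimage hc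
  have h0 : (0 : ℂ) ∈ ((fun z : ℂ => g0 + z • (g1 - g0)) ⁻¹' interior (Zset J)) := by simpa using hg0
  have hinf : {z : ℂ | g0 + z • (g1 - g0) ∈ Zset J}.Infinite := by
    refine Set.Infinite.mono (s := ((fun z : ℂ => g0 + z • (g1 - g0)) ⁻¹' interior (Zset J))) ?_ ?_
    · exact fun z hz => interior_subset (s := Zset J) hz
    · exact infinite_of_mem_nhds 0 (hopen.mem_nhds h0)
  have hfin := line_finite hJ g0 (g1 - g0) hinf
  have hcl : IsClosed {z : ℂ | g0 + z • (g1 - g0) ∈ Zset J} := (isClosed_Zset hJ).preimage hc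
  have hd : Dense {z : ℂ | g0 + z • (g1 - g0) ∈ Zset J} := by
    have := (Set.Finite.countable hfin).dense_compl ℂ
    rwa [compl_compl] at this
  have huniv : {z : ℂ | g0 + z • (g1 - g0) ∈ Zset J} = Set.univ := by
    rw [← hcl.closure_eq]; exact hd.closure_eq
  have : (1 : ℂ) ∈ {z : ℂ | g0 + z • (g1 - g0) ∈ Zset J} := by rw [huniv]; trivial
  simpa using this

end KC

open Module

set_option linter.all false

namespace KC

open Matrix

/-- real diagonal matrix as a complex matrix -/
noncomputable def dg {r : ℕ} (lam : Fin r → ℝ) : Matrix (Fin r) (Fin r) ℂ := Matrix.diagonal (fun i => (lam i : ℂ))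

theorem exists_perm_of_map_eq {n : ℕ} {α : Type} [DecidableEq α] (f g : Fin n → α)
    (h : Multiset.map f Finset.univ.val = Multiset.map g Finset.univ.val) :
    ∃ e : Equiv.Perm (Fin n), ∀ i, f i = g (e i) := by
  have hc : ∀ x, Fintype.card {i // f i = x} = Fintype.card {i // g i = x} := by
    intro x
    have := congrArg (Multiset.count x) h
    rw [Multiset.count_map, Multiset.count_map] at this
    rw [Fintype.card_subtype, Fintype.card_subtype]
    rw [Finset.card_def, Finset.card_def, Finset.filter_val, Finset.filter_val]
    convert this using 3 <;> simp [eq_comm]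
  let E := (Equiv.sigmaFiberEquiv f).symm.trans
    ((Equiv.sigmaCongrRight fun x => Fintype.equivOfCardEq (hc x)).trans (Equiv.sigmaFiberEquiv g))
  refine ⟨E, fun i => ?_⟩
  have : g (E i) = f i := ((Fintype.equivOfCardEq (hc (f i))) ⟨i, rfl⟩).2
  exact this.symm

theorem isHermitian_conj {r : ℕ} (lam : Fin r → ℝ) (V : Matrix (Fin r) (Fin r) ℂ) :
    (V * dg lam * Vᴴ).IsHermitian := by
  rw [Matrix.IsHermitian, conjTranspose_mul, conjTranspose_mul, conjTranspose_conjTranspose, mul_assoc]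
  congr 2
  rw [dg, diagonal_conjTranspose]
  congr 1
  ext i
  simp

theorem kirwan_iff {s r : ℕ} (Λ : Fin s → Fin r → ℝ) (t : ℝ) :
    KirwanMem Λ t ↔ (∀ l, Antitone (Λ l)) ∧ ∃ V : Fin s → Matrix (Fin r) (Fin r) ℂ,
      (∀ l, (V l)ᴴ * V l = 1) ∧ ∑ l, V l * dg (Λ l) * (V l)ᴴ = (t : ℂ) • (1 : Matrix (Fin r) (Fin r) ℂ) := by
  constructor
  · rintro ⟨h1, A, hA, hsum, he⟩
    refine ⟨h1, ?_⟩
    have : ∀ l, ∃ V : Matrix (Fin r) (Fin r) ℂ, Vᴴ * V = 1 ∧ V * dg (Λ l) * Vᴴ = A l := by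
      intro l
      obtain ⟨e, he⟩ := he l
      let U : Matrix (Fin r) (Fin r) ℂ := (hA l).eigenvectorUnitary
      have hU : Uᴴ * U = 1 := Unitary.coe_star_mul_self (hA l).eigenvectorUnitary
      have hsp : A l = U * dg (hA l).eigenvalues * Uᴴ := by
        conv_lhs => rw [(hA l).spectral_theorem, Unitary.conjStarAlgAut_apply]
        rfl
      refine ⟨U.submatrix id e, ?_, ?_⟩
      · rw [conjTranspose_submatrix, ← submatrix_mul _ _ _ _ _ Function.bijective_id, hU]
        simp
      · have hd : dg (Λ l) = (dg (hA l).eigenvalues).submatrix e e := by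
          ext i j
          simp [dg, diagonal_apply, he]
        rw [hd, conjTranspose_submatrix, ← submatrix_mul _ _ _ _ _ e.bijective,
          ← submatrix_mul _ _ _ _ _ e.bijective, ← hsp]
        simp
    choose V hV hVA using this
    exact ⟨V, hV, by simp only [hVA, hsum]⟩
  · rintro ⟨h1, V, hV, hsum⟩
    refine ⟨h1, fun l => V l * dg (Λ l) * (V l)ᴴ, fun l => isHermitian_conj _ _, hsum, fun l => ?_⟩
    apply exists_perm_of_map_eq
    have hc : (V l * dg (Λ l) * (V l)ᴴ).charpoly = ∏ i, (Polynomial.X - Polynomial.C (Λ l i : ℂ)) := by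
      rw [charpoly_mul_comm, ← mul_assoc, hV, one_mul, dg, charpoly_diagonal]
    have h2 := (isHermitian_conj (Λ l) (V l)).roots_charpoly_eq_eigenvalues
    rw [hc, Polynomial.roots_prod _ _ (Finset.prod_ne_zero_iff.mpr fun i _ => Polynomial.X_sub_C_ne_zero _)] at h2
    have h3 := congrArg (Multiset.map Complex.re) h2
    simp only [Polynomial.roots_X_sub_C, Multiset.bind_singleton, Multiset.map_map] at h3
    simpa [Function.comp_def] using h3

theorem kirwan_trace {s r : ℕ} {Λ : Fin s → Fin r → ℝ} {t : ℝ} (h : KirwanMem Λ t) : TT Λ = r * t := by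
  obtain ⟨_, V, hV, hsum⟩ := (kirwan_iff Λ t).mp h
  have h1 := congrArg Matrix.trace hsum
  rw [Matrix.trace_sum, Matrix.trace_smul, Matrix.trace_one] at h1
  have h2 : ∀ l, (V l * dg (Λ l) * (V l)ᴴ).trace = ((∑ j, Λ l j : ℝ) : ℂ) := by
    intro l
    rw [Matrix.trace_mul_comm, ← mul_assoc, hV, one_mul, dg, Matrix.trace_diagonal]
    push_cast; rfl
  simp only [h2] at h1
  have h3 : ((TT Λ : ℝ) : ℂ) = ((r * t : ℝ) : ℂ) := by
    rw [TT]; push_cast; push_cast at h1; rw [h1]; simp [mul_comm]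
  exact_mod_cast h3

theorem tr_lower {r d : ℕ} {lam : Fin r → ℝ} (hl : Antitone lam) {J : Fin d → Fin r}
    {M : Matrix (Fin r) (Fin d) ℂ} (hM : Mᴴ * M = 1) (hz : ∀ i k, J k < i → M i k = 0) :
    ∑ k, lam (J k) ≤ (Mᴴ * dg lam * M).trace.re := by
  have h1 : ∀ k, ∑ i, ‖M i k‖^2 = 1 := by
    intro k
    have h1 : (Mᴴ * M) k k = 1 := by rw [hM]; simp
    rw [Matrix.mul_apply] at h1
    have : ∀ j, Mᴴ k j * M j k = ((‖M j k‖^2 : ℝ) : ℂ) := by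
      intro j
      rw [Matrix.conjTranspose_apply, Complex.star_def, Complex.conj_mul']
      push_cast; rfl
    simp only [this] at h1
    exact_mod_cast h1
  have h2 : (Mᴴ * dg lam * M).trace.re = ∑ k, ∑ i, lam i * ‖M i k‖^2 := by
    rw [Matrix.trace, Complex.re_sum]
    apply Finset.sum_congr rfl
    intro k _
    rw [Matrix.diag_apply, Matrix.mul_apply, Complex.re_sum]
    apply Finset.sum_congr rfl
    intro i _
    rw [dg, Matrix.mul_diagonal, Matrix.conjTranspose_apply, Complex.star_def]
    have : (starRingEnd ℂ) (M i k) * (lam i : ℂ) * M i k = ((lam i * ‖M i k‖^2 : ℝ) : ℂ) := by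
      rw [mul_right_comm, Complex.conj_mul']
      push_cast; ring
    rw [this, Complex.ofReal_re]
  rw [h2]
  apply Finset.sum_le_sum
  intro k _
  calc lam (J k) = ∑ i, lam (J k) * ‖M i k‖^2 := by rw [← Finset.mul_sum, h1, mul_one]
    _ ≤ _ := by
      apply Finset.sum_le_sum
      intro i _
      by_cases hi : J k < i
      · rw [hz i k hi]; simp
      · exact mul_le_mul_of_nonneg_right (hl (not_lt.mp hi)) (sq_nonneg _)

theorem kirwan_ineq {s d r : ℕ} {Λ : Fin s → Fin r → ℝ} {t : ℝ} (h : KirwanMem Λ t)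
    {J : Fin s → Fin d → Fin r} (hJ : Gen J) : TJ J Λ ≤ d * t := by
  obtain ⟨hanti, V, hV, hsum⟩ := (kirwan_iff Λ t).mp h
  have hg : (fun l => (V l)ᴴ) ∈ Zset J := by rw [show Zset J = Set.univ from hJ]; trivial
  obtain ⟨S, hS, hp⟩ := hg
  obtain ⟨Y, C, hf, _⟩ := exists_frame hS hp
  have hV' : ∀ l, V l * (V l)ᴴ = 1 := fun l => mul_eq_one_comm.mp (hV l)
  have hC' : ∀ l, C l * (C l)ᴴ = 1 := fun l => mul_eq_one_comm.mp (hf.hC l)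
  have h1 : ∀ l, ∑ k, Λ l (J l k) ≤ (Yᴴ * (V l * dg (Λ l) * (V l)ᴴ) * Y).trace.re := by
    intro l
    have hM : ((V l)ᴴ * (Y * C l))ᴴ * ((V l)ᴴ * (Y * C l)) = 1 := by
      simp only [conjTranspose_mul, conjTranspose_conjTranspose, Matrix.mul_assoc]
      rw [← Matrix.mul_assoc (V l) _ _, hV', Matrix.one_mul, ← Matrix.mul_assoc Yᴴ, hf.hY, Matrix.one_mul, hf.hC]
    refine (tr_lower (hanti l) hM (hf.hz l)).trans (le_of_eq ?_)
    congr 1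
    simp only [conjTranspose_mul, conjTranspose_conjTranspose, Matrix.mul_assoc]
    rw [Matrix.trace_mul_comm]
    simp only [Matrix.mul_assoc, hC', Matrix.mul_one]
  calc TJ J Λ ≤ ∑ l, (Yᴴ * (V l * dg (Λ l) * (V l)ᴴ) * Y).trace.re := Finset.sum_le_sum fun l _ => h1 l
    _ = (Yᴴ * (∑ l, V l * dg (Λ l) * (V l)ᴴ) * Y).trace.re := by
      rw [Matrix.mul_sum, Matrix.sum_mul, Matrix.trace_sum, Complex.re_sum]
    _ = d * t := by
      rw [hsum]
      simp [hf.hY, mul_comm]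

end KC

open Module

set_option linter.all false

namespace KC
open Matrix ComplexOrder

theorem one_le_det_one_add {κ : Type} [Fintype κ] [DecidableEq κ] {P : Matrix κ κ ℂ} (hP : P.PosSemidef) :
    1 ≤ (1 + P).det.re := by
  have hH := hP.1
  have h1 : P = (hH.eigenvectorUnitary : Matrix κ κ ℂ) * diagonal (fun i => (hH.eigenvalues i : ℂ)) * star (hH.eigenvectorUnitary : Matrix κ κ ℂ) := by
    conv_lhs => rw [hH.spectral_theorem]
    rfl
  have hU : (hH.eigenvectorUnitary : Matrix κ κ ℂ) * star (hH.eigenvectorUnitary : Matrix κ κ ℂ) = 1 :=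
    Unitary.mul_star_self_of_mem hH.eigenvectorUnitary.2
  have h2 : 1 + P = (hH.eigenvectorUnitary : Matrix κ κ ℂ) * (diagonal (fun i => ((1 + hH.eigenvalues i : ℝ) : ℂ))) * star (hH.eigenvectorUnitary : Matrix κ κ ℂ) := by
    have h3 : diagonal (fun i => ((1 + hH.eigenvalues i : ℝ) : ℂ)) = 1 + diagonal (fun i => (hH.eigenvalues i : ℂ)) := by
      rw [← diagonal_one, diagonal_add]; congr 1; ext i; push_cast; rfl
    rw [h3, mul_add, add_mul, mul_one, hU, ← h1]
  rw [h2, det_mul, det_mul, mul_right_comm, ← det_mul, hU, det_one, one_mul, det_diagonal]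
  rw [← Complex.ofReal_prod, Complex.ofReal_re]
  have h4 : ∏ i : κ, (1:ℝ) ≤ ∏ i, (1 + hH.eigenvalues i) :=
    Finset.prod_le_prod (fun _ _ => zero_le_one) (fun i _ => by have := hP.eigenvalues_nonneg i; linarith)
  simpa using h4

theorem det_add_ge {κ : Type} [Fintype κ] [DecidableEq κ] (C P : Matrix κ κ ℂ) (hP : P.PosSemidef) :
    ‖C.det‖^2 ≤ (Cᴴ * C + P).det.re := by
  by_cases hC : C.det = 0
  · rw [hC]
    have h := ((posSemidef_conjTranspose_mul_self C).add hP).det_nonneg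
    have := (Complex.le_def.1 h).1
    simpa using this
  · have hu : IsUnit C.det := isUnit_iff_ne_zero.mpr hC
    have h1 : Cᴴ * C + P = Cᴴ * (1 + C⁻¹ᴴ * P * C⁻¹) * C := by
      rw [mul_add, add_mul, mul_one]
      congr 1
      rw [← mul_assoc, ← mul_assoc, ← conjTranspose_mul, nonsing_inv_mul _ hu, conjTranspose_one, one_mul,
        mul_assoc, nonsing_inv_mul _ hu, mul_one]
    have h2 := one_le_det_one_add (hP.conjTranspose_mul_mul_same C⁻¹)
    rw [h1, det_mul, det_mul, det_conjTranspose, mul_right_comm]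
    have h3 : star C.det * C.det = ((‖C.det‖^2 : ℝ) : ℂ) := by
      rw [mul_comm, Complex.star_def, Complex.mul_conj, Complex.normSq_eq_norm_sq]
    rw [h3, Complex.re_ofReal_mul]
    nlinarith [sq_nonneg ‖C.det‖]

theorem minor_le_det {r : ℕ} {κ : Type} [Fintype κ] [DecidableEq κ] (N : Matrix (Fin r) κ ℂ) (x : Fin r → ℝ)
    (ι : κ → Fin r) (hι : Function.Injective ι) :
    ‖(N.submatrix ι id).det‖^2 * Real.exp (∑ k, x (ι k)) ≤ (Nᴴ * dg (fun i => Real.exp (x i)) * N).det.re := by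
  classical
  set E : Matrix κ κ ℂ := diagonal (fun k => (Real.exp (x (ι k) / 2) : ℂ)) with hE
  set P : Matrix κ κ ℂ := Nᴴ * dg (fun i => if i ∈ Set.range ι then 0 else Real.exp (x i)) * N with hP
  have hPp : P.PosSemidef := by
    rw [hP]
    apply PosSemidef.conjTranspose_mul_mul_same
    unfold dg
    apply PosSemidef.diagonal
    intro i
    simp only [Pi.zero_apply]
    split_ifs
    · simp
    · exact_mod_cast (Real.exp_pos _).le
  have h := det_add_ge (E * N.submatrix ι id) P hPp
  have h1 : (E * N.submatrix ι id)ᴴ * (E * N.submatrix ι id) + P = Nᴴ * dg (fun i => Real.exp (x i)) * N := by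
    ext a b
    have key : ∀ y : Fin r → ℝ, (Nᴴ * dg y * N) a b = ∑ i, star (N i a) * y i * N i b := by
      intro y
      rw [mul_apply]
      apply Finset.sum_congr rfl
      intro i _
      simp [dg, mul_diagonal]
    rw [Matrix.add_apply, hP, key, key, mul_apply]
    have e1 : ∑ j, (E * N.submatrix ι id)ᴴ a j * (E * N.submatrix ι id) j b
        = ∑ j, star (N (ι j) a) * (Real.exp (x (ι j)) : ℂ) * N (ι j) b := by
      apply Finset.sum_congr rfl
      intro j _
      have : (Real.exp (x (ι j)) : ℂ) = Real.exp (x (ι j)/2) * Real.exp (x (ι j)/2) := by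
        rw [← Complex.ofReal_mul, ← Real.exp_add]; congr 2; ring
      rw [this]
      simp only [hE, conjTranspose_apply, diagonal_mul, submatrix_apply, id, star_mul', Complex.star_def, Complex.conj_ofReal]
      ring
    rw [e1]
    have e2 : ∑ j, star (N (ι j) a) * (Real.exp (x (ι j)) : ℂ) * N (ι j) b
       = ∑ i, if i ∈ Set.range ι then star (N i a) * (Real.exp (x i) : ℂ) * N i b else 0 := by
      rw [← Finset.sum_filter]
      rw [show (Finset.univ.filter (fun i => i ∈ Set.range ι)) = Finset.univ.image ι by ext; simp]
      rw [Finset.sum_image (fun _ _ _ _ h => hι h)]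
    rw [e2, ← Finset.sum_add_distrib]
    apply Finset.sum_congr rfl
    intro i _
    split_ifs <;> simp
  rw [h1] at h
  refine le_trans (le_of_eq ?_) h
  rw [det_mul, norm_mul, mul_pow, mul_comm]
  congr 1
  rw [hE, det_diagonal, ← Complex.ofReal_prod, ← Real.exp_sum, Complex.norm_real, Real.norm_eq_abs, sq_abs,
    ← Real.exp_nat_mul, ← Finset.sum_div]
  congr 1
  push_cast; ring

/-- Abel summation positivity. -/
theorem abel_nonneg {r : ℕ} {x : Fin r → ℝ} (hx : Antitone x) (A : ℕ → ℝ) (h0 : A 0 = 0) (hr : A r = 0)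
    (hA : ∀ m, m ≤ r → 0 ≤ A m) : 0 ≤ ∑ i : Fin r, x i * (A (i+1) - A i) := by
  cases r with
  | zero => simp
  | succ n =>
    have key : ∀ m (hm : m ≤ n), x ⟨m, by omega⟩ * A (m+1) ≤
        ∑ i ∈ Finset.range (m+1), (if h : i < n+1 then x ⟨i, h⟩ else 0) * (A (i+1) - A i) := by
      intro m
      induction m with
      | zero => intro hm; simp [h0]
      | succ k ih =>
        intro hm
        rw [Finset.sum_range_succ]
        have := ih (by omega)
        rw [dif_pos (by omega : k + 1 < n + 1)]
        have h2 : x ⟨k+1, by omega⟩ ≤ x ⟨k, by omega⟩ := hx (by simp)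
        nlinarith [hA (k+1) (by omega)]
    have := key n le_rfl
    rw [hr, mul_zero] at this
    rw [Finset.sum_range] at this
    simpa [Nat.lt_succ_iff.mp (Fin.is_lt _)] using this

end KC

open Module

set_option linter.all false

namespace KC
open Matrix ComplexOrder Filter Topology

theorem isFlag_Fl {r : ℕ} {x B : Matrix (Fin r) (Fin r) ℂ} (h : x * B = 1) : IsFlag r (Fl x) := by
  have h' : B * x = 1 := mul_eq_one_comm.mp h
  let b : Basis (Fin r) ℂ (Fin r → ℂ) := Basis.ofEquivFun (Matrix.toLin'OfInv h h').symm
  have hb : ∀ v i, b.repr v i = (x *ᵥ v) i := by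
    intro v i
    rw [← Basis.equivFun_apply, Basis.equivFun_ofEquivFun]
    rfl
  have : Fl x = bflag b := by
    funext j
    ext v
    rw [mem_Fl, mem_bflag]
    simp only [hb]
  rw [this]
  exact isFlag_bflag b

/-- first `j` columns -/
def Bj {r : ℕ} (B : Matrix (Fin r) (Fin r) ℂ) (j : ℕ) : Matrix (Fin r) {i : Fin r // (i : ℕ) < j} ℂ :=
  B.submatrix id Subtype.val

theorem card_kappa (r j : ℕ) : Fintype.card {i : Fin r // (i : ℕ) < j} = min j r := by
  rw [Fintype.card_subtype]
  rcases le_total j r with h | h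
  · rw [min_eq_left h]
    rw [Fin.card_filter_val_lt, min_eq_right h]
  · rw [min_eq_right h, Fin.card_filter_val_lt, min_eq_left h]

/-- the opposite flag of a matrix -/
def Gr {r : ℕ} (U : Matrix (Fin r) (Fin r) ℂ) : ℕ → Submodule ℂ (Fin r → ℂ) := Fl (Uᴴ.submatrix Fin.rev id)

theorem isFlag_Gr {r : ℕ} {U : Matrix (Fin r) (Fin r) ℂ} (h : Uᴴ * U = 1) : IsFlag r (Gr U) := by
  apply isFlag_Fl (B := U.submatrix id Fin.rev)
  have h2 : Uᴴ.submatrix Fin.rev id * U.submatrix id Fin.rev = (Uᴴ * U).submatrix Fin.rev Fin.rev := rfl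
  rw [h2, h]
  ext i j
  simp [one_apply]

theorem exists_minor {r : ℕ} {x B U : Matrix (Fin r) (Fin r) ℂ} (h : x * B = 1) (hU : Uᴴ * U = 1) (j : ℕ) :
    ∃ ι : {i : Fin r // (i : ℕ) < j} → Fin r, Function.Injective ι ∧
      ((Uᴴ * Bj B j).submatrix ι id).det ≠ 0 ∧
      ∀ m, m ≤ r → (Finset.univ.filter (fun k => (ι k : ℕ) < m)).card + dm (Fl x) (Gr U (r - m)) j = min j r := by
  classical
  have hF := isFlag_Fl h
  have hG := isFlag_Gr hU
  have hr := hF.rank j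
  obtain ⟨J, hJ⟩ := exists_type hG (Fl x j) hr
  let e : {i : Fin r // (i : ℕ) < j} ≃ Fin (min j r) := Fintype.equivFinOfCardEq (card_kappa r j)
  refine ⟨fun k => Fin.rev (J (e k)), ?_, ?_, ?_⟩
  · intro a b hab
    exact e.injective (hJ.sm.injective (Fin.rev_injective hab))
  · intro hdet
    obtain ⟨c, hc0, hc⟩ := Matrix.exists_mulVec_eq_zero_iff.mpr hdet
    set v := Bj B j *ᵥ c with hv
    have hvF : v ∈ Fl x j := by
      rw [mem_Fl]
      intro i hi
      have : x *ᵥ v = (x * Bj B j) *ᵥ c := by rw [hv, mulVec_mulVec]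
      rw [this]
      have h2 : x * Bj B j = (1 : Matrix (Fin r) (Fin r) ℂ).submatrix id Subtype.val := by
        rw [← h]; rfl
      rw [h2]
      simp only [mulVec, dotProduct]
      apply Finset.sum_eq_zero
      intro k _
      rw [submatrix_apply, id, one_apply_ne, zero_mul]
      intro hik
      have := k.2
      rw [← hik] at this
      omega
    have hv0 : v ≠ 0 := by
      intro h0
      apply hc0
      have : x *ᵥ v = (x * Bj B j) *ᵥ c := by rw [hv, mulVec_mulVec]
      rw [h0, mulVec_zero] at this
      have h2 : x * Bj B j = (1 : Matrix (Fin r) (Fin r) ℂ).submatrix id Subtype.val := by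
        rw [← h]; rfl
      rw [h2] at this
      funext k
      have h3 := congrFun this.symm k.1
      simp only [mulVec, dotProduct, submatrix_apply, id, one_apply] at h3
      rw [Finset.sum_eq_single k] at h3
      · simpa using h3
      · intro b _ hb
        rw [if_neg (fun hh => hb (Subtype.ext hh.symm)), zero_mul]
      · simp
    -- pick the level of v
    have hex : ∃ m, v ∈ Gr U m := ⟨r, by rw [hG.top le_rfl]; trivial⟩
    obtain ⟨m, hm, hmin⟩ : ∃ m, v ∈ Gr U m ∧ ∀ m' < m, v ∉ Gr U m' :=
      ⟨Nat.find hex, Nat.find_spec hex, fun m' hm' => Nat.find_min hex hm'⟩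
    have hm0 : m ≠ 0 := by
      rintro rfl
      rw [hG.bot] at hm
      exact hv0 (by simpa using hm)
    obtain ⟨n, rfl⟩ := Nat.exists_eq_succ_of_ne_zero hm0
    have hn := hmin n (Nat.lt_succ_self n)
    have hlt : dm (Gr U) (Fl x j) n < dm (Gr U) (Fl x j) (n+1) := by
      apply Submodule.finrank_lt_finrank_of_lt
      refine lt_of_le_of_ne (inf_le_inf_left _ (hG.mono (Nat.le_succ n))) ?_
      intro heq
      have : v ∈ Fl x j ⊓ Gr U (n+1) := ⟨hvF, hm⟩
      rw [← heq] at this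
      exact hn this.2
    rw [hJ.cnt, hJ.cnt] at hlt
    have : ∃ k, (J k : ℕ) = n := by
      by_contra hcon
      push Not at hcon
      apply absurd hlt
      rw [not_lt]
      apply Finset.card_le_card
      intro k hk
      simp only [Finset.mem_filter, Finset.mem_univ, true_and] at hk ⊢
      have := hcon k
      omega
    obtain ⟨k, hk⟩ := this
    apply hn
    have hz := congrFun hc (e.symm k)
    change v ∈ Fl _ _ at hm
    change v ∈ Fl _ _
    rw [mem_Fl] at hm ⊢
    intro i hi
    by_cases hi' : n + 1 ≤ i
    · exact hm i hi'
    have hik : i = J k := Fin.ext (by omega)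
    subst hik
    have e1 : ((Uᴴ * Bj B j).submatrix (fun k => Fin.rev (J (e k))) id *ᵥ c) (e.symm k) = (Uᴴ *ᵥ v) (Fin.rev (J k)) := by
      rw [hv, mulVec_mulVec]
      simp [mulVec, dotProduct]
    rw [e1] at hz
    exact hz
  · intro m hm
    have h1 : dm (Fl x) (Gr U (r-m)) j = dm (Gr U) (Fl x j) (r-m) := by
      unfold dm; rw [inf_comm]
    rw [h1, hJ.cnt]
    have h2 : (Finset.univ.filter (fun k => ((Fin.rev (J (e k)) : Fin r) : ℕ) < m)).card
        = (Finset.univ.filter (fun k => ¬ ((J k : ℕ) < r - m))).card := by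
      apply Finset.card_equiv e
      intro k
      simp only [Finset.mem_filter, Finset.mem_univ, true_and, Fin.val_rev]
      have := (J (e k)).2
      omega
    rw [h2, add_comm, Finset.card_filter_add_card_filter_not, Finset.card_univ, Fintype.card_fin]

noncomputable def Lf {r : ℕ} (B h : Matrix (Fin r) (Fin r) ℂ) (j : ℕ) : ℝ :=
  Real.log ((Bj B j)ᴴ * h * Bj B j).det.re

theorem det_conj {r : ℕ} {U : Matrix (Fin r) (Fin r) ℂ} (hU : Uᴴ * U = 1) (x : Fin r → ℝ) :
    (U * dg (fun i => Real.exp (x i)) * Uᴴ).det = (Real.exp (∑ i, x i) : ℝ) := by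
  rw [det_mul, det_mul, mul_right_comm, ← det_mul, mul_eq_one_comm.mp hU, det_one, one_mul, dg, det_diagonal,
    Real.exp_sum, Complex.ofReal_prod]

theorem local_bound {r : ℕ} {x B U0 : Matrix (Fin r) (Fin r) ℂ} (h : x * B = 1) (hU0 : U0ᴴ * U0 = 1) (j : ℕ) :
    ∃ (ι : {i : Fin r // (i : ℕ) < j} → Fin r) (e : ℝ),
      (∀ m, m ≤ r → (Finset.univ.filter (fun k => (ι k : ℕ) < m)).card + dm (Fl x) (Gr U0 (r - m)) j = min j r) ∧
      ∀ᶠ U in 𝓝 U0, Uᴴ * U = 1 → ∀ y : Fin r → ℝ,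
        (∑ k, y (ι k)) + e ≤ Lf B (U * dg (fun i => Real.exp (y i)) * Uᴴ) j ∧
        ((j = 0 ∨ r ≤ j) → Lf B (U * dg (fun i => Real.exp (y i)) * Uᴴ) j = (∑ k, y (ι k)) + e) := by
  classical
  obtain ⟨ι, hι, hdet, hcnt⟩ := exists_minor h hU0 j
  by_cases hj0 : j = 0
  · subst hj0
    refine ⟨ι, 0, hcnt, Eventually.of_forall ?_⟩
    intro U hU y
    haveI : IsEmpty {i : Fin r // (i : ℕ) < 0} := ⟨fun i => absurd i.2 (by omega)⟩
    have : Lf B (U * dg (fun i => Real.exp (y i)) * Uᴴ) 0 = 0 := by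
      unfold Lf
      rw [det_isEmpty]; simp
    simp [this]
  by_cases hjr : r ≤ j
  · refine ⟨ι, Real.log (‖B.det‖^2), hcnt, Eventually.of_forall ?_⟩
    intro U hU y
    let e : {i : Fin r // (i : ℕ) < j} ≃ Fin r := Equiv.subtypeUnivEquiv (fun i => by omega)
    have hbij : Function.Bijective ι := (Fintype.bijective_iff_injective_and_card ι).mpr ⟨hι, Fintype.card_congr e⟩
    have hsum : ∑ k, y (ι k) = ∑ i, y i := hbij.sum_comp y
    have hBd : B.det ≠ 0 := by
      intro h0
      have := congrArg det h
      rw [det_mul, h0, mul_zero, det_one] at this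
      exact zero_ne_one this
    have : Lf B (U * dg (fun i => Real.exp (y i)) * Uᴴ) j = (∑ k, y (ι k)) + Real.log (‖B.det‖^2) := by
      unfold Lf
      have h1 : (Bj B j)ᴴ * (U * dg (fun i => Real.exp (y i)) * Uᴴ) * Bj B j
          = (Bᴴ * (U * dg (fun i => Real.exp (y i)) * Uᴴ) * B).submatrix e e := rfl
      rw [h1, det_submatrix_equiv_self, det_mul, det_mul, det_conj hU, det_conjTranspose, mul_right_comm]
      have h3 : star B.det * B.det = ((‖B.det‖^2 : ℝ) : ℂ) := by
        rw [mul_comm, Complex.star_def, Complex.mul_conj, Complex.normSq_eq_norm_sq]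
      rw [h3, ← Complex.ofReal_mul, Complex.ofReal_re, Real.log_mul (by positivity) (Real.exp_pos _).ne', Real.log_exp,
        hsum, add_comm]
    rw [this]
    exact ⟨le_rfl, fun _ => rfl⟩
  · set c := ‖((U0ᴴ * Bj B j).submatrix ι id).det‖ with hc
    have hcpos : 0 < c := norm_pos_iff.mpr hdet
    refine ⟨ι, Real.log ((c/2)^2), hcnt, ?_⟩
    have hcont : Continuous (fun U : Matrix (Fin r) (Fin r) ℂ => ‖((Uᴴ * Bj B j).submatrix ι id).det‖) := by
      apply Continuous.norm
      apply Continuous.matrix_det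
      apply Continuous.matrix_submatrix
      exact (continuous_id.matrix_conjTranspose).matrix_mul continuous_const
    have hev : ∀ᶠ U in 𝓝 U0, c/2 < ‖((Uᴴ * Bj B j).submatrix ι id).det‖ :=
      hcont.continuousAt.eventually (lt_mem_nhds (by change c/2 < c; linarith))
    filter_upwards [hev] with U hUc hU y
    refine ⟨?_, fun hh => absurd hh (by tauto)⟩
    have hm := minor_le_det (Uᴴ * Bj B j) y ι hι
    have h1 : (Uᴴ * Bj B j)ᴴ * dg (fun i => Real.exp (y i)) * (Uᴴ * Bj B j)
        = (Bj B j)ᴴ * (U * dg (fun i => Real.exp (y i)) * Uᴴ) * Bj B j := by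
      rw [conjTranspose_mul, conjTranspose_conjTranspose]
      simp only [Matrix.mul_assoc]
    rw [h1] at hm
    unfold Lf
    rw [add_comm, ← Real.log_exp (∑ k, y (ι k)), ← Real.log_mul (by positivity) (Real.exp_pos _).ne']
    apply Real.log_le_log (by positivity)
    refine le_trans ?_ hm
    gcongr

end KC

open Module

set_option linter.all false

namespace KC
open Matrix ComplexOrder Filter Topology

noncomputable def ff {s r : ℕ} (B : Fin s → Matrix (Fin r) (Fin r) ℂ) (Λ : Fin s → Fin r → ℝ) (t : ℝ)
    (h : Matrix (Fin r) (Fin r) ℂ) : ℝ :=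
  ∑ l, ∑ j : Fin r, Λ l j * (Lf (B l) h (j+1) - Lf (B l) h j) - t * Real.log h.det.re

theorem sum_comp_cnt {r : ℕ} {κ : Type} [Fintype κ] (ι : κ → Fin r) (y : Fin r → ℝ) :
    ∑ k, y (ι k) = ∑ i : Fin r, y i * (((Finset.univ.filter (fun k => (ι k : ℕ) < (i:ℕ)+1)).card : ℝ)
      - ((Finset.univ.filter (fun k => (ι k : ℕ) < (i:ℕ))).card : ℝ)) := by
  classical
  rw [← Finset.sum_fiberwise Finset.univ ι (fun k => y (ι k))]
  apply Finset.sum_congr rfl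
  intro i _
  rw [Finset.sum_congr rfl (g := fun _ => y i) (fun k hk => by rw [(Finset.mem_filter.mp hk).2]),
    Finset.sum_const, nsmul_eq_mul, mul_comm]
  congr 1
  have : (Finset.univ.filter (fun k => (ι k : ℕ) < (i:ℕ)+1)) =
      (Finset.univ.filter (fun k => (ι k : ℕ) < (i:ℕ))) ∪ (Finset.univ.filter (fun k => ι k = i)) := by
    ext k
    simp only [Finset.mem_filter, Finset.mem_univ, true_and, Finset.mem_union, Fin.ext_iff]
    omega
  rw [this, Finset.card_union_of_disjoint]
  · push_cast; ring
  · rw [Finset.disjoint_filter]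
    intro k _ h1 h2
    rw [h2] at h1
    omega

theorem lower_bound {s r : ℕ} {x B : Fin s → Matrix (Fin r) (Fin r) ℂ} (hx : ∀ l, x l * B l = 1)
    {Λ : Fin s → Fin r → ℝ} {t : ℝ} (hΛ : ∀ l, Antitone (Λ l)) (hT : TT Λ = r * t)
    (hss : ∀ S : Submodule ℂ (Fin r → ℂ), ∑ l, deg (Fl (x l)) (Λ l) S ≤ finrank ℂ S * t) :
    ∃ C, ∀ U : Matrix (Fin r) (Fin r) ℂ, Uᴴ * U = 1 → ∀ y : Fin r → ℝ, Antitone y →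
      C ≤ ff B Λ t (U * dg (fun i => Real.exp (y i)) * Uᴴ) := by
  classical
  have hK := isCompact_isometries r r
  have := hK.induction_on (p := fun K => ∃ C, ∀ U ∈ K, Uᴴ * U = 1 → ∀ y : Fin r → ℝ, Antitone y →
      C ≤ ff B Λ t (U * dg (fun i => Real.exp (y i)) * Uᴴ)) ⟨0, fun U hU => absurd hU (Set.notMem_empty _)⟩
      ?_ ?_ ?_
  · obtain ⟨C, hC⟩ := this
    exact ⟨C, fun U hU => hC U hU hU⟩
  · rintro K K' hKK ⟨C, hC⟩
    exact ⟨C, fun U hU => hC U (hKK hU)⟩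
  · rintro K K' ⟨C, hC⟩ ⟨C', hC'⟩
    refine ⟨min C C', ?_⟩
    rintro U (hU | hU) h1 y hy
    · exact (min_le_left _ _).trans (hC U hU h1 y hy)
    · exact (min_le_right _ _).trans (hC' U hU h1 y hy)
  intro U0 hU0
  have hb := fun l j => local_bound (hx l) hU0 j
  choose ι e hcnt hev using hb
  have hev' : ∀ᶠ U in 𝓝 U0, ∀ l, ∀ j : Fin (r+1), Uᴴ * U = 1 → ∀ y : Fin r → ℝ,
        (∑ k, y (ι l j k)) + e l j ≤ Lf (B l) (U * dg (fun i => Real.exp (y i)) * Uᴴ) j ∧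
        (((j:ℕ) = 0 ∨ r ≤ j) → Lf (B l) (U * dg (fun i => Real.exp (y i)) * Uᴴ) j = (∑ k, y (ι l j k)) + e l j) :=
    eventually_all.mpr fun l => eventually_all.mpr fun j => hev l j
  refine ⟨_, mem_nhdsWithin_of_mem_nhds hev', ∑ l, ∑ j : Fin r, Λ l j * (e l (j+1) - e l j), ?_⟩
  intro U hUK hU y hy
  have hl := fun l (j : ℕ) (hj : j ≤ r) => hUK l ⟨j, by omega⟩ hU y
  set h := U * dg (fun i => Real.exp (y i)) * Uᴴ with hh
  simp only at hl
  have step1 : ∀ l, ∑ j : Fin r, Λ l j * ((∑ k, y (ι l (j+1) k)) - ∑ k, y (ι l j k))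
      + ∑ j : Fin r, Λ l j * (e l (j+1) - e l j) ≤ ∑ j : Fin r, Λ l j * (Lf (B l) h (j+1) - Lf (B l) h j) := by
    intro l
    have := abel_nonneg (hΛ l) (fun j => Lf (B l) h j - (∑ k, y (ι l j k)) - e l j)
      (by rw [(hl l 0 (by omega)).2 (Or.inl rfl)]; ring) (by rw [(hl l r le_rfl).2 (Or.inr le_rfl)]; ring)
      (fun m hm => by have := (hl l m hm).1; linarith)
    rw [← sub_nonneg, ← Finset.sum_add_distrib, ← Finset.sum_sub_distrib]
    refine this.trans (le_of_eq ?_)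
    apply Finset.sum_congr rfl
    intro i _
    ring
  set c : Fin s → ℕ → ℕ → ℝ := fun l j m => ((Finset.univ.filter (fun k => (ι l j k : ℕ) < m)).card : ℝ) with hc
  have hMc : ∀ l j, ∑ k, y (ι l j k) = ∑ i : Fin r, y i * (c l j (i+1) - c l j i) := fun l j => sum_comp_cnt _ _
  set A : ℕ → ℝ := fun m => ∑ l, ∑ j : Fin r, Λ l j * (c l (j+1) m - c l j m) - t * m with hA
  have hAe : ∀ m, m ≤ r → A m = r * t - ∑ l, deg (Fl (x l)) (Λ l) (Gr U0 (r-m)) - t * m := by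
    intro m hm
    simp only [hA]
    congr 1
    rw [← hT, TT, ← Finset.sum_sub_distrib]
    apply Finset.sum_congr rfl
    intro l _
    rw [deg, ← Finset.sum_sub_distrib]
    apply Finset.sum_congr rfl
    intro j _
    have h1 := hcnt l (j+1) m hm
    have h2 := hcnt l j m hm
    rw [min_eq_left (by omega)] at h1 h2
    have h1' : c l (j+1) m + dm (Fl (x l)) (Gr U0 (r-m)) (j+1) = (j:ℝ) + 1 := by
      simp only [hc]; exact_mod_cast h1
    have h2' : c l j m + dm (Fl (x l)) (Gr U0 (r-m)) j = (j:ℝ) := by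
      simp only [hc]; exact_mod_cast h2
    rw [eq_sub_of_add_eq h1', eq_sub_of_add_eq h2']
    ring
  have hG := isFlag_Gr (U := U0) hU0
  have hA0 : ∀ m, m ≤ r → 0 ≤ A m := by
    intro m hm
    rw [hAe m hm]
    have := hss (Gr U0 (r-m))
    rw [hG.rank, min_eq_left (by omega), Nat.cast_sub hm] at this
    linarith
  have hAr : A r = 0 := by
    rw [hAe r le_rfl, Nat.sub_self, hG.bot]
    have hz : ∀ l, deg (Fl (x l)) (Λ l) ⊥ = 0 := by
      intro l
      have : ∀ j, dm (Fl (x l)) ⊥ j = 0 := fun j => by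
        unfold dm; rw [bot_inf_eq]; exact finrank_bot _ _
      simp [deg, this]
    simp only [hz, Finset.sum_const_zero]
    ring
  have hA00 : A 0 = 0 := by
    rw [hAe 0 (Nat.zero_le _), Nat.sub_zero, hG.top le_rfl]
    have : ∑ l, deg (Fl (x l)) (Λ l) ⊤ = r * t := by
      rw [← hT, TT]
      apply Finset.sum_congr rfl
      intro l _
      rw [deg]
      apply Finset.sum_congr rfl
      intro j _
      rw [dm_full (isFlag_Fl (hx l)), dm_full (isFlag_Fl (hx l)), min_eq_left (by omega), min_eq_left (by omega)]
      push_cast; ring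
    rw [this]; simp
  have hfin := abel_nonneg hy A hA00 hAr hA0
  have step2 : ∑ i : Fin r, y i * (A (i+1) - A i) =
      ∑ l, ∑ j : Fin r, Λ l j * ((∑ k, y (ι l (j+1) k)) - ∑ k, y (ι l j k)) - t * ∑ i, y i := by
    simp only [hMc, hA]
    rw [Finset.mul_sum]
    have : ∑ l, ∑ j : Fin r, Λ l j * (∑ i : Fin r, y i * (c l (j+1) (i+1) - c l (j+1) i) -
        ∑ i : Fin r, y i * (c l j (i+1) - c l j i)) =
        ∑ i : Fin r, ∑ l, ∑ j : Fin r, Λ l j * (y i * (c l (j+1) (i+1) - c l (j+1) i) - y i * (c l j (i+1) - c l j i)) := by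
      symm
      rw [Finset.sum_comm]
      apply Finset.sum_congr rfl
      intro l _
      rw [Finset.sum_comm]
      apply Finset.sum_congr rfl
      intro j _
      rw [← Finset.sum_sub_distrib, Finset.mul_sum]
    rw [this, ← Finset.sum_sub_distrib]
    apply Finset.sum_congr rfl
    intro i _
    rw [mul_sub]
    rw [mul_sub, Finset.mul_sum, mul_sub, Finset.mul_sum]
    simp only [Finset.mul_sum]
    have : ∀ a b c d e: ℝ, c - d = e → a - b = 0 → a - b + (c - d) = e := by intros; linarith
    push_cast
    have e3 : ∑ l, ∑ j : Fin r, y i * (Λ l j * (c l (j+1) (i+1) - c l j (i+1))) - ∑ l, ∑ j : Fin r, y i * (Λ l j * (c l (j+1) i - c l j i))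
      = ∑ l, ∑ j : Fin r, Λ l j * (y i * (c l (j+1) (i+1) - c l (j+1) i) - y i * (c l j (i+1) - c l j i)) := by
      rw [← Finset.sum_sub_distrib]
      apply Finset.sum_congr rfl
      intro l _
      rw [← Finset.sum_sub_distrib]
      apply Finset.sum_congr rfl
      intro j _
      ring
    rw [← e3]
    ring
  unfold ff
  rw [hh, det_conj hU, Complex.ofReal_re, Real.log_exp, ← hh]
  have := Finset.sum_le_sum (fun l (_ : l ∈ Finset.univ) => step1 l)
  rw [Finset.sum_add_distrib] at this
  linarith

end KC

open Module

set_option linter.all false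

namespace KC
open Matrix ComplexOrder Filter Topology

theorem posdef_form {r : ℕ} {h : Matrix (Fin r) (Fin r) ℂ} (hh : h.PosDef) :
    ∃ (U : Matrix (Fin r) (Fin r) ℂ) (y : Fin r → ℝ), Uᴴ * U = 1 ∧ h = U * dg (fun i => Real.exp (y i)) * Uᴴ := by
  have hH := hh.1
  have h1 : h = (hH.eigenvectorUnitary : Matrix (Fin r) (Fin r) ℂ) * diagonal (fun i => (hH.eigenvalues i : ℂ)) * star (hH.eigenvectorUnitary : Matrix (Fin r) (Fin r) ℂ) := by
    conv_lhs => rw [hH.spectral_theorem]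
    rfl
  refine ⟨hH.eigenvectorUnitary, fun i => Real.log (hH.eigenvalues i), ?_, ?_⟩
  · exact Unitary.star_mul_self_of_mem hH.eigenvectorUnitary.2
  · conv_lhs => rw [h1]
    congr 2
    unfold dg
    congr 1
    ext i
    show _ = ((Real.exp (Real.log (hH.eigenvalues i)) : ℝ) : ℂ)
    rw [Real.exp_log (hh.eigenvalues_pos i)]

theorem dg_perm {r : ℕ} (U : Matrix (Fin r) (Fin r) ℂ) (y : Fin r → ℝ) (p : Equiv.Perm (Fin r)) :
    (U.submatrix id p) * dg (y ∘ p) * (U.submatrix id p)ᴴ = U * dg y * Uᴴ := by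
  have h1 : dg (y ∘ p) = (dg y).submatrix p p := by
    unfold dg; rw [submatrix_diagonal_equiv]; rfl
  rw [h1, conjTranspose_submatrix, submatrix_mul_equiv U (dg y) id p p, submatrix_mul_equiv (U * dg y) Uᴴ id p id, submatrix_id_id]

theorem antitone_form {r : ℕ} {U : Matrix (Fin r) (Fin r) ℂ} (hU : Uᴴ * U = 1) (y : Fin r → ℝ) :
    ∃ (U' : Matrix (Fin r) (Fin r) ℂ) (y' : Fin r → ℝ), U'ᴴ * U' = 1 ∧ Antitone y' ∧
      U * dg (fun i => Real.exp (y i)) * Uᴴ = U' * dg (fun i => Real.exp (y' i)) * U'ᴴ := by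
  let p := Tuple.sort (fun i => - y i)
  have hp := Tuple.monotone_sort (fun i => - y i)
  refine ⟨U.submatrix id p, y ∘ p, ?_, ?_, ?_⟩
  · rw [conjTranspose_submatrix]
    have : Uᴴ.submatrix p id * U.submatrix id p = (Uᴴ * U).submatrix p p := rfl
    rw [this, hU]
    ext i j
    simp [one_apply]
  · intro i j hij
    have := hp hij
    simp only [Function.comp] at this ⊢
    linarith
  · exact (dg_perm U (fun i => Real.exp (y i)) p).symm

noncomputable def GG {s r : ℕ} (B : Fin s → Matrix (Fin r) (Fin r) ℂ) (Λ : Fin s → Fin r → ℝ) (t δ : ℝ)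
    (h : Matrix (Fin r) (Fin r) ℂ) : ℝ :=
  ff B Λ t h + δ * (h.trace.re - Real.log h.det.re)

theorem trace_conj {r : ℕ} {U : Matrix (Fin r) (Fin r) ℂ} (hU : Uᴴ * U = 1) (x : Fin r → ℝ) :
    (U * dg (fun i => Real.exp (x i)) * Uᴴ).trace.re = ∑ i, Real.exp (x i) := by
  rw [trace_mul_comm, ← mul_assoc, hU, one_mul, dg, trace_diagonal, Complex.re_sum]
  simp only [Complex.ofReal_re]

theorem GG_conj {s r : ℕ} (B : Fin s → Matrix (Fin r) (Fin r) ℂ) (Λ : Fin s → Fin r → ℝ) (t δ : ℝ)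
    {U : Matrix (Fin r) (Fin r) ℂ} (hU : Uᴴ * U = 1) (y : Fin r → ℝ) :
    GG B Λ t δ (U * dg (fun i => Real.exp (y i)) * Uᴴ) =
      ff B Λ t (U * dg (fun i => Real.exp (y i)) * Uᴴ) + δ * ∑ i, (Real.exp (y i) - y i) := by
  unfold GG
  rw [trace_conj hU, det_conj hU, Complex.ofReal_re, Real.log_exp, Finset.sum_sub_distrib]

theorem exp_sub_ge (y : ℝ) : Real.exp y / 2 ≤ Real.exp y - y := by
  have h2 : (2:ℝ) * Real.exp (y - Real.log 2) = Real.exp y := by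
    rw [Real.exp_sub, Real.exp_log (by norm_num)]; ring
  have h3 := Real.add_one_le_exp (y - Real.log 2)
  have h4 : Real.log 2 ≤ 1 := by have := Real.log_le_sub_one_of_pos (show (0:ℝ) < 2 by norm_num); linarith
  linarith

theorem abs_le_exp_sub (y : ℝ) : |y| ≤ Real.exp y - y := by
  have := exp_sub_ge y
  have := Real.exp_pos y
  rw [abs_le]; constructor <;> linarith

theorem det_pos_aux {r : ℕ} {x B U : Matrix (Fin r) (Fin r) ℂ} (h : x * B = 1) (hU : Uᴴ * U = 1) (j : ℕ) (y : Fin r → ℝ) :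
    0 < ((Bj B j)ᴴ * (U * dg (fun i => Real.exp (y i)) * Uᴴ) * Bj B j).det.re := by
  obtain ⟨ι, hι, hdet, -⟩ := exists_minor h hU j
  have hm := minor_le_det (Uᴴ * Bj B j) y ι hι
  have h1 : (Uᴴ * Bj B j)ᴴ * dg (fun i => Real.exp (y i)) * (Uᴴ * Bj B j)
        = (Bj B j)ᴴ * (U * dg (fun i => Real.exp (y i)) * Uᴴ) * Bj B j := by
      rw [conjTranspose_mul, conjTranspose_conjTranspose]
      simp only [Matrix.mul_assoc]
  rw [h1] at hm
  have := norm_pos_iff.mpr hdet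
  exact lt_of_lt_of_le (by positivity) hm

theorem continuous_dg_exp {r : ℕ} : Continuous (fun p : Matrix (Fin r) (Fin r) ℂ × (Fin r → ℝ) =>
    p.1 * dg (fun i => Real.exp (p.2 i)) * p.1ᴴ) := by
  have h1 : Continuous (fun p : Matrix (Fin r) (Fin r) ℂ × (Fin r → ℝ) => dg (fun i => Real.exp (p.2 i))) := by
    unfold dg
    apply Continuous.matrix_diagonal
    fun_prop
  exact (continuous_fst.matrix_mul h1).matrix_mul continuous_fst.matrix_conjTranspose

theorem exists_min {s r : ℕ} {x B : Fin s → Matrix (Fin r) (Fin r) ℂ} (hx : ∀ l, x l * B l = 1)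
    {Λ : Fin s → Fin r → ℝ} {t : ℝ} {C : ℝ} (hC : ∀ U : Matrix (Fin r) (Fin r) ℂ, Uᴴ * U = 1 → ∀ y : Fin r → ℝ,
      C ≤ ff B Λ t (U * dg (fun i => Real.exp (y i)) * Uᴴ)) {δ : ℝ} (hδ : 0 < δ) :
    ∃ (U0 : Matrix (Fin r) (Fin r) ℂ) (y0 : Fin r → ℝ), U0ᴴ * U0 = 1 ∧
      ∀ U : Matrix (Fin r) (Fin r) ℂ, Uᴴ * U = 1 → ∀ y : Fin r → ℝ,
       GG B Λ t δ (U0 * dg (fun i => Real.exp (y0 i)) * U0ᴴ) ≤ GG B Λ t δ (U * dg (fun i => Real.exp (y i)) * Uᴴ) := by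
  set M := (GG B Λ t δ ((1 : Matrix (Fin r) (Fin r) ℂ) * dg (fun i => Real.exp ((0 : Fin r → ℝ) i)) * (1 : Matrix (Fin r) (Fin r) ℂ)ᴴ) - C) / δ with hM
  have h1 : (1 : Matrix (Fin r) (Fin r) ℂ)ᴴ * 1 = 1 := by simp
  have hRn : ∀ y : Fin r → ℝ, ∀ i, |y i| ≤ ∑ i, (Real.exp (y i) - y i) := by
    intro y i
    refine (abs_le_exp_sub (y i)).trans ?_
    exact Finset.single_le_sum (f := fun i => Real.exp (y i) - y i) (fun i _ => (abs_nonneg _).trans (abs_le_exp_sub (y i))) (Finset.mem_univ i)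
  have hMout : ∀ U : Matrix (Fin r) (Fin r) ℂ, Uᴴ * U = 1 → ∀ y : Fin r → ℝ,
      GG B Λ t δ (U * dg (fun i => Real.exp (y i)) * Uᴴ) ≤ GG B Λ t δ ((1 : Matrix (Fin r) (Fin r) ℂ) * dg (fun i => Real.exp ((0 : Fin r → ℝ) i)) * (1 : Matrix (Fin r) (Fin r) ℂ)ᴴ) → ∀ i, |y i| ≤ M := by
    intro U hU y hle i
    refine (hRn y i).trans ?_
    rw [hM, le_div_iff₀ hδ]
    rw [GG_conj _ _ _ _ hU] at hle
    have := hC U hU y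
    linarith
  let K : Set (Matrix (Fin r) (Fin r) ℂ × (Fin r → ℝ)) := {U | Uᴴ * U = 1} ×ˢ (Set.univ.pi fun _ => Set.Icc (-M) M)
  have hKc : IsCompact K := (isCompact_isometries r r).prod (isCompact_univ_pi fun _ => isCompact_Icc)
  have hM0 : ∀ i : Fin r, |(0 : Fin r → ℝ) i| ≤ M := hMout 1 h1 0 le_rfl
  have hne : ((1 : Matrix (Fin r) (Fin r) ℂ), (0 : Fin r → ℝ)) ∈ K := ⟨h1, fun i _ => abs_le.mp (hM0 i)⟩
  have hcont : ContinuousOn (fun p : Matrix (Fin r) (Fin r) ℂ × (Fin r → ℝ) =>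
      GG B Λ t δ (p.1 * dg (fun i => Real.exp (p.2 i)) * p.1ᴴ)) K := by
    have hL : ∀ l j, ContinuousOn (fun p : Matrix (Fin r) (Fin r) ℂ × (Fin r → ℝ) =>
        Lf (B l) (p.1 * dg (fun i => Real.exp (p.2 i)) * p.1ᴴ) j) K := by
      intro l j
      unfold Lf
      apply ContinuousOn.log
      · apply Continuous.continuousOn
        apply Complex.continuous_re.comp
        apply Continuous.matrix_det
        exact (continuous_const.matrix_mul continuous_dg_exp).matrix_mul continuous_const
      · rintro ⟨U, y⟩ ⟨hU, -⟩
        exact (det_pos_aux (hx l) hU j y).ne'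
    have hD : ContinuousOn (fun p : Matrix (Fin r) (Fin r) ℂ × (Fin r → ℝ) =>
        Real.log (p.1 * dg (fun i => Real.exp (p.2 i)) * p.1ᴴ).det.re) K := by
      apply ContinuousOn.log
      · apply Continuous.continuousOn
        apply Complex.continuous_re.comp
        apply Continuous.matrix_det
        exact continuous_dg_exp
      · rintro ⟨U, y⟩ ⟨hU, -⟩
        simp only
        rw [det_conj hU, Complex.ofReal_re]
        exact (Real.exp_pos _).ne'
    have hTr : ContinuousOn (fun p : Matrix (Fin r) (Fin r) ℂ × (Fin r → ℝ) =>
        (p.1 * dg (fun i => Real.exp (p.2 i)) * p.1ᴴ).trace.re) K :=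
      (Complex.continuous_re.comp (continuous_dg_exp.matrix_trace)).continuousOn
    unfold GG ff
    apply ContinuousOn.add
    · apply ContinuousOn.sub
      · apply continuousOn_finset_sum
        intro l _
        apply continuousOn_finset_sum
        intro j _
        exact continuousOn_const.mul ((hL l _).sub (hL l _))
      · exact continuousOn_const.mul hD
    · exact continuousOn_const.mul (hTr.sub hD)
  obtain ⟨⟨U0, y0⟩, hmem, hmin⟩ := hKc.exists_isMinOn ⟨_, hne⟩ hcont
  refine ⟨U0, y0, hmem.1, ?_⟩
  intro U hU y
  have hmin' := isMinOn_iff.mp hmin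
  have hmin1 := hmin' _ hne
  by_cases hle : GG B Λ t δ (U * dg (fun i => Real.exp (y i)) * Uᴴ) ≤ GG B Λ t δ ((1 : Matrix (Fin r) (Fin r) ℂ) * dg (fun i => Real.exp ((0 : Fin r → ℝ) i)) * (1 : Matrix (Fin r) (Fin r) ℂ)ᴴ)
  · have := hMout U hU y hle
    exact hmin' (U, y) ⟨hU, fun i _ => abs_le.mp (this i)⟩
  · exact hmin1.trans (not_le.mp hle).le

end KC

open Module

set_option linter.all false

namespace KC
open Matrix ComplexOrder Filter Topology

theorem hasDerivAt_logdet {κ : Type} [Fintype κ] [DecidableEq κ] (Y : Matrix κ κ ℂ) :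
    HasDerivAt (fun τ : ℝ => Real.log (1 + (τ : ℂ) • Y).det.re) Y.trace.re 0 := by
  have h1 : HasDerivAt (fun z : ℂ => (1 + z • Y).det) Y.trace 0 := by
    set q := ((1 + (Polynomial.X : Polynomial ℂ) • Y.map Polynomial.C).det.divX.divX) with hq
    have e : (fun z : ℂ => (1 + z • Y).det) = fun z => 1 + Y.trace * z + q.eval z * z^2 := by
      funext z
      exact det_one_add_smul z Y
    rw [e]
    have hp := (q.hasDerivAt (0:ℂ)).mul ((hasDerivAt_id (0:ℂ)).pow 2)
    have hl := ((hasDerivAt_id (0:ℂ)).const_mul Y.trace).const_add 1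
    have := hl.add hp
    refine HasDerivAt.congr_deriv this ?_
    simp
  have h2 : HasDerivAt (fun τ : ℝ => (1 + (τ:ℂ) • Y).det.re) Y.trace.re 0 := by
    have := h1.real_of_complex (z := 0)
    simpa using this
  have h3 := h2.log (by simp)
  simpa using h3

theorem sum_kappa {r : ℕ} (j : ℕ) (f : Fin r → ℂ) :
    ∑ m : {i : Fin r // (i : ℕ) < j}, f m.1 = ∑ i : Fin r, if (i:ℕ) < j then f i else 0 := by
  rw [← Finset.sum_subtype (p := fun m : Fin r => (m:ℕ) < j) (Finset.univ.filter (fun m : Fin r => (m:ℕ) < j)) (by simp),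
      Finset.sum_filter]

theorem posdef_pert {r : ℕ} {X : Matrix (Fin r) (Fin r) ℂ} (hX : X.IsHermitian) :
    ∀ᶠ τ : ℝ in 𝓝 0, (1 + (τ : ℂ) • X).PosDef := by
  have h1 : X = (hX.eigenvectorUnitary : Matrix (Fin r) (Fin r) ℂ) * diagonal (fun i => (hX.eigenvalues i : ℂ)) * star (hX.eigenvectorUnitary : Matrix (Fin r) (Fin r) ℂ) := by
    conv_lhs => rw [hX.spectral_theorem]
    rfl
  set U := (hX.eigenvectorUnitary : Matrix (Fin r) (Fin r) ℂ) with hUdef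
  have hU : U * star U = 1 := Unitary.mul_star_self_of_mem hX.eigenvectorUnitary.2
  have hev : ∀ᶠ τ : ℝ in 𝓝 0, ∀ i, 0 < 1 + τ * hX.eigenvalues i := by
    rw [eventually_all]
    intro i
    have : Continuous (fun τ : ℝ => 1 + τ * hX.eigenvalues i) := by fun_prop
    exact this.continuousAt.eventually (lt_mem_nhds (by simp))
  filter_upwards [hev] with τ hτ
  have h2 : 1 + (τ:ℂ) • X = U * diagonal (fun i => ((1 + τ * hX.eigenvalues i : ℝ) : ℂ)) * star U := by
    have h3 : diagonal (fun i => ((1 + τ * hX.eigenvalues i : ℝ) : ℂ)) = 1 + (τ:ℂ) • diagonal (fun i => (hX.eigenvalues i : ℂ)) := by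
      rw [← diagonal_one, ← diagonal_smul, diagonal_add]; congr 1; ext i; push_cast; rfl
    rw [h3, mul_add, add_mul, mul_one, hU, mul_smul_comm, smul_mul_assoc, ← h1]
  rw [h2]
  have h4 : (diagonal (fun i => ((1 + τ * hX.eigenvalues i : ℝ) : ℂ))).PosDef := by
    apply PosDef.diagonal
    intro i
    exact_mod_cast hτ i
  have h5 := h4.conjTranspose_mul_mul_same (B := star U) (by
    apply mulVec_injective_of_isUnit
    exact IsUnit.of_mul_eq_one _ (mul_eq_one_comm.mp hU))
  simpa [star_eq_conjTranspose] using h5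

theorem Lf_curve {r : ℕ} {x B g g' : Matrix (Fin r) (Fin r) ℂ} (hx : x * B = 1) (hg : g' * g = 1) :
    ∃ V : Matrix (Fin r) (Fin r) ℂ, Vᴴ * V = 1 ∧ ∀ (X : Matrix (Fin r) (Fin r) ℂ) (j : ℕ),
      HasDerivAt (fun τ : ℝ => Lf B (gᴴ * (1 + (τ:ℂ) • X) * g) j) (∑ i : Fin r, if (i:ℕ) < j then (Vᴴ * X * V) i i else 0).re 0 := by
  have hg' : g * g' = 1 := mul_eq_one_comm.mp hg
  have hxg : (x * g') * (g * B) = 1 := by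
    rw [Matrix.mul_assoc, ← Matrix.mul_assoc g', hg, Matrix.one_mul, hx]
  have hgx : (g * B) * (x * g') = 1 := mul_eq_one_comm.mp hxg
  have hF := isFlag_Fl hxg
  obtain ⟨b, hb, hbm⟩ := exists_adapted_on (fun k : Fin r => Fl (x * g') (k+1)) (fun k => by
    rw [hF.rank]; omega)
  set V : Matrix (Fin r) (Fin r) ℂ := Matrix.of (fun i k => b k i) with hV
  have hVV : Vᴴ * V = 1 := by
    ext i k
    rw [one_apply, ← hb i k]
    rfl
  set T := x * g' * V with hT
  have hTz : ∀ i k, k < i → T i k = 0 := by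
    intro i k hik
    have := hbm k i (by exact Nat.succ_le_of_lt hik)
    exact this
  have hVT : V = g * B * T := by rw [hT, ← Matrix.mul_assoc, hgx, Matrix.one_mul]
  refine ⟨V, hVV, ?_⟩
  intro X j
  set Tj : Matrix {i : Fin r // (i : ℕ) < j} {i : Fin r // (i : ℕ) < j} ℂ := T.submatrix Subtype.val Subtype.val with hTj
  have hVj : Bj V j = g * Bj B j * Tj := by
    ext i k
    have h1 : Bj V j i k = (g * B * T) i k.1 := by rw [← hVT]; rfl
    rw [h1, mul_apply, mul_apply]
    have h2 : ∑ m : {i : Fin r // (i : ℕ) < j}, (g * Bj B j) i m * Tj m k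
       = _ := sum_kappa j (fun m : Fin r => (g * B) i m * T m k.1)
    rw [h2]
    apply Finset.sum_congr rfl
    intro m _
    split_ifs with h
    · rfl
    · rw [hTz m k.1, mul_zero]
      have := k.2
      rw [Fin.lt_def]; omega
  have hVj1 : (Bj V j)ᴴ * Bj V j = 1 := by
    have : (Bj V j)ᴴ * Bj V j = (Vᴴ * V).submatrix Subtype.val Subtype.val := rfl
    rw [this, hVV]
    ext a c
    simp [one_apply, Subtype.ext_iff]
  have key : ∀ τ : ℝ, (1 + (τ:ℂ) • ((Bj V j)ᴴ * X * Bj V j)).det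
      = ((‖Tj.det‖^2 : ℝ) : ℂ) * ((Bj B j)ᴴ * (gᴴ * (1 + (τ:ℂ) • X) * g) * Bj B j).det := by
    intro τ
    have e1 : 1 + (τ:ℂ) • ((Bj V j)ᴴ * X * Bj V j) = (Bj V j)ᴴ * (1 + (τ:ℂ) • X) * Bj V j := by
      rw [Matrix.mul_add, Matrix.add_mul, Matrix.mul_one, hVj1, Matrix.mul_smul, Matrix.smul_mul]
    have e2 : (Bj V j)ᴴ * (1 + (τ:ℂ) • X) * Bj V j = Tjᴴ * ((Bj B j)ᴴ * (gᴴ * (1 + (τ:ℂ) • X) * g) * Bj B j) * Tj := by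
      rw [hVj, conjTranspose_mul, conjTranspose_mul]
      simp only [Matrix.mul_assoc]
    rw [e1, e2, det_mul, det_mul, det_conjTranspose, mul_right_comm]
    congr 1
    rw [mul_comm, Complex.star_def, Complex.mul_conj, Complex.normSq_eq_norm_sq]
  have hT0 : ‖Tj.det‖^2 ≠ 0 := by
    intro h0
    have := key 0
    rw [h0] at this
    simp at this
  have e3 : (fun τ : ℝ => Lf B (gᴴ * (1 + (τ:ℂ) • X) * g) j) =
      fun τ : ℝ => Real.log ((‖Tj.det‖^2)⁻¹ * (1 + (τ:ℂ) • ((Bj V j)ᴴ * X * Bj V j)).det.re) := by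
    funext τ
    rw [key, Complex.re_ofReal_mul, ← mul_assoc, inv_mul_cancel₀ hT0, one_mul]
    rfl
  have h4 := (hasDerivAt_logdet ((Bj V j)ᴴ * X * Bj V j)).const_add (Real.log (‖Tj.det‖^2)⁻¹)
  have h5 : ∀ᶠ τ : ℝ in 𝓝 0, (1 + (τ:ℂ) • ((Bj V j)ᴴ * X * Bj V j)).det.re ≠ 0 := by
    have hc : Continuous (fun τ : ℝ => (1 + (τ:ℂ) • ((Bj V j)ᴴ * X * Bj V j)).det.re) := by
      apply Complex.continuous_re.comp
      apply Continuous.matrix_det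
      exact continuous_const.add (Complex.continuous_ofReal.smul continuous_const)
    apply hc.continuousAt.eventually_ne
    simp
  have h6 : (((Bj V j)ᴴ * X * Bj V j).trace) = ∑ i : Fin r, if (i:ℕ) < j then (Vᴴ * X * V) i i else 0 := by
    exact sum_kappa j (fun i : Fin r => (Vᴴ * X * V) i i)
  rw [← h6, e3]
  refine h4.congr_of_eventuallyEq ?_
  filter_upwards [h5] with τ hτ
  rw [Real.log_mul (inv_ne_zero hT0) hτ]

theorem crit {s r : ℕ} {x B : Fin s → Matrix (Fin r) (Fin r) ℂ} (hx : ∀ l, x l * B l = 1)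
    {Λ : Fin s → Fin r → ℝ} {t δ : ℝ} {g g' : Matrix (Fin r) (Fin r) ℂ} (hg : g' * g = 1)
    (hmin : ∀ h : Matrix (Fin r) (Fin r) ℂ, h.PosDef → GG B Λ t δ (gᴴ * g) ≤ GG B Λ t δ h) :
    ∃ V : Fin s → Matrix (Fin r) (Fin r) ℂ, (∀ l, (V l)ᴴ * V l = 1) ∧
      ∑ l, V l * dg (Λ l) * (V l)ᴴ - ((t + δ : ℝ) : ℂ) • (1 : Matrix (Fin r) (Fin r) ℂ) + (δ:ℂ) • (g * gᴴ) = 0 := by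
  choose V hV hVd using fun l => Lf_curve (hx l) hg
  refine ⟨V, hV, ?_⟩
  set H := ∑ l, V l * dg (Λ l) * (V l)ᴴ - ((t + δ : ℝ) : ℂ) • (1 : Matrix (Fin r) (Fin r) ℂ) + (δ:ℂ) • (g * gᴴ) with hH
  have hHerm : H.IsHermitian := by
    unfold IsHermitian
    rw [hH, conjTranspose_add, conjTranspose_sub, conjTranspose_sum, conjTranspose_smul, conjTranspose_smul, conjTranspose_mul,
      conjTranspose_conjTranspose, conjTranspose_one]
    congr 1
    · congr 1
      · apply Finset.sum_congr rfl
        intro l _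
        exact isHermitian_conj (Λ l) (V l)
      · simp
    · simp
  have hgdet : g.det ≠ 0 := by
    intro h0
    have := congrArg det hg
    rw [det_mul, h0, mul_zero, det_one] at this
    exact zero_ne_one this
  -- derivative
  have hd : ∀ X : Matrix (Fin r) (Fin r) ℂ, HasDerivAt (fun τ : ℝ => GG B Λ t δ (gᴴ * (1 + (τ:ℂ) • X) * g))
      (∑ l, ∑ j : Fin r, Λ l j * ((V l)ᴴ * X * V l) j j - (t + δ) * X.trace + δ * (gᴴ * X * g).trace).re 0 := by
    intro X
    have hdet : HasDerivAt (fun τ : ℝ => Real.log (gᴴ * (1 + (τ:ℂ) • X) * g).det.re) X.trace.re 0 := by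
      have e : ∀ τ : ℝ, (gᴴ * (1 + (τ:ℂ) • X) * g).det.re = ‖g.det‖^2 * (1 + (τ:ℂ) • X).det.re := by
        intro τ
        rw [det_mul, det_mul, det_conjTranspose, mul_right_comm]
        have h3 : star g.det * g.det = ((‖g.det‖^2 : ℝ) : ℂ) := by
          rw [mul_comm, Complex.star_def, Complex.mul_conj, Complex.normSq_eq_norm_sq]
        rw [h3, Complex.re_ofReal_mul]
      have h4 := (hasDerivAt_logdet X).const_add (Real.log (‖g.det‖^2))
      have h5 : ∀ᶠ τ : ℝ in 𝓝 0, (1 + (τ:ℂ) • X).det.re ≠ 0 := by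
        have hc : Continuous (fun τ : ℝ => (1 + (τ:ℂ) • X).det.re) := by
          apply Complex.continuous_re.comp
          apply Continuous.matrix_det
          exact continuous_const.add (Complex.continuous_ofReal.smul continuous_const)
        apply hc.continuousAt.eventually_ne
        simp
      refine h4.congr_of_eventuallyEq ?_
      filter_upwards [h5] with τ hτ
      rw [e, Real.log_mul (pow_ne_zero _ (norm_ne_zero_iff.mpr hgdet)) hτ]
    have htr : HasDerivAt (fun τ : ℝ => (gᴴ * (1 + (τ:ℂ) • X) * g).trace.re) (gᴴ * X * g).trace.re 0 := by
      have e : ∀ τ : ℝ, (gᴴ * (1 + (τ:ℂ) • X) * g).trace.re = (gᴴ * g).trace.re + τ * (gᴴ * X * g).trace.re := by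
        intro τ
        rw [Matrix.mul_add, Matrix.add_mul, Matrix.mul_one, trace_add, Complex.add_re, Matrix.mul_smul, Matrix.smul_mul, trace_smul,
          smul_eq_mul, Complex.re_ofReal_mul]
      simp only [e]
      have := ((hasDerivAt_id (0:ℝ)).mul_const (gᴴ * X * g).trace.re).const_add (gᴴ * g).trace.re
      simpa using this
    have hff : HasDerivAt (fun τ : ℝ => ∑ l, ∑ j : Fin r, Λ l j * (Lf (B l) (gᴴ * (1 + (τ:ℂ) • X) * g) (j+1) - Lf (B l) (gᴴ * (1 + (τ:ℂ) • X) * g) j))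
        (∑ l, ∑ j : Fin r, Λ l j * ((∑ i : Fin r, if (i:ℕ) < j+1 then ((V l)ᴴ * X * V l) i i else 0).re
          - (∑ i : Fin r, if (i:ℕ) < j then ((V l)ᴴ * X * V l) i i else 0).re)) 0 := by
      apply HasDerivAt.fun_sum
      intro l _
      apply HasDerivAt.fun_sum
      intro j _
      exact ((hVd l X (j+1)).sub (hVd l X j)).const_mul _
    have hall := (hff.sub (hdet.const_mul t)).add ((htr.sub hdet).const_mul δ)
    unfold GG ff
    refine HasDerivAt.congr_deriv hall ?_
    have e1 : ∀ l, ∀ j : Fin r, (∑ i : Fin r, if (i:ℕ) < j+1 then ((V l)ᴴ * X * V l) i i else 0).re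
          - (∑ i : Fin r, if (i:ℕ) < j then ((V l)ᴴ * X * V l) i i else 0).re = (((V l)ᴴ * X * V l) j j).re := by
      intro l j
      rw [← Complex.sub_re, ← Finset.sum_sub_distrib, Finset.sum_eq_single j]
      · simp
      · intro i _ hij
        have : (i:ℕ) ≠ j := fun h => hij (Fin.ext h)
        by_cases h : (i:ℕ) < j
        · rw [if_pos h, if_pos (by omega), sub_self]
        · rw [if_neg h, if_neg (by omega), sub_self]
      · simp
    simp only [e1]
    simp only [Complex.add_re, Complex.sub_re, Complex.re_sum, Complex.re_ofReal_mul]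
    rw [← Complex.ofReal_add, Complex.re_ofReal_mul]
    ring
  have hz : ∀ X : Matrix (Fin r) (Fin r) ℂ, X.IsHermitian →
     (∑ l, ∑ j : Fin r, Λ l j * ((V l)ᴴ * X * V l) j j - (t + δ) * X.trace + δ * (gᴴ * X * g).trace).re = 0 := by
    intro X hX
    apply IsLocalMin.hasDerivAt_eq_zero _ (hd X)
    filter_upwards [posdef_pert hX] with τ hτ
    simp only [Complex.ofReal_zero, zero_smul, add_zero, Matrix.mul_one]
    apply hmin
    apply hτ.conjTranspose_mul_mul_same
    apply mulVec_injective_of_isUnit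
    exact IsUnit.of_mul_eq_one _ (mul_eq_one_comm.mp hg)
  have hzH := hz H hHerm
  have e2 : ∀ X : Matrix (Fin r) (Fin r) ℂ, ∑ l, ∑ j : Fin r, Λ l j * ((V l)ᴴ * X * V l) j j - (t + δ) * X.trace + δ * (gᴴ * X * g).trace =
      ((∑ l, V l * dg (Λ l) * (V l)ᴴ - ((t + δ : ℝ) : ℂ) • (1 : Matrix (Fin r) (Fin r) ℂ) + (δ:ℂ) • (g * gᴴ)) * X).trace := by
    intro X
    rw [Matrix.add_mul, Matrix.sub_mul, Finset.sum_mul, trace_add, trace_sub, trace_sum, smul_mul, smul_mul, trace_smul, trace_smul, Matrix.one_mul]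
    congr 1
    · congr 1
      · apply Finset.sum_congr rfl
        intro l _
        rw [Matrix.mul_assoc, Matrix.mul_assoc, trace_mul_comm, Matrix.mul_assoc]
        unfold dg trace
        apply Finset.sum_congr rfl
        intro j _
        rw [diag_apply]
        simp only [← Matrix.mul_assoc]
        rw [mul_diagonal, mul_comm]
      · simp
    · rw [smul_eq_mul]
      congr 1
      rw [Matrix.mul_assoc, trace_mul_comm, Matrix.mul_assoc, trace_mul_comm, Matrix.mul_assoc]
  rw [e2, ← hH] at hzH
  have h7 : (Hᴴ * H).trace = 0 := by
    rw [hHerm.eq]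
    have h8 := (posSemidef_conjTranspose_mul_self H).trace_nonneg
    rw [hHerm.eq] at h8
    have := (Complex.le_def.1 h8).2
    apply Complex.ext
    · exact hzH
    · simpa using this.symm
  exact trace_conjTranspose_mul_self_eq_zero_iff.mp h7

theorem kirwan_of_semistable {s r : ℕ} {x B : Fin s → Matrix (Fin r) (Fin r) ℂ} (hx : ∀ l, x l * B l = 1)
    {Λ : Fin s → Fin r → ℝ} {t : ℝ} (hΛ : ∀ l, Antitone (Λ l)) (hT : TT Λ = r * t)
    (hss : ∀ S : Submodule ℂ (Fin r → ℂ), ∑ l, deg (Fl (x l)) (Λ l) S ≤ finrank ℂ S * t) : KirwanMem Λ t := by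
  obtain ⟨C, hC0⟩ := lower_bound hx hΛ hT hss
  have hC : ∀ U : Matrix (Fin r) (Fin r) ℂ, Uᴴ * U = 1 → ∀ y : Fin r → ℝ,
      C ≤ ff B Λ t (U * dg (fun i => Real.exp (y i)) * Uᴴ) := by
    intro U hU y
    obtain ⟨U', y', hU', hy', he⟩ := antitone_form hU y
    rw [he]
    exact hC0 U' hU' y' hy'
  -- approximate solutions
  have happ : ∀ ε : ℝ, 0 < ε → ∃ V : Fin s → Matrix (Fin r) (Fin r) ℂ, (∀ l, (V l)ᴴ * V l = 1) ∧
      ∀ i j, ‖(∑ l, V l * dg (Λ l) * (V l)ᴴ - (t : ℂ) • (1 : Matrix (Fin r) (Fin r) ℂ)) i j‖ ≤ 5 * ε := by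
    intro ε hε
    set A : Set ℝ := {a | ∃ (U : Matrix (Fin r) (Fin r) ℂ) (y : Fin r → ℝ), Uᴴ * U = 1 ∧ a = ff B Λ t (U * dg (fun i => Real.exp (y i)) * Uᴴ)} with hA
    have hAne : A.Nonempty := ⟨_, 1, 0, by simp, rfl⟩
    have hAb : BddBelow A := ⟨C, by rintro a ⟨U, y, hU, rfl⟩; exact hC U hU y⟩
    obtain ⟨a, ⟨U1, y1, hU1, rfl⟩, ha⟩ := Real.lt_sInf_add_pos hAne hε
    set R1 := ∑ i, (Real.exp (y1 i) - y1 i) with hR1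
    have hR1n : 0 ≤ R1 := Finset.sum_nonneg fun i _ => (abs_nonneg _).trans (abs_le_exp_sub _)
    set δ := ε / (1 + R1) with hδ
    have hδpos : 0 < δ := by positivity
    have hδε : δ ≤ ε := div_le_self hε.le (by linarith)
    have hδR : δ * R1 ≤ ε := by
      rw [hδ, div_mul_eq_mul_div, div_le_iff₀ (by linarith)]
      nlinarith
    obtain ⟨U0, y0, hU0, hmin⟩ := exists_min hx hC hδpos
    set g : Matrix (Fin r) (Fin r) ℂ := dg (fun i => Real.exp (y0 i / 2)) * U0ᴴ with hg
    set g' : Matrix (Fin r) (Fin r) ℂ := U0 * dg (fun i => Real.exp (- (y0 i / 2))) with hg'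
    have hdd : dg (fun i => Real.exp (- (y0 i / 2))) * dg (fun i => Real.exp (y0 i / 2)) = 1 := by
      unfold dg
      rw [diagonal_mul_diagonal, ← diagonal_one]
      congr 1
      ext i
      rw [← Complex.ofReal_mul, ← Real.exp_add]
      simp
    have hgg : g' * g = 1 := by
      rw [hg, hg', Matrix.mul_assoc, ← Matrix.mul_assoc (dg _), hdd, Matrix.one_mul, mul_eq_one_comm.mp hU0]
    have hdh : ∀ z : Fin r → ℝ, (dg z)ᴴ = dg z := by
      intro z
      unfold dg
      rw [diagonal_conjTranspose]
      congr 1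
      ext i
      simp
    have hgh : gᴴ * g = U0 * dg (fun i => Real.exp (y0 i)) * U0ᴴ := by
      rw [hg, conjTranspose_mul, hdh, conjTranspose_conjTranspose, Matrix.mul_assoc, ← Matrix.mul_assoc (dg _), Matrix.mul_assoc U0]
      congr 2
      unfold dg
      rw [diagonal_mul_diagonal]
      congr 1
      ext i
      rw [← Complex.ofReal_mul, ← Real.exp_add]
      congr 2; ring
    obtain ⟨V, hV, hVe⟩ := crit hx (Λ := Λ) (t := t) (δ := δ) hgg (by
      intro h hh
      obtain ⟨U, y, hU, rfl⟩ := posdef_form hh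
      rw [hgh]
      exact hmin U hU y)
    refine ⟨V, hV, ?_⟩
    -- trace bound
    have hm := hmin U1 hU1 y1
    rw [GG_conj _ _ _ _ hU0, GG_conj _ _ _ _ hU1, ← hR1] at hm
    have hinf : sInf A ≤ ff B Λ t (U0 * dg (fun i => Real.exp (y0 i)) * U0ᴴ) := csInf_le hAb ⟨U0, y0, hU0, rfl⟩
    have hR0 : δ * ∑ i, (Real.exp (y0 i) - y0 i) ≤ 2 * ε := by linarith
    have htr : (∑ i, Real.exp (y0 i)) ≤ 2 * ∑ i, (Real.exp (y0 i) - y0 i) := by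
      rw [Finset.mul_sum]
      apply Finset.sum_le_sum
      intro i _
      have := exp_sub_ge (y0 i)
      linarith
    have htr4 : δ * (gᴴ * g).trace.re ≤ 4 * ε := by
      rw [hgh, trace_conj hU0]
      nlinarith
    have hent : ∀ i j, ‖(g * gᴴ) i j‖ ≤ (gᴴ * g).trace.re := by
      intro i j
      have e1 : (gᴴ * g).trace.re = ∑ a, ∑ b, ‖g a b‖^2 := by
        rw [trace_mul_comm]
        unfold trace
        rw [Complex.re_sum]
        apply Finset.sum_congr rfl
        intro a _
        rw [diag_apply, mul_apply, Complex.re_sum]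
        apply Finset.sum_congr rfl
        intro b _
        rw [conjTranspose_apply, Complex.star_def, Complex.mul_conj, Complex.ofReal_re, Complex.normSq_eq_norm_sq]
      have hrow : ∀ a, ∑ b, ‖g a b‖^2 ≤ (gᴴ * g).trace.re := by
        intro a
        rw [e1]
        exact Finset.single_le_sum (f := fun a => ∑ b, ‖g a b‖^2) (fun a _ => Finset.sum_nonneg fun _ _ => sq_nonneg _) (Finset.mem_univ a)
      rw [mul_apply]
      refine (norm_sum_le _ _).trans ?_
      have : ∑ k, ‖g i k * gᴴ k j‖ ≤ ∑ k, (‖g i k‖^2 / 2 + ‖g j k‖^2 / 2) := by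
        apply Finset.sum_le_sum
        intro k _
        rw [norm_mul, conjTranspose_apply, norm_star]
        nlinarith [sq_nonneg (‖g i k‖ - ‖g j k‖)]
      refine this.trans ?_
      rw [Finset.sum_add_distrib, ← Finset.sum_div, ← Finset.sum_div]
      linarith [hrow i, hrow j]
    intro i j
    have hE : ∑ l, V l * dg (Λ l) * (V l)ᴴ - (t : ℂ) • (1 : Matrix (Fin r) (Fin r) ℂ) = (δ:ℂ) • (1 : Matrix (Fin r) (Fin r) ℂ) - (δ:ℂ) • (g * gᴴ) := by
      rw [Complex.ofReal_add, add_smul] at hVe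
      rw [← sub_eq_zero, ← hVe]
      abel
    rw [hE, Matrix.sub_apply, Matrix.smul_apply, Matrix.smul_apply]
    refine (norm_sub_le _ _).trans ?_
    rw [norm_smul, norm_smul, Complex.norm_real, Real.norm_of_nonneg hδpos.le]
    have h1 : ‖(1 : Matrix (Fin r) (Fin r) ℂ) i j‖ ≤ 1 := by
      rw [one_apply]; split_ifs <;> simp
    have h2 := hent i j
    have h3 : δ * ‖(g * gᴴ) i j‖ ≤ 4 * ε := le_trans (mul_le_mul_of_nonneg_left h2 hδpos.le) htr4
    nlinarith
  -- compactness
  set N : (Fin s → Matrix (Fin r) (Fin r) ℂ) → ℝ := fun V =>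
    ∑ i, ∑ j, ‖(∑ l, V l * dg (Λ l) * (V l)ᴴ - (t : ℂ) • (1 : Matrix (Fin r) (Fin r) ℂ)) i j‖ with hN
  have hNc : Continuous N := by
    apply continuous_finset_sum
    intro i _
    apply continuous_finset_sum
    intro j _
    apply Continuous.norm
    apply Continuous.matrix_elem
    apply Continuous.sub _ continuous_const
    apply continuous_finset_sum
    intro l _
    exact ((continuous_apply l).matrix_mul continuous_const).matrix_mul (continuous_apply l).matrix_conjTranspose
  have hKc : IsCompact (Set.univ.pi fun _ : Fin s => {Y : Matrix (Fin r) (Fin r) ℂ | Yᴴ * Y = 1}) :=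
    isCompact_univ_pi fun _ => isCompact_isometries r r
  obtain ⟨V, hV, hVmin⟩ := hKc.exists_isMinOn ⟨fun _ => 1, fun _ _ => by simp⟩ hNc.continuousOn
  have hVmin' := isMinOn_iff.mp hVmin
  have hN0 : N V ≤ 0 := by
    by_contra hcon
    push Not at hcon
    set ε := N V / (10 * (r * r + 1)) with hε
    have hεp : 0 < ε := by positivity
    obtain ⟨W, hW, hWb⟩ := happ ε hεp
    have h1 := hVmin' W (fun l _ => hW l)
    have h2 : N W ≤ ∑ i : Fin r, ∑ j : Fin r, 5 * ε :=
      Finset.sum_le_sum fun i _ => Finset.sum_le_sum fun j _ => hWb i j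
    simp only [Finset.sum_const, Finset.card_univ, Fintype.card_fin, nsmul_eq_mul] at h2
    have h3 : ε * (10 * (r * r + 1)) = N V := by rw [hε]; field_simp
    nlinarith
  rw [kirwan_iff]
  refine ⟨hΛ, V, fun l => hV l trivial, ?_⟩
  rw [← sub_eq_zero]
  ext i j
  have h1 : ‖(∑ l, V l * dg (Λ l) * (V l)ᴴ - (t : ℂ) • (1 : Matrix (Fin r) (Fin r) ℂ)) i j‖ ≤ N V := by
    refine le_trans ?_ (Finset.single_le_sum (f := fun i => ∑ j, ‖(∑ l, V l * dg (Λ l) * (V l)ᴴ - (t : ℂ) • (1 : Matrix (Fin r) (Fin r) ℂ)) i j‖)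
      (fun a _ => Finset.sum_nonneg fun _ _ => norm_nonneg _) (Finset.mem_univ i))
    exact Finset.single_le_sum (f := fun j => ‖(∑ l, V l * dg (Λ l) * (V l)ᴴ - (t : ℂ) • (1 : Matrix (Fin r) (Fin r) ℂ)) i j‖)
      (fun a _ => norm_nonneg _) (Finset.mem_univ j)
  exact norm_le_zero_iff.mp (h1.trans hN0)

end KC

open Module

set_option linter.all false

namespace KC
open Matrix ComplexOrder Filter Topology

/-- Filtered homomorphisms for one index. -/
def HL {d q : ℕ} (c : Fin d → ℕ) (u : Matrix (Fin d) (Fin d) ℂ) (y : Matrix (Fin q) (Fin q) ℂ) :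
    Submodule ℂ (Matrix (Fin q) (Fin d) ℂ) where
  carrier := {ψ | ∀ (i : Fin q) (k : Fin d), c k ≤ i → (y * ψ * u) i k = 0}
  add_mem' := by
    intro a b ha hb i k h
    rw [Matrix.mul_add, Matrix.add_mul, Matrix.add_apply, ha i k h, hb i k h, add_zero]
  zero_mem' := by
    intro i k h
    simp
  smul_mem' := by
    intro z a ha i k h
    rw [Matrix.mul_smul, Matrix.smul_mul, Matrix.smul_apply, ha i k h, smul_zero]

theorem mem_HL {d q : ℕ} {c : Fin d → ℕ} {u : Matrix (Fin d) (Fin d) ℂ} {y : Matrix (Fin q) (Fin q) ℂ}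
    {ψ : Matrix (Fin q) (Fin d) ℂ} :
    ψ ∈ HL c u y ↔ ∀ (i : Fin q) (k : Fin d), c k ≤ i → (y * ψ * u) i k = 0 := Iff.rfl

theorem mem_HL' {d q : ℕ} {c : Fin d → ℕ} {u : Matrix (Fin d) (Fin d) ℂ} {y : Matrix (Fin q) (Fin q) ℂ}
    {ψ : Matrix (Fin q) (Fin d) ℂ} :
    ψ ∈ HL c u y ↔ ∀ k : Fin d, ψ *ᵥ (u.col k) ∈ Fl y (c k) := by
  constructor
  · intro h k
    rw [mem_Fl]
    intro i hi
    have := h i k hi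
    rw [Matrix.mul_assoc] at this
    exact this
  · intro h i k hi
    rw [Matrix.mul_assoc]
    exact (mem_Fl _ _ _).mp (h k) i hi

/-- The space of filtered homomorphisms. -/
def Hm {s d q : ℕ} (c : Fin s → Fin d → ℕ) (u : Fin s → Matrix (Fin d) (Fin d) ℂ)
    (y : Fin s → Matrix (Fin q) (Fin q) ℂ) : Submodule ℂ (Matrix (Fin q) (Fin d) ℂ) :=
  ⨅ l, HL (c l) (u l) (y l)

theorem mem_Hm {s d q : ℕ} {c : Fin s → Fin d → ℕ} {u : Fin s → Matrix (Fin d) (Fin d) ℂ}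
    {y : Fin s → Matrix (Fin q) (Fin q) ℂ} {ψ : Matrix (Fin q) (Fin d) ℂ} :
    ψ ∈ Hm c u y ↔ ∀ l, ψ ∈ HL (c l) (u l) (y l) := by
  simp [Hm, Submodule.mem_iInf]

theorem ker_count {M : Type} [AddCommGroup M] [Module ℂ M] [FiniteDimensional ℂ M] {s d : ℕ}
    (u : Fin s → Matrix (Fin d) (Fin d) ℂ) (Q : Fin s → Fin d → Submodule ℂ M) :
    ∃ N : Submodule ℂ (Fin d → M), (∀ z ∈ N, ∀ l k, (∑ j, (u l j k) • z j) ∈ Q l k) ∧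
      (d * finrank ℂ M : ℤ) - ∑ l, ∑ k, ((finrank ℂ M : ℤ) - finrank ℂ (Q l k)) ≤ finrank ℂ N := by
  let T : (Fin d → M) →ₗ[ℂ] ((p : Fin s × Fin d) → M ⧸ Q p.1 p.2) :=
    LinearMap.pi fun p => (Q p.1 p.2).mkQ ∘ₗ (∑ j, (u p.1 j p.2) • LinearMap.proj j)
  refine ⟨LinearMap.ker T, ?_, ?_⟩
  · intro z hz l k
    have := congrFun (LinearMap.mem_ker.mp hz) (l, k)
    simp only [T, LinearMap.pi_apply, LinearMap.comp_apply, Submodule.mkQ_apply, LinearMap.sum_apply, LinearMap.smul_apply, LinearMap.proj_apply, Pi.zero_apply] at this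
    exact (Submodule.Quotient.mk_eq_zero _).mp this
  have h1 := T.finrank_range_add_finrank_ker
  have h2 : finrank ℂ (LinearMap.range T) ≤ ∑ l, ∑ k, finrank ℂ (M ⧸ Q l k) := by
    refine (Submodule.finrank_le _).trans ?_
    rw [finrank_pi_fintype, Fintype.sum_prod_type]
  have h3 : ∀ l k, (finrank ℂ (M ⧸ Q l k) : ℤ) = (finrank ℂ M : ℤ) - finrank ℂ (Q l k) := by
    intro l k
    have a1 := (Q l k).finrank_quotient_add_finrank
    omega
  simp_rw [← h3]
  rw [finrank_pi_fintype, Finset.sum_const, Finset.card_univ, Fintype.card_fin, smul_eq_mul] at h1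
  have h2' : (finrank ℂ (LinearMap.range T) : ℤ) ≤ ∑ l, ∑ k, (finrank ℂ (M ⧸ Q l k) : ℤ) := by exact_mod_cast h2
  have h1' : (finrank ℂ (LinearMap.range T) : ℤ) + finrank ℂ (LinearMap.ker T) = d * finrank ℂ M := by exact_mod_cast h1
  linarith

theorem lemma_B {s d q : ℕ} (c : Fin s → Fin d → ℕ) (u : Fin s → Matrix (Fin d) (Fin d) ℂ)
    (y : Fin s → Matrix (Fin q) (Fin q) ℂ) (R : Submodule ℂ (Fin q → ℂ)) :
    (d * finrank ℂ R : ℤ) - ∑ l, ∑ k, ((finrank ℂ R : ℤ) - finrank ℂ (R ⊓ Fl (y l) (c l k) : Submodule ℂ (Fin q → ℂ)))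
      ≤ finrank ℂ (Hm c u y) := by
  obtain ⟨K, hK, hd⟩ := ker_count u (fun l k => (Fl (y l) (c l k)).comap R.subtype)
  have a2 : ∀ l k, finrank ℂ ((Fl (y l) (c l k)).comap R.subtype) = finrank ℂ (R ⊓ Fl (y l) (c l k) : Submodule ℂ (Fin q → ℂ)) := by
    intro l k
    rw [← Submodule.map_comap_subtype]
    exact (Submodule.finrank_map_subtype_eq _ _).symm
  simp_rw [a2] at hd
  have h4 : finrank ℂ K ≤ finrank ℂ (Hm c u y) := by
    let N : (Fin d → R) →ₗ[ℂ] Matrix (Fin q) (Fin d) ℂ :=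
      { toFun := fun z => Matrix.of fun i j => (z j : Fin q → ℂ) i
        map_add' := by intro a b; ext; simp
        map_smul' := by intro a b; ext; simp }
    have hN : ∀ z ∈ K, N z ∈ Hm c u y := by
      intro z hz
      rw [mem_Hm]
      intro l
      rw [mem_HL']
      intro k
      have := hK z hz l k
      have e : N z *ᵥ ((u l).col k) = ((∑ j, (u l j k) • z j : R) : Fin q → ℂ) := by
        ext i
        simp [N, mulVec, dotProduct, mul_comm, Finset.sum_apply]
      rw [e]
      exact this
    let N' := (N.restrict hN : K →ₗ[ℂ] Hm c u y)
    apply LinearMap.finrank_le_finrank_of_injective (f := N')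
    intro a b hab
    have : N a = N b := congrArg Subtype.val hab
    apply Subtype.ext
    funext j
    apply Subtype.ext
    funext i
    exact congrFun (congrFun this i) j
  have h4' : (finrank ℂ K : ℤ) ≤ finrank ℂ (Hm c u y) := by exact_mod_cast h4
  linarith

/-- Homs sending a subspace to a subspace. -/
def Wsp {d q : ℕ} (K : Submodule ℂ (Fin d → ℂ)) (R : Submodule ℂ (Fin q → ℂ)) :
    Submodule ℂ (Matrix (Fin q) (Fin d) ℂ) where
  carrier := {ψ | ∀ v ∈ K, ψ *ᵥ v ∈ R}
  add_mem' := by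
    intro a b ha hb v hv
    rw [Matrix.add_mulVec]
    exact R.add_mem (ha v hv) (hb v hv)
  zero_mem' := by
    intro v hv
    simp
  smul_mem' := by
    intro z a ha v hv
    rw [Matrix.smul_mulVec]
    exact R.smul_mem _ (ha v hv)

theorem finrank_Wsp {d q : ℕ} (K : Submodule ℂ (Fin d → ℂ)) (R : Submodule ℂ (Fin q → ℂ)) :
    (d * q : ℤ) - finrank ℂ K * ((q : ℤ) - finrank ℂ R) ≤ finrank ℂ (Wsp K R) := by
  let T : Matrix (Fin q) (Fin d) ℂ →ₗ[ℂ] (K →ₗ[ℂ] ((Fin q → ℂ) ⧸ R)) :=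
    { toFun := fun ψ => R.mkQ ∘ₗ ψ.mulVecLin ∘ₗ K.subtype
      map_add' := by
        intro a b; ext v; simp [Matrix.add_mulVec]
      map_smul' := by
        intro a b; ext v; simp [Matrix.smul_mulVec] }
  have h1 := T.finrank_range_add_finrank_ker
  have h2 : LinearMap.ker T = Wsp K R := by
    ext ψ
    rw [LinearMap.mem_ker]
    constructor
    · intro h v hv
      have := congrArg (fun f => f ⟨v, hv⟩) h
      simp only [T, LinearMap.coe_mk, AddHom.coe_mk, LinearMap.comp_apply, Submodule.mkQ_apply, LinearMap.zero_apply, Submodule.subtype_apply, mulVecLin_apply] at this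
      exact (Submodule.Quotient.mk_eq_zero _).mp this
    · intro h
      ext v
      simp only [T, LinearMap.coe_mk, AddHom.coe_mk, LinearMap.comp_apply, Submodule.mkQ_apply, LinearMap.zero_apply, Submodule.subtype_apply, mulVecLin_apply]
      exact (Submodule.Quotient.mk_eq_zero _).mpr (h v v.2)
  have h3 : finrank ℂ (LinearMap.range T) ≤ finrank ℂ K * finrank ℂ ((Fin q → ℂ) ⧸ R) := by
    refine (Submodule.finrank_le _).trans ?_
    rw [finrank_linearMap]
  have h4 := R.finrank_quotient_add_finrank
  rw [h2, finrank_matrix] at h1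
  simp only [Fintype.card_fin, finrank_self, mul_one, finrank_fin_fun] at h1 h4
  have h5 : (finrank ℂ ((Fin q → ℂ) ⧸ R) : ℤ) = (q : ℤ) - finrank ℂ R := by omega
  have h3' : (finrank ℂ (LinearMap.range T) : ℤ) ≤ finrank ℂ K * finrank ℂ ((Fin q → ℂ) ⧸ R) := by exact_mod_cast h3
  rw [h5] at h3'
  have h1' : (finrank ℂ (LinearMap.range T) : ℤ) + finrank ℂ (Wsp K R) = q * d := by exact_mod_cast h1
  linarith

theorem finrank_W_inf_HL {d d' q : ℕ} {c : Fin d → ℕ} (hc : Monotone c) {x u : Matrix (Fin d) (Fin d) ℂ}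
    (hx : x * u = 1) {y yi : Matrix (Fin q) (Fin q) ℂ} (hy : y * yi = 1) (K : Submodule ℂ (Fin d → ℂ))
    (R : Submodule ℂ (Fin q → ℂ)) {I : Fin d' → Fin d} (hI : IsType (Fl x) K I) :
    (finrank ℂ (Wsp K R ⊓ HL c u y : Submodule ℂ (Matrix (Fin q) (Fin d) ℂ)) : ℤ) ≤ ∑ k, (c k : ℤ) - ∑ k', (c (I k') : ℤ)
      + ∑ k', (finrank ℂ (R ⊓ Fl y (c (I k')) : Submodule ℂ (Fin q → ℂ)) : ℤ) := by
  classical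
  have hFx := isFlag_Fl hx
  have hFy := isFlag_Fl hy
  have hex : ∀ k : Fin d, ∃ v, v ∈ Fl x (k+1) ∧ v ∉ Fl x k ∧ (k ∈ Set.range I → v ∈ K) := by
    intro k
    by_cases hk : k ∈ Set.range I
    · obtain ⟨k', rfl⟩ := hk
      obtain ⟨v, h1, h2, h3⟩ := hI.ex k'
      exact ⟨v, h2, h3, fun _ => h1⟩
    · obtain ⟨v, h1, h2⟩ := flag_ex hFx k
      exact ⟨v, h1, h2, fun h => absurd h hk⟩
  choose b hb1 hb2 hb3 using hex
  obtain ⟨B, hB, -⟩ := flag_basis hFx b hb1 hb2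
  let U : Fin d → Submodule ℂ (Fin q → ℂ) := fun k => if k ∈ Set.range I then R ⊓ Fl y (c k) else Fl y (c k)
  have hmem : ∀ ψ ∈ Wsp K R ⊓ HL c u y, ∀ k, ψ *ᵥ (b k) ∈ U k := by
    intro ψ hψ k
    have h1 : ψ *ᵥ (b k) ∈ Fl y (c k) := by
      have e : b k = u *ᵥ (x *ᵥ b k) := by
        rw [mulVec_mulVec, mul_eq_one_comm.mp hx, one_mulVec]
      have e2 : u *ᵥ (x *ᵥ b k) = ∑ j, (x *ᵥ b k) j • u.col j := by
        rw [Matrix.mulVec_eq_sum]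
        apply Finset.sum_congr rfl
        intro j _
        ext i
        simp [mul_comm]
      rw [e, e2]
      have e3 : ψ *ᵥ (∑ j, (x *ᵥ b k) j • u.col j) = ∑ j, (x *ᵥ b k) j • (ψ *ᵥ u.col j) := by
        have := map_sum ψ.mulVecLin (fun j => (x *ᵥ b k) j • u.col j) Finset.univ
        simp only [mulVecLin_apply, mulVec_smul] at this
        exact this
      rw [e3]
      apply Submodule.sum_mem
      intro j _
      by_cases hj : (k : ℕ) + 1 ≤ j
      · rw [(mem_Fl _ _ _).mp (hb1 k) j hj, zero_smul]
        exact Submodule.zero_mem _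
      · apply Submodule.smul_mem
        apply Fl_mono y (hc (show j ≤ k by rw [Fin.le_def]; omega))
        exact mem_HL'.mp hψ.2 j
    by_cases hk : k ∈ Set.range I
    · simp only [U, if_pos hk]
      exact ⟨hψ.1 _ (hb3 k hk), h1⟩
    · simp only [U, if_neg hk]
      exact h1
  let T : (Wsp K R ⊓ HL c u y : Submodule ℂ (Matrix (Fin q) (Fin d) ℂ)) →ₗ[ℂ] ((k : Fin d) → U k) :=
    { toFun := fun ψ k => ⟨(ψ : Matrix (Fin q) (Fin d) ℂ) *ᵥ (b k), hmem ψ ψ.2 k⟩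
      map_add' := by intro a b; ext; simp [Matrix.add_mulVec]
      map_smul' := by intro a b; ext; simp [Matrix.smul_mulVec] }
  have hinj : Function.Injective T := by
    intro ψ ψ' h
    apply Subtype.ext
    apply Matrix.ext_of_mulVec_single
    intro i
    have : (ψ : Matrix (Fin q) (Fin d) ℂ).mulVecLin = (ψ' : Matrix (Fin q) (Fin d) ℂ).mulVecLin := by
      apply B.ext
      intro k
      rw [hB]
      have := congrArg Subtype.val (congrFun h k)
      exact this
    exact congrArg (fun f => f (Pi.single i 1)) this
  have h1 := LinearMap.finrank_le_finrank_of_injective hinj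
  rw [finrank_pi_fintype] at h1
  have h2 : ∀ k, (finrank ℂ (U k) : ℤ) ≤ c k + if k ∈ Set.range I then (finrank ℂ (R ⊓ Fl y (c k) : Submodule ℂ (Fin q → ℂ)) : ℤ) - c k else 0 := by
    intro k
    by_cases hk : k ∈ Set.range I
    · have e : U k = R ⊓ Fl y (c k) := if_pos hk
      rw [e, if_pos hk]
      linarith
    · have e : U k = Fl y (c k) := if_neg hk
      rw [e, if_neg hk, hFy.rank]
      have := min_le_left (c k) q
      omega
  have h3 : ∑ k, (if k ∈ Set.range I then (finrank ℂ (R ⊓ Fl y (c k) : Submodule ℂ (Fin q → ℂ)) : ℤ) - c k else 0) = ∑ k', ((finrank ℂ (R ⊓ Fl y (c (I k')) : Submodule ℂ (Fin q → ℂ)) : ℤ) - c (I k')) := by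
    rw [← Finset.sum_filter]
    have : Finset.univ.filter (fun k => k ∈ Set.range I) = Finset.univ.image I := by
      ext k; simp
    rw [this, Finset.sum_image (fun a _ b _ h => hI.sm.injective h)]
  have h4 : (∑ k, (finrank ℂ (U k) : ℤ)) ≤ ∑ k, ((c k : ℤ) + if k ∈ Set.range I then (finrank ℂ (R ⊓ Fl y (c k) : Submodule ℂ (Fin q → ℂ)) : ℤ) - c k else 0) := Finset.sum_le_sum fun k _ => h2 k
  rw [Finset.sum_add_distrib, h3, Finset.sum_sub_distrib] at h4
  have h5 : (finrank ℂ (Wsp K R ⊓ HL c u y : Submodule ℂ (Matrix (Fin q) (Fin d) ℂ)) : ℤ) ≤ ∑ k, (finrank ℂ (U k) : ℤ) := by exact_mod_cast h1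
  linarith

theorem surj_count {V : Type} [AddCommGroup V] [Module ℂ V] [FiniteDimensional ℂ V] {s : ℕ}
    (W : Submodule ℂ V) (H : Fin s → Submodule ℂ V) (hW : ⨅ l, H l ≤ W)
    (hs : ∀ w : Fin s → V, (∀ l, w l ∈ W) → ∃ w0 ∈ W, ∀ l, w0 + w l ∈ H l) :
    (finrank ℂ (⨅ l, H l : Submodule ℂ V) : ℤ) ≤ finrank ℂ W - ∑ l, ((finrank ℂ W : ℤ) - finrank ℂ (W ⊓ H l : Submodule ℂ V)) := by
  let Q : Fin s → Submodule ℂ W := fun l => (H l).comap W.subtype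
  let T : W →ₗ[ℂ] ((l : Fin s) → W ⧸ Q l) := LinearMap.pi fun l => (Q l).mkQ
  have hsurj : Function.Surjective T := by
    intro z
    have : ∀ l, ∃ w : W, (Q l).mkQ w = z l := fun l => (Q l).mkQ_surjective (z l)
    choose w hw using this
    obtain ⟨w0, h0, h1⟩ := hs (fun l => -(w l : V)) (fun l => W.neg_mem (w l).2)
    refine ⟨⟨w0, h0⟩, ?_⟩
    funext l
    rw [← hw l]
    show (Q l).mkQ _ = _
    rw [← sub_eq_zero, ← map_sub, Submodule.mkQ_apply, Submodule.Quotient.mk_eq_zero]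
    have := h1 l
    rw [← sub_eq_add_neg] at this
    exact this
  have h1 := T.finrank_range_add_finrank_ker
  rw [LinearMap.range_eq_top.mpr hsurj, finrank_top, finrank_pi_fintype] at h1
  have h3 : ∀ l, (finrank ℂ (W ⧸ Q l) : ℤ) = (finrank ℂ W : ℤ) - finrank ℂ (W ⊓ H l : Submodule ℂ V) := by
    intro l
    have a1 := (Q l).finrank_quotient_add_finrank
    have a2 : finrank ℂ (Q l) = finrank ℂ (W ⊓ H l : Submodule ℂ V) := by
      rw [← Submodule.map_comap_subtype]
      exact (Submodule.finrank_map_subtype_eq _ _).symm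
    omega
  have h4 : finrank ℂ (⨅ l, H l : Submodule ℂ V) ≤ finrank ℂ (LinearMap.ker T) := by
    have : (⨅ l, H l : Submodule ℂ V) ≤ (LinearMap.ker T).map W.subtype := by
      intro v hv
      refine ⟨⟨v, hW hv⟩, ?_, rfl⟩
      rw [SetLike.mem_coe, LinearMap.mem_ker]
      funext l
      show (Q l).mkQ _ = 0
      rw [Submodule.mkQ_apply, Submodule.Quotient.mk_eq_zero]
      exact (Submodule.mem_iInf _).mp hv l
    refine (Submodule.finrank_mono this).trans (le_of_eq ?_)
    exact (Submodule.finrank_map_subtype_eq _ _)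
  have h1' : (∑ l, (finrank ℂ (W ⧸ Q l) : ℤ)) + finrank ℂ (LinearMap.ker T) = finrank ℂ W := by exact_mod_cast h1
  simp_rw [h3] at h1'
  have h4' : (finrank ℂ (⨅ l, H l : Submodule ℂ V) : ℤ) ≤ finrank ℂ (LinearMap.ker T) := by exact_mod_cast h4
  linarith

end KC

open Module

set_option linter.all false

namespace KC
open Matrix ComplexOrder Filter Topology

theorem exists_PQ {V V' : Type} [AddCommGroup V] [Module ℂ V] [FiniteDimensional ℂ V]
    [AddCommGroup V'] [Module ℂ V'] [FiniteDimensional ℂ V'] (N : V →ₗ[ℂ] V') :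
    ∃ ρ : ℕ, ρ = finrank ℂ (LinearMap.range N) ∧ ∃ (P : V' →ₗ[ℂ] (Fin ρ → ℂ))
      (Q : (Fin ρ → ℂ) →ₗ[ℂ] V), P ∘ₗ N ∘ₗ Q = LinearMap.id := by
  obtain ⟨R, hR⟩ := LinearMap.exists_rightInverse_of_surjective N.rangeRestrict
    (LinearMap.range_eq_top.mpr N.surjective_rangeRestrict)
  let e : (Fin (finrank ℂ (LinearMap.range N)) → ℂ) ≃ₗ[ℂ] LinearMap.range N :=
    LinearEquiv.ofFinrankEq _ _ (by simp)
  have h : N ∘ₗ (R ∘ₗ e.toLinearMap) = (LinearMap.range N).subtype ∘ₗ e.toLinearMap := by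
    ext v
    have := congrArg (fun f => (f (e (Pi.single v 1)) : V')) hR
    simpa using this
  obtain ⟨P, hP⟩ := LinearMap.exists_leftInverse_of_injective (N ∘ₗ (R ∘ₗ e.toLinearMap)) (by
    rw [LinearMap.ker_eq_bot, h]
    exact (Submodule.subtype_injective _).comp e.injective)
  exact ⟨_, rfl, P, _, hP⟩

theorem tendsto_inv_mat {n : ℕ} {ι : Type} {f : Filter ι} {G : ι → Matrix (Fin n) (Fin n) ℂ}
    {G0 : Matrix (Fin n) (Fin n) ℂ} (h : Tendsto G f (𝓝 G0)) (h0 : G0.det ≠ 0) :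
    Tendsto (fun i => (G i)⁻¹) f (𝓝 G0⁻¹) := by
  simp_rw [Matrix.inv_def, Ring.inverse_eq_inv']
  have h1 : Tendsto (fun i => (G i).det) f (𝓝 G0.det) :=
    ((continuous_id.matrix_det).tendsto G0).comp h
  have h2 : Tendsto (fun i => (G i).adjugate) f (𝓝 G0.adjugate) :=
    ((continuous_id.matrix_adjugate).tendsto G0).comp h
  exact (h1.inv₀ h0).smul h2

theorem tendsto_mulVec {m n : ℕ} {ι : Type} {f : Filter ι} {G : ι → Matrix (Fin m) (Fin n) ℂ}
    {G0 : Matrix (Fin m) (Fin n) ℂ} {v : ι → (Fin n → ℂ)} {v0 : Fin n → ℂ} (h : Tendsto G f (𝓝 G0))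
    (hv : Tendsto v f (𝓝 v0)) : Tendsto (fun i => G i *ᵥ v i) f (𝓝 (G0 *ᵥ v0)) := by
  have hc : Continuous (fun p : Matrix (Fin m) (Fin n) ℂ × (Fin n → ℂ) => p.1 *ᵥ p.2) := by fun_prop
  have := (hc.tendsto (G0, v0)).comp (h.prodMk_nhds hv)
  exact this

theorem perturb {V V' : Type} [AddCommGroup V] [Module ℂ V] [FiniteDimensional ℂ V]
    [TopologicalSpace V] [IsTopologicalAddGroup V] [ContinuousSMul ℂ V] [T2Space V]
    [AddCommGroup V'] [Module ℂ V'] [FiniteDimensional ℂ V']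
    [TopologicalSpace V'] [IsTopologicalAddGroup V'] [ContinuousSMul ℂ V'] [T2Space V']
    (N A B : V →ₗ[ℂ] V')
    (h : ∀ᶠ ε in 𝓝[≠] (0:ℂ), finrank ℂ (LinearMap.ker N) ≤ finrank ℂ (LinearMap.ker (N + ε • A + ε^2 • B)))
    (φ : V) (hφ : N φ = 0) :
    ∃ (w : ℂ → V) (w0 : V), Tendsto w (𝓝[≠] 0) (𝓝 w0) ∧
      (∀ᶠ ε in 𝓝[≠] (0:ℂ), (N + ε • A + ε^2 • B) (φ + ε • w ε) = 0) ∧ N w0 + A φ = 0 := by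
  obtain ⟨ρ, hρ, P, Q, hPQ⟩ := exists_PQ N
  let G : ℂ → Matrix (Fin ρ) (Fin ρ) ℂ := fun ε =>
    1 + ε • LinearMap.toMatrix' (P ∘ₗ A ∘ₗ Q) + ε^2 • LinearMap.toMatrix' (P ∘ₗ B ∘ₗ Q)
  have hG : ∀ ε z, G ε *ᵥ z = P ((N + ε • A + ε^2 • B) (Q z)) := by
    intro ε z
    have e1 : P (N (Q z)) = z := congrArg (fun f => f z) hPQ
    have e2 : ∀ X : V →ₗ[ℂ] V', LinearMap.toMatrix' (P ∘ₗ X ∘ₗ Q) *ᵥ z = P (X (Q z)) := by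
      intro X
      rw [LinearMap.toMatrix'_mulVec]
      rfl
    simp only [G, Matrix.add_mulVec, Matrix.smul_mulVec, e2, Matrix.one_mulVec, LinearMap.add_apply, LinearMap.smul_apply, map_add, map_smul, e1]
  have hGc : Tendsto G (𝓝[≠] 0) (𝓝 1) := by
    have : Continuous G := by fun_prop
    have h0 : G 0 = 1 := by simp [G]
    rw [← h0]
    exact (this.tendsto 0).mono_left nhdsWithin_le_nhds
  have hdet : ∀ᶠ ε in 𝓝[≠] (0:ℂ), (G ε).det ≠ 0 := by
    have h1 : Tendsto (fun i => (G i).det) (𝓝[≠] 0) (𝓝 (1 : Matrix (Fin ρ) (Fin ρ) ℂ).det) :=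
      ((continuous_id.matrix_det).tendsto _).comp hGc
    exact h1.eventually_ne (by simp)
  have hGi := tendsto_inv_mat hGc (by simp)
  have hnull : ∀ᶠ ε in 𝓝[≠] (0:ℂ), ∀ v, P ((N + ε • A + ε^2 • B) v) = 0 → (N + ε • A + ε^2 • B) v = 0 := by
    filter_upwards [h, hdet] with ε h1 h2 v hv
    set M := N + ε • A + ε^2 • B with hM
    have r1 := M.finrank_range_add_finrank_ker
    have r2 := N.finrank_range_add_finrank_ker
    have hinj : Function.Injective (M ∘ₗ Q) := by
      rw [← LinearMap.ker_eq_bot, LinearMap.ker_eq_bot']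
      intro z hz
      have : G ε *ᵥ z = 0 := by
        rw [hG, ← hM]
        change P ((M ∘ₗ Q) z) = 0
        rw [hz, map_zero]
      exact Matrix.eq_zero_of_mulVec_eq_zero h2 this
    have r3 : finrank ℂ (LinearMap.range (M ∘ₗ Q)) = ρ := by
      rw [LinearMap.finrank_range_of_inj hinj]; simp
    have r4 : LinearMap.range (M ∘ₗ Q) = LinearMap.range M := by
      apply Submodule.eq_of_le_of_finrank_le (LinearMap.range_comp_le_range _ _)
      rw [r3]
      omega
    have : M v ∈ LinearMap.range (M ∘ₗ Q) := by rw [r4]; exact ⟨v, rfl⟩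
    obtain ⟨z, hz⟩ := this
    rw [← hz]
    have hz0 : G ε *ᵥ z = 0 := by
      rw [hG, ← hM]
      change P ((M ∘ₗ Q) z) = 0
      rw [hz, hv]
    rw [Matrix.eq_zero_of_mulVec_eq_zero h2 hz0, map_zero]
  let z : ℂ → (Fin ρ → ℂ) := fun ε => -((G ε)⁻¹ *ᵥ (P (A φ) + ε • P (B φ)))
  have hz : Tendsto z (𝓝[≠] 0) (𝓝 (-((1 : Matrix (Fin ρ) (Fin ρ) ℂ)⁻¹ *ᵥ (P (A φ) + (0:ℂ) • P (B φ))))) := by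
    have h1 : Tendsto (fun ε : ℂ => P (A φ) + ε • P (B φ)) (𝓝[≠] 0) (𝓝 (P (A φ) + (0:ℂ) • P (B φ))) := by
      have : Continuous (fun ε : ℂ => P (A φ) + ε • P (B φ)) := by fun_prop
      exact (this.tendsto 0).mono_left nhdsWithin_le_nhds
    apply Tendsto.neg
    exact tendsto_mulVec hGi h1
  have hQc : Continuous Q := LinearMap.continuous_of_finiteDimensional Q
  have hNc : Continuous N := LinearMap.continuous_of_finiteDimensional N
  have hAc : Continuous A := LinearMap.continuous_of_finiteDimensional A
  have hBc : Continuous B := LinearMap.continuous_of_finiteDimensional B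
  set w0 := Q (-((1 : Matrix (Fin ρ) (Fin ρ) ℂ)⁻¹ *ᵥ (P (A φ) + (0:ℂ) • P (B φ)))) with hw0
  have hw : Tendsto (fun ε => Q (z ε)) (𝓝[≠] 0) (𝓝 w0) := (hQc.tendsto _).comp hz
  have hzero : ∀ᶠ ε in 𝓝[≠] (0:ℂ), (N + ε • A + ε^2 • B) (φ + ε • Q (z ε)) = 0 := by
    filter_upwards [hnull, hdet] with ε h1 h2
    apply h1
    have e1 : P ((N + ε • A + ε^2 • B) (Q (z ε))) = - (P (A φ) + ε • P (B φ)) := by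
      rw [← hG]
      simp only [z]
      rw [mulVec_neg, mulVec_mulVec, Matrix.mul_nonsing_inv _ (isUnit_iff_ne_zero.mpr h2), one_mulVec]
    rw [map_add, map_add, map_smul, map_smul, e1]
    simp only [LinearMap.add_apply, LinearMap.smul_apply, hφ, map_add, map_smul, map_zero]
    module
  refine ⟨fun ε => Q (z ε), w0, hw, hzero, ?_⟩
  have hlim : Tendsto (fun ε : ℂ => N (Q (z ε)) + A φ + ε • (B φ + A (Q (z ε)) + ε • B (Q (z ε)))) (𝓝[≠] 0)
      (𝓝 (N w0 + A φ + (0:ℂ) • (B φ + A w0 + (0:ℂ) • B w0))) := by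
    have hid : Tendsto (fun ε : ℂ => ε) (𝓝[≠] 0) (𝓝 0) := tendsto_id.mono_left nhdsWithin_le_nhds
    have tN := (hNc.tendsto w0).comp hw
    have tA := (hAc.tendsto w0).comp hw
    have tB := (hBc.tendsto w0).comp hw
    exact (tN.add tendsto_const_nhds).add (hid.smul ((tendsto_const_nhds.add tA).add (hid.smul tB)))
  have hlim0 : Tendsto (fun ε : ℂ => N (Q (z ε)) + A φ + ε • (B φ + A (Q (z ε)) + ε • B (Q (z ε)))) (𝓝[≠] 0) (𝓝 0) := by
    apply Tendsto.congr' _ tendsto_const_nhds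
    filter_upwards [hzero, self_mem_nhdsWithin] with ε h1 h2
    have h3 : ε • (N (Q (z ε)) + A φ + ε • (B φ + A (Q (z ε)) + ε • B (Q (z ε)))) = 0 := by
      rw [← h1]
      simp only [LinearMap.add_apply, LinearMap.smul_apply, map_add, map_smul, hφ]
      module
    exact ((smul_eq_zero.mp h3).resolve_left h2).symm
  have := tendsto_nhds_unique hlim hlim0
  simpa using this

theorem rank_pert {d q ρ : ℕ} (φ : Matrix (Fin q) (Fin d) ℂ) (hρ : φ.rank = ρ)
    {w : ℂ → Matrix (Fin q) (Fin d) ℂ} {w0 : Matrix (Fin q) (Fin d) ℂ} (hw : Tendsto w (𝓝[≠] 0) (𝓝 w0))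
    (h : ∀ᶠ ε in 𝓝[≠] (0:ℂ), (φ + ε • w ε).rank ≤ ρ) :
    w0 ∈ Wsp (LinearMap.ker φ.mulVecLin) (LinearMap.range φ.mulVecLin) := by
  intro v hv
  by_contra hcon
  have hv0 : φ *ᵥ v = 0 := hv
  let b : Basis (Fin ρ) ℂ (LinearMap.range φ.mulVecLin) := finBasisOfFinrankEq _ _ hρ
  have hu : ∀ i, ∃ u, φ *ᵥ u = (b i : Fin q → ℂ) := fun i => (b i).2
  choose u hu using hu
  let fam : ℂ → Option (Fin ρ) → (Fin q → ℂ) := fun ε o =>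
    o.elim (w ε *ᵥ v) (fun i => (φ + ε • w ε) *ᵥ u i)
  let fam0 : Option (Fin ρ) → (Fin q → ℂ) := fun o => o.elim (w0 *ᵥ v) (fun i => φ *ᵥ u i)
  have hli : LinearIndependent ℂ fam0 := by
    have e : fam0 = fun o => o.casesOn' (w0 *ᵥ v) (fun i => φ *ᵥ u i) := by
      funext o; cases o <;> rfl
    rw [e, linearIndependent_option']
    have e2 : (fun i => φ *ᵥ u i) = fun i => ((b i : LinearMap.range φ.mulVecLin) : Fin q → ℂ) := by
      funext i; exact hu i
    refine ⟨?_, ?_⟩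
    · rw [e2]
      have hb := b.linearIndependent.map' (LinearMap.range φ.mulVecLin).subtype (Submodule.ker_subtype _)
      exact hb
    · intro hmem
      apply hcon
      refine (Submodule.span_le.mpr ?_) hmem
      rintro _ ⟨i, rfl⟩
      exact ⟨u i, rfl⟩
  have hid : Tendsto (fun ε : ℂ => ε) (𝓝[≠] 0) (𝓝 0) := tendsto_id.mono_left nhdsWithin_le_nhds
  have ht : Tendsto fam (𝓝[≠] 0) (𝓝 fam0) := by
    rw [tendsto_pi_nhds]
    rintro (_ | i)
    · exact tendsto_mulVec hw tendsto_const_nhds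
    · have h1 : Tendsto (fun ε => φ + ε • w ε) (𝓝[≠] 0) (𝓝 (φ + (0:ℂ) • w0)) := tendsto_const_nhds.add (hid.smul hw)
      rw [zero_smul, add_zero] at h1
      exact tendsto_mulVec h1 tendsto_const_nhds
  have hopen : IsOpen {f : Option (Fin ρ) → (Fin q → ℂ) | LinearIndependent ℂ f} := isOpen_setOf_linearIndependent
  have hev := ht.eventually (hopen.mem_nhds hli)
  obtain ⟨ε, h1, h2, h3⟩ := (hev.and (h.and self_mem_nhdsWithin)).exists
  have h4 : ∀ o, fam ε o ∈ LinearMap.range (φ + ε • w ε).mulVecLin := by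
    rintro (_ | i)
    · refine ⟨ε⁻¹ • v, ?_⟩
      show (φ + ε • w ε) *ᵥ (ε⁻¹ • v) = w ε *ᵥ v
      rw [mulVec_smul, Matrix.add_mulVec, hv0, zero_add, Matrix.smul_mulVec, inv_smul_smul₀ h3]
    · exact ⟨u i, rfl⟩
  have h5 : LinearIndependent ℂ (fun o => (⟨fam ε o, h4 o⟩ : LinearMap.range (φ + ε • w ε).mulVecLin)) :=
    LinearIndependent.of_comp (Submodule.subtype _) h1
  have h6 := h5.fintype_card_le_finrank
  rw [Fintype.card_option, Fintype.card_fin] at h6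
  have h8 : finrank ℂ (LinearMap.range (φ + ε • w ε).mulVecLin) ≤ ρ := h2
  omega

theorem W_decomp {d q : ℕ} (φ w : Matrix (Fin q) (Fin d) ℂ)
    (hw : w ∈ Wsp (LinearMap.ker φ.mulVecLin) (LinearMap.range φ.mulVecLin)) :
    ∃ (η : Matrix (Fin q) (Fin q) ℂ) (ξ : Matrix (Fin d) (Fin d) ℂ), w = η * φ + φ * ξ := by
  -- a generalized inverse
  have hG : ∃ G : Matrix (Fin d) (Fin q) ℂ, φ * G * φ = φ := by
    obtain ⟨R, hR⟩ := LinearMap.exists_rightInverse_of_surjective φ.mulVecLin.rangeRestrict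
      (LinearMap.range_eq_top.mpr φ.mulVecLin.surjective_rangeRestrict)
    obtain ⟨p, hp⟩ := LinearMap.exists_leftInverse_of_injective (LinearMap.range φ.mulVecLin).subtype (Submodule.ker_subtype _)
    refine ⟨LinearMap.toMatrix' (R ∘ₗ p), ?_⟩
    apply Matrix.ext_of_mulVec_single
    intro i
    set v : Fin d → ℂ := Pi.single i 1
    rw [← mulVec_mulVec, ← mulVec_mulVec, LinearMap.toMatrix'_mulVec]
    have e1 : p (φ *ᵥ v) = φ.mulVecLin.rangeRestrict v :=
      congrArg (fun f => f (φ.mulVecLin.rangeRestrict v)) hp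
    have e2 : φ.mulVecLin.rangeRestrict (R (φ.mulVecLin.rangeRestrict v)) = φ.mulVecLin.rangeRestrict v :=
      congrArg (fun f => f (φ.mulVecLin.rangeRestrict v)) hR
    rw [LinearMap.comp_apply, e1]
    exact congrArg Subtype.val e2
  obtain ⟨G, hG⟩ := hG
  refine ⟨w * G, G * (w * (1 - G * φ)), ?_⟩
  have key : φ * (G * (w * (1 - G * φ))) = w * (1 - G * φ) := by
    apply Matrix.ext_of_mulVec_single
    intro i
    set v : Fin d → ℂ := Pi.single i 1
    have h1 : (1 - G * φ) *ᵥ v ∈ LinearMap.ker φ.mulVecLin := by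
      rw [LinearMap.mem_ker, mulVecLin_apply, mulVec_mulVec, Matrix.mul_sub, Matrix.mul_one, ← Matrix.mul_assoc, hG, sub_self, zero_mulVec]
    obtain ⟨t, ht⟩ := hw _ h1
    rw [mulVecLin_apply] at ht
    have e : φ *ᵥ t = (w * (1 - G * φ)) *ᵥ v := by rw [ht, mulVec_mulVec]
    rw [← Matrix.mul_assoc, ← mulVec_mulVec, ← e, mulVec_mulVec, hG]
  rw [key, Matrix.mul_sub, Matrix.mul_one, Matrix.mul_assoc]
  abel

end KC

open Module

set_option linter.all false

namespace KC
open Matrix ComplexOrder Filter Topology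

/-- The masked linear system. -/
def Mk {s d q : ℕ} (c : Fin s → Fin d → ℕ) (u : Fin s → Matrix (Fin d) (Fin d) ℂ)
    (y : Fin s → Matrix (Fin q) (Fin q) ℂ) :
    Matrix (Fin q) (Fin d) ℂ →ₗ[ℂ] (Fin s → Fin q → Fin d → ℂ) where
  toFun ψ := fun l i k => if c l k ≤ i then (y l * ψ * u l) i k else 0
  map_add' := by
    intro a b
    funext l i k
    by_cases h : c l k ≤ i <;> simp [h, Matrix.mul_add, Matrix.add_mul]
  map_smul' := by
    intro a b
    funext l i k
    by_cases h : c l k ≤ i <;> simp [h]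

theorem Mk_eq_zero {s d q : ℕ} {c : Fin s → Fin d → ℕ} {u : Fin s → Matrix (Fin d) (Fin d) ℂ}
    {y : Fin s → Matrix (Fin q) (Fin q) ℂ} {ψ : Matrix (Fin q) (Fin d) ℂ} :
    Mk c u y ψ = 0 ↔ ψ ∈ Hm c u y := by
  rw [mem_Hm]
  constructor
  · intro h l i k hk
    have := congrFun (congrFun (congrFun h l) i) k
    simpa [Mk, hk] using this
  · intro h
    funext l i k
    by_cases hk : c l k ≤ i
    · simpa [Mk, hk] using h l i k hk
    · simp [Mk, hk]

theorem ker_Mk {s d q : ℕ} (c : Fin s → Fin d → ℕ) (u : Fin s → Matrix (Fin d) (Fin d) ℂ)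
    (y : Fin s → Matrix (Fin q) (Fin q) ℂ) : LinearMap.ker (Mk c u y) = Hm c u y := by
  ext ψ
  rw [LinearMap.mem_ker, Mk_eq_zero]

theorem dense_of_line {E : Type} [AddCommGroup E] [Module ℂ E] [TopologicalSpace E] [ContinuousAdd E]
    [ContinuousSMul ℂ E] (f : E → ℂ) (hl : ∀ a b, Differentiable ℂ (fun z : ℂ => f (a + z • b)))
    (h : ∃ p, f p ≠ 0) : Dense {p | f p ≠ 0} := by
  obtain ⟨p, hp⟩ := h
  intro a
  have hd := hl a (p - a)
  have han : ∀ z, AnalyticAt ℂ (fun z : ℂ => f (a + z • (p - a))) z := fun z => hd.analyticAt z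
  have hne : ∀ᶠ z in 𝓝[≠] (0:ℂ), f (a + z • (p - a)) ≠ 0 := by
    rcases (han 0).eventually_eq_zero_or_eventually_ne_zero with h0 | h0
    · exfalso
      have : (fun z : ℂ => f (a + z • (p - a))) = fun _ => 0 := by
        have hA : AnalyticOnNhd ℂ (fun z : ℂ => f (a + z • (p - a))) Set.univ := fun z _ => han z
        have hB : AnalyticOnNhd ℂ (fun _ : ℂ => (0:ℂ)) Set.univ := fun z _ => analyticAt_const
        exact hA.eq_of_eventuallyEq hB h0
      have h1 := congrFun this 1
      simp only [one_smul, add_sub_cancel] at h1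
      exact hp h1
    · exact h0
  have ht : Tendsto (fun z : ℂ => a + z • (p - a)) (𝓝[≠] 0) (𝓝 a) := by
    have hc : Continuous (fun z : ℂ => a + z • (p - a)) := by fun_prop
    have := (hc.tendsto 0).mono_left (nhdsWithin_le_nhds (s := {0}ᶜ))
    simpa using this
  exact mem_closure_of_tendsto ht hne

theorem diff_det {n : ℕ} {M : ℂ → Matrix (Fin n) (Fin n) ℂ}
    (h : ∀ i j, Differentiable ℂ (fun z => M z i j)) : Differentiable ℂ (fun z => (M z).det) := by
  simp_rw [Matrix.det_apply']
  apply Differentiable.fun_sum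
  intro σ _
  apply Differentiable.mul (differentiable_const _)
  apply Differentiable.fun_finset_prod
  intro i _
  exact h _ _

theorem diff_adj {n : ℕ} {M : ℂ → Matrix (Fin n) (Fin n) ℂ}
    (h : ∀ i j, Differentiable ℂ (fun z => M z i j)) (i j : Fin n) :
    Differentiable ℂ (fun z => (M z).adjugate i j) := by
  simp_rw [Matrix.adjugate_apply]
  apply diff_det
  intro a b
  by_cases hab : a = j
  · subst hab
    simp
  · simp_rw [Matrix.updateRow_ne hab]
    exact h a b

/-- Product of all determinants. -/
noncomputable def dets {s n : ℕ} (x : Fin s → Matrix (Fin n) (Fin n) ℂ) : ℂ := ∏ l, (x l).det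

theorem dets_ne {s n : ℕ} {x : Fin s → Matrix (Fin n) (Fin n) ℂ} : dets x ≠ 0 ↔ ∀ l, (x l).det ≠ 0 := by
  simp [dets, Finset.prod_ne_zero_iff]

theorem Hm_adj {s d q : ℕ} (c : Fin s → Fin d → ℕ) {x : Fin s → Matrix (Fin d) (Fin d) ℂ}
    (hx : ∀ l, (x l).det ≠ 0) (y : Fin s → Matrix (Fin q) (Fin q) ℂ) :
    Hm c (fun l => (x l).adjugate) y = Hm c (fun l => (x l)⁻¹) y := by
  ext ψ
  rw [mem_Hm, mem_Hm]
  apply forall_congr'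
  intro l
  rw [mem_HL, mem_HL, Matrix.inv_def, Ring.inverse_eq_inv']
  simp [hx l]

/-- `(x, y)` realizes the minimal dimension. -/
def IsMin {s d q : ℕ} (c : Fin s → Fin d → ℕ) (x : Fin s → Matrix (Fin d) (Fin d) ℂ)
    (y : Fin s → Matrix (Fin q) (Fin q) ℂ) : Prop :=
  (∀ l, (x l).det ≠ 0) ∧ (∀ l, (y l).det ≠ 0) ∧ ∀ (x' : Fin s → Matrix (Fin d) (Fin d) ℂ)
    (y' : Fin s → Matrix (Fin q) (Fin q) ℂ), (∀ l, (x' l).det ≠ 0) → (∀ l, (y' l).det ≠ 0) →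
      finrank ℂ (Hm c (fun l => (x l)⁻¹) y) ≤ finrank ℂ (Hm c (fun l => (x' l)⁻¹) y')

theorem min_open {s d q : ℕ} (c : Fin s → Fin d → ℕ) :
    ∃ f : (Fin s → Matrix (Fin d) (Fin d) ℂ) × (Fin s → Matrix (Fin q) (Fin q) ℂ) → ℂ,
      Continuous f ∧ (∀ a b, Differentiable ℂ (fun z : ℂ => f (a + z • b))) ∧ (∃ p, f p ≠ 0) ∧
      ∀ p, f p ≠ 0 → IsMin c p.1 p.2 := by
  classical
  let hmv : (Fin s → Matrix (Fin d) (Fin d) ℂ) × (Fin s → Matrix (Fin q) (Fin q) ℂ) → ℕ :=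
    fun p => finrank ℂ (Hm c (fun l => (p.1 l)⁻¹) p.2)
  let D : Set ((Fin s → Matrix (Fin d) (Fin d) ℂ) × (Fin s → Matrix (Fin q) (Fin q) ℂ)) :=
    {p | (∀ l, (p.1 l).det ≠ 0) ∧ (∀ l, (p.2 l).det ≠ 0)}
  have hne : (hmv '' D).Nonempty := by
    refine ⟨hmv (fun _ => 1, fun _ => 1), _, ⟨?_, ?_⟩, rfl⟩ <;> intro l <;> simp
  obtain ⟨p0, hp0D, hp0⟩ := Nat.sInf_mem hne
  have hmin : ∀ p ∈ D, hmv p0 ≤ hmv p := by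
    intro p hp
    rw [hp0]
    exact Nat.sInf_le ⟨p, hp, rfl⟩
  let M : (Fin s → Matrix (Fin d) (Fin d) ℂ) × (Fin s → Matrix (Fin q) (Fin q) ℂ) → Matrix (Fin q) (Fin d) ℂ →ₗ[ℂ] (Fin s → Fin q → Fin d → ℂ) :=
    fun p => Mk c (fun l => (p.1 l).adjugate) p.2
  have hM : ∀ p ∈ D, finrank ℂ (LinearMap.ker (M p)) = hmv p := by
    intro p hp
    simp only [M, hmv]
    rw [ker_Mk, Hm_adj c hp.1]
  obtain ⟨ρ, hρ, P, Q, hPQ⟩ := exists_PQ (M p0)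
  let G : (Fin s → Matrix (Fin d) (Fin d) ℂ) × (Fin s → Matrix (Fin q) (Fin q) ℂ) → Matrix (Fin ρ) (Fin ρ) ℂ :=
    fun p => Matrix.of fun i j => P (M p (Q (Pi.single j 1))) i
  have hG : ∀ p z, G p *ᵥ z = P (M p (Q z)) := by
    intro p z
    have : G p = LinearMap.toMatrix' (P ∘ₗ M p ∘ₗ Q) := by
      ext i j
      rw [LinearMap.toMatrix'_apply]
      rfl
    rw [this, LinearMap.toMatrix'_mulVec]
    rfl
  have hPc : Continuous P := LinearMap.continuous_of_finiteDimensional P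
  refine ⟨fun p => (G p).det * (dets p.1 * dets p.2), ?_, ?_, ⟨p0, ?_⟩, ?_⟩
  · have hGc : Continuous G := by
      apply continuous_matrix
      intro i j
      have hin : Continuous (fun p => M p (Q (Pi.single j 1))) := by
        apply continuous_pi; intro l
        apply continuous_pi; intro a
        apply continuous_pi; intro k
        by_cases hk : c l k ≤ a
        · simp only [M, Mk, LinearMap.coe_mk, AddHom.coe_mk, hk, if_true]
          have h1 : Continuous (fun p : (Fin s → Matrix (Fin d) (Fin d) ℂ) × (Fin s → Matrix (Fin q) (Fin q) ℂ) => p.2 l * Q (Pi.single j 1) * (p.1 l).adjugate) := by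
            apply Continuous.matrix_mul
            · exact Continuous.matrix_mul ((continuous_apply l).comp continuous_snd) continuous_const
            · exact Continuous.matrix_adjugate ((continuous_apply l).comp continuous_fst)
          exact h1.matrix_elem a k
        · simp only [M, Mk, LinearMap.coe_mk, AddHom.coe_mk, hk, if_false]
          exact continuous_const
      exact (continuous_apply i).comp (hPc.comp hin)
    have hd1 : Continuous (fun p : (Fin s → Matrix (Fin d) (Fin d) ℂ) × (Fin s → Matrix (Fin q) (Fin q) ℂ) => dets p.1) := by
      apply continuous_finset_prod
      intro l _
      exact Continuous.matrix_det ((continuous_apply l).comp continuous_fst)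
    have hd2 : Continuous (fun p : (Fin s → Matrix (Fin d) (Fin d) ℂ) × (Fin s → Matrix (Fin q) (Fin q) ℂ) => dets p.2) := by
      apply continuous_finset_prod
      intro l _
      exact Continuous.matrix_det ((continuous_apply l).comp continuous_snd)
    exact hGc.matrix_det.mul (hd1.mul hd2)
  · intro a b
    have e1 : ∀ l i j, Differentiable ℂ (fun z : ℂ => (a + z • b).1 l i j) := by
      intro l i j
      show Differentiable ℂ (fun z : ℂ => a.1 l i j + z * b.1 l i j)
      fun_prop
    have e2 : ∀ l i j, Differentiable ℂ (fun z : ℂ => (a + z • b).2 l i j) := by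
      intro l i j
      show Differentiable ℂ (fun z : ℂ => a.2 l i j + z * b.2 l i j)
      fun_prop
    apply Differentiable.mul
    · apply diff_det
      intro i j
      have hin : Differentiable ℂ (fun z : ℂ => M (a + z • b) (Q (Pi.single j 1))) := by
        rw [differentiable_pi]; intro l
        rw [differentiable_pi]; intro i'
        rw [differentiable_pi]; intro k
        by_cases hk : c l k ≤ i'
        · simp only [M, Mk, LinearMap.coe_mk, AddHom.coe_mk, hk, if_true, Matrix.mul_apply]
          apply Differentiable.fun_sum
          intro t _
          apply Differentiable.mul
          · apply Differentiable.fun_sum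
            intro t' _
            exact (e2 l _ _).mul (differentiable_const _)
          · exact diff_adj (e1 l) _ _
        · simp only [M, Mk, LinearMap.coe_mk, AddHom.coe_mk, hk, if_false]
          exact differentiable_const _
      have hP2 : Differentiable ℂ (fun z : ℂ => P (M (a + z • b) (Q (Pi.single j 1)))) :=
        (LinearMap.toContinuousLinearMap P).differentiable.comp hin
      exact (differentiable_pi.mp hP2) i
    · apply Differentiable.mul
      · apply Differentiable.fun_finset_prod
        intro l _
        exact diff_det (e1 l)
      · apply Differentiable.fun_finset_prod
        intro l _
        exact diff_det (e2 l)
  · have : G p0 = 1 := by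
      apply Matrix.ext_of_mulVec_single
      intro i
      rw [hG, one_mulVec]
      exact congrArg (fun f => f (Pi.single i 1)) hPQ
    show (G p0).det * (dets p0.1 * dets p0.2) ≠ 0
    rw [this, det_one, one_mul]
    exact mul_ne_zero (dets_ne.mpr hp0D.1) (dets_ne.mpr hp0D.2)
  · intro p hp
    have h1 : (G p).det ≠ 0 := left_ne_zero_of_mul hp
    have h2 := right_ne_zero_of_mul hp
    have hx := dets_ne.mp (left_ne_zero_of_mul h2)
    have hy := dets_ne.mp (right_ne_zero_of_mul h2)
    refine ⟨hx, hy, ?_⟩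
    intro x' y' hx' hy'
    refine le_trans ?_ (hmin (x', y') ⟨hx', hy'⟩)
    show hmv p ≤ hmv p0
    rw [← hM p ⟨hx, hy⟩, ← hM p0 hp0D]
    have r1 := (M p).finrank_range_add_finrank_ker
    have r2 := (M p0).finrank_range_add_finrank_ker
    have hinj : Function.Injective (M p ∘ₗ Q) := by
      rw [← LinearMap.ker_eq_bot, LinearMap.ker_eq_bot']
      intro z hz
      have : G p *ᵥ z = 0 := by
        rw [hG]
        change P ((M p ∘ₗ Q) z) = 0
        rw [hz, map_zero]
      exact Matrix.eq_zero_of_mulVec_eq_zero h1 this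
    have r3 : finrank ℂ (LinearMap.range (M p ∘ₗ Q)) = ρ := by
      rw [LinearMap.finrank_range_of_inj hinj]; simp
    have r4 := Submodule.finrank_mono (LinearMap.range_comp_le_range Q (M p))
    omega

end KC

open Module

set_option linter.all false

namespace KC
open Matrix ComplexOrder Filter Topology

theorem Mk_path {s d q : ℕ} (c : Fin s → Fin d → ℕ) (u : Fin s → Matrix (Fin d) (Fin d) ℂ)
    (y : Fin s → Matrix (Fin q) (Fin q) ℂ) (η : Fin s → Matrix (Fin q) (Fin q) ℂ)
    (ξ : Fin s → Matrix (Fin d) (Fin d) ℂ) (ε : ℂ) :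
    Mk c (fun l => (1 + ε • ξ l) * u l) (fun l => y l * (1 + ε • η l)) =
      Mk c u y + ε • (Mk c u (fun l => y l * η l) + Mk c (fun l => ξ l * u l) y)
        + ε ^ 2 • Mk c (fun l => ξ l * u l) (fun l => y l * η l) := by
  refine LinearMap.ext fun ψ => ?_
  funext l i k
  by_cases h : c l k ≤ i
  · have e : (y l * (1 + ε • η l)) * ψ * ((1 + ε • ξ l) * u l) =
      y l * ψ * u l + ε • ((y l * η l) * ψ * u l + y l * ψ * (ξ l * u l)) + ε ^ 2 • ((y l * η l) * ψ * (ξ l * u l)) := by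
      simp only [Matrix.mul_add, Matrix.add_mul, Matrix.mul_one, Matrix.one_mul, Matrix.smul_mul, Matrix.mul_smul, smul_add, smul_smul, pow_two, Matrix.mul_assoc]
      abel
    have := congrFun (congrFun e i) k
    simpa [Mk, h] using this
  · simp [Mk, h]

theorem step_W {s d q : ℕ} (c : Fin s → Fin d → ℕ)
    {Ω : Set ((Fin s → Matrix (Fin d) (Fin d) ℂ) × (Fin s → Matrix (Fin q) (Fin q) ℂ))} (hΩ : IsOpen Ω)
    (hmin : ∀ p ∈ Ω, IsMin c p.1 p.2) {x : Fin s → Matrix (Fin d) (Fin d) ℂ}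
    {y : Fin s → Matrix (Fin q) (Fin q) ℂ} (hxy : (x, y) ∈ Ω) {φ : Matrix (Fin q) (Fin d) ℂ}
    (hφ : φ ∈ Hm c (fun l => (x l)⁻¹) y)
    (hmax : ∀ p ∈ Ω, ∀ ψ ∈ Hm c (fun l => (p.1 l)⁻¹) p.2, ψ.rank ≤ φ.rank) :
    Hm c (fun l => (x l)⁻¹) y ≤ Wsp (LinearMap.ker φ.mulVecLin) (LinearMap.range φ.mulVecLin) ∧
    ∀ w : Fin s → Matrix (Fin q) (Fin d) ℂ,
      (∀ l, w l ∈ Wsp (LinearMap.ker φ.mulVecLin) (LinearMap.range φ.mulVecLin)) →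
      ∃ w0 ∈ Wsp (LinearMap.ker φ.mulVecLin) (LinearMap.range φ.mulVecLin),
        ∀ l, w0 + w l ∈ HL (c l) ((x l)⁻¹) (y l) := by
  constructor
  · intro ψ hψ
    apply rank_pert φ rfl (w := fun _ => ψ) (w0 := ψ) tendsto_const_nhds
    refine Eventually.of_forall fun ε => hmax _ hxy _ ?_
    exact Submodule.add_mem _ hφ (Submodule.smul_mem _ _ hψ)
  · intro w hw
    choose η ξ hηξ using fun l => W_decomp φ (w l) (hw l)
    obtain ⟨hx, hy, hm⟩ := hmin _ hxy
    simp only at hx hy hm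
    set u : Fin s → Matrix (Fin d) (Fin d) ℂ := fun l => (x l)⁻¹ with hu
    have hudet : ∀ l, (u l).det ≠ 0 := by
      intro l
      simp [hu, Matrix.det_nonsing_inv, hx l]
    have hcu : ∀ l, Tendsto (fun ε : ℂ => (1 + ε • ξ l) * u l) (𝓝 0) (𝓝 (u l)) := by
      intro l
      have : Continuous (fun ε : ℂ => (1 + ε • ξ l) * u l) := by fun_prop
      simpa using this.tendsto 0
    have hcy : ∀ l, Tendsto (fun ε : ℂ => y l * (1 + ε • η l)) (𝓝 0) (𝓝 (y l)) := by
      intro l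
      have : Continuous (fun ε : ℂ => y l * (1 + ε • η l)) := by fun_prop
      simpa using this.tendsto 0
    have hcx : ∀ l, Tendsto (fun ε : ℂ => ((1 + ε • ξ l) * u l)⁻¹) (𝓝 0) (𝓝 (x l)) := by
      intro l
      have h1 := tendsto_inv_mat (hcu l) (hudet l)
      have h2 : (u l)⁻¹ = x l := by
        simp only [hu]
        exact Matrix.nonsing_inv_nonsing_inv _ (isUnit_iff_ne_zero.mpr (hx l))
      rwa [h2] at h1
    have hdu : ∀ᶠ ε in 𝓝 (0:ℂ), ∀ l, ((1 + ε • ξ l) * u l).det ≠ 0 := by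
      rw [eventually_all]
      intro l
      have hd : Tendsto (fun ε : ℂ => ((1 + ε • ξ l) * u l).det) (𝓝 0) (𝓝 (u l).det) :=
        ((continuous_id.matrix_det).tendsto (u l)).comp (hcu l)
      exact hd.eventually_ne (hudet l)
    have hin : ∀ᶠ ε in 𝓝 (0:ℂ), ((fun l => ((1 + ε • ξ l) * u l)⁻¹), (fun l => y l * (1 + ε • η l))) ∈ Ω := by
      have ht : Tendsto (fun ε : ℂ => (((fun l => ((1 + ε • ξ l) * u l)⁻¹), (fun l => y l * (1 + ε • η l))) :
          (Fin s → Matrix (Fin d) (Fin d) ℂ) × (Fin s → Matrix (Fin q) (Fin q) ℂ))) (𝓝 0) (𝓝 (x, y)) := by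
        apply Tendsto.prodMk_nhds
        · exact tendsto_pi_nhds.mpr hcx
        · exact tendsto_pi_nhds.mpr hcy
      exact ht (hΩ.mem_nhds hxy)
    have hinv : ∀ᶠ ε in 𝓝 (0:ℂ), (fun l => (((1 + ε • ξ l) * u l)⁻¹)⁻¹) = fun l => (1 + ε • ξ l) * u l := by
      filter_upwards [hdu] with ε hε
      funext l
      exact Matrix.nonsing_inv_nonsing_inv _ (isUnit_iff_ne_zero.mpr (hε l))
    have hall := (hin.and hinv).filter_mono (nhdsWithin_le_nhds (s := {0}ᶜ))
    obtain ⟨W, w0, hW, hWe, hw0⟩ := perturb (Mk c u y)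
      (Mk c u (fun l => y l * η l) + Mk c (fun l => ξ l * u l) y)
      (Mk c (fun l => ξ l * u l) (fun l => y l * η l)) (by
        filter_upwards [hall] with ε hε
        rw [← Mk_path, ker_Mk, ker_Mk]
        have := hm _ _ (hmin _ hε.1).1 (hmin _ hε.1).2.1
        simp only at this
        rwa [hε.2] at this) φ (Mk_eq_zero.mpr hφ)
    refine ⟨w0, ?_, ?_⟩
    · apply rank_pert φ rfl hW
      filter_upwards [hall, hWe] with ε hε hε2
      rw [← Mk_path, Mk_eq_zero] at hε2
      apply hmax _ hε.1
      simp only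
      rw [hε.2]
      exact hε2
    · intro l
      rw [mem_HL]
      intro i k hk
      have := congrFun (congrFun (congrFun hw0 l) i) k
      simp only [Mk, LinearMap.add_apply, LinearMap.coe_mk, AddHom.coe_mk, Pi.add_apply, hk, if_true, Pi.zero_apply] at this
      rw [hηξ l]
      simp only [Matrix.mul_add, Matrix.add_mul, Matrix.mul_assoc, Matrix.add_apply] at this ⊢
      exact this

end KC

open Module

set_option linter.all false

namespace KC
open Matrix ComplexOrder Filter Topology

theorem dense_finset {X ι : Type} [TopologicalSpace X] (t : Finset ι) (U : ι → Set X)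
    (ho : ∀ i, IsOpen (U i)) (hd : ∀ i, Dense (U i)) :
    IsOpen (⋂ i ∈ t, U i) ∧ Dense (⋂ i ∈ t, U i) := by
  classical
  induction t using Finset.induction_on with
  | empty => simp
  | insert a t ha ih =>
    rw [Finset.set_biInter_insert]
    exact ⟨(ho a).inter ih.1, (hd a).inter_of_isOpen_left ih.2 (ho a)⟩

theorem dense_iInter_fin {X ι : Type} [TopologicalSpace X] [Fintype ι] (U : ι → Set X)
    (ho : ∀ i, IsOpen (U i)) (hd : ∀ i, Dense (U i)) :
    IsOpen (⋂ i, U i) ∧ Dense (⋂ i, U i) := by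
  simpa using dense_finset Finset.univ U ho hd

theorem isOpen_dets {s n : ℕ} : IsOpen {x : Fin s → Matrix (Fin n) (Fin n) ℂ | ∀ l, (x l).det ≠ 0} := by
  have : {x : Fin s → Matrix (Fin n) (Fin n) ℂ | ∀ l, (x l).det ≠ 0} = ⋂ l, {x | (x l).det ≠ 0} := by
    ext; simp
  rw [this]
  apply isOpen_iInter_of_finite
  intro l
  apply isOpen_ne_fun
  · exact Continuous.matrix_det (continuous_apply l)
  · exact continuous_const

theorem gen_id {s d : ℕ} : Gen (fun (_ : Fin s) (k : Fin d) => k) := by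
  apply gen_of_interior (fun _ => strictMono_id)
  refine ⟨fun _ => 1, mem_interior.mpr ⟨_, ?_, isOpen_dets, ?_⟩⟩
  · intro x hx
    refine ⟨⊤, by simp, ?_⟩
    intro l k
    have hF := isFlag_Fl (Matrix.mul_nonsing_inv (x l) (isUnit_iff_ne_zero.mpr (hx l)))
    rw [dm_full hF]
    have := k.2
    show (k:ℕ) + 1 ≤ min ((k:ℕ) + 1) d
    omega
  · intro l; simp

theorem gen_comp {s d d' r : ℕ} {I : Fin s → Fin d → Fin r} {I' : Fin s → Fin d' → Fin d}
    (hsm : ∀ l, StrictMono (I l)) (hsm' : ∀ l, StrictMono (I' l)) (hI : Gen I) (hI' : Gen I') :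
    Gen (fun l k => I l (I' l k)) := by
  rw [Gen, Set.eq_univ_iff_forall]
  intro g
  have hg : g ∈ Zset I := by rw [hI]; trivial
  obtain ⟨S, hS, hp⟩ := hg
  obtain ⟨Y, C, hf, -⟩ := exists_frame hS hp
  have hg' : (fun l => (C l)ᴴ) ∈ Zset I' := by rw [hI']; trivial
  obtain ⟨S', hS', hp'⟩ := hg'
  obtain ⟨Y', C', hf', -⟩ := exists_frame hS' hp'
  have hCC : ∀ l, C l * (C l)ᴴ = 1 := fun l => mul_eq_one_comm.mp (hf.hC l)
  apply mem_Zset_of_frame (fun l => (hsm l).comp (hsm' l)) (Y := Y * Y') (W := Y'ᴴ * Yᴴ) (C := C')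
    (D := fun l => (C' l)ᴴ)
  · calc Y'ᴴ * Yᴴ * (Y * Y') = Y'ᴴ * (Yᴴ * Y) * Y' := by simp only [Matrix.mul_assoc]
      _ = 1 := by rw [hf.hY, Matrix.mul_one, hf'.hY]
  · exact hf'.hC
  · intro l i k hik
    have e : g l * (Y * Y' * C' l) = (g l * (Y * C l)) * ((C l)ᴴ * (Y' * C' l)) := by
      calc g l * (Y * Y' * C' l) = g l * (Y * (1 : Matrix (Fin d) (Fin d) ℂ) * (Y' * C' l)) := by
            simp only [Matrix.mul_assoc, Matrix.mul_one, Matrix.one_mul]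
        _ = _ := by rw [← hCC l]; simp only [Matrix.mul_assoc]
    rw [e, Matrix.mul_apply]
    apply Finset.sum_eq_zero
    intro m _
    by_cases hm : I' l k < m
    · rw [hf'.hz l m k hm, mul_zero]
    · rw [hf.hz l i m (lt_of_le_of_lt ((hsm l).monotone (not_lt.mp hm)) hik), zero_mul]

/-- Euler pairing. -/
def pair {s d : ℕ} (q : ℕ) (c : Fin s → Fin d → ℕ) : ℤ :=
  d * q - ∑ l, ∑ k, ((q : ℤ) - c l k)

theorem pair_eq {s d : ℕ} (q : ℕ) (c : Fin s → Fin d → ℕ) :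
    pair q c = d * q - s * (d * q) + ∑ l, ∑ k, (c l k : ℤ) := by
  simp only [pair, Finset.sum_sub_distrib, Finset.sum_const, Finset.card_univ, Fintype.card_fin, nsmul_eq_mul]
  ring

theorem schofield {s q : ℕ} (hs : 1 ≤ s) : ∀ (d : ℕ) (c : Fin s → Fin d → ℕ), (∀ l, Monotone (c l)) →
    ∃ (x : Fin s → Matrix (Fin d) (Fin d) ℂ) (y : Fin s → Matrix (Fin q) (Fin q) ℂ),
      (∀ l, (x l).det ≠ 0) ∧ (∀ l, (y l).det ≠ 0) ∧ ∃ (d' : ℕ) (I : Fin s → Fin d' → Fin d),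
        (∀ l, StrictMono (I l)) ∧ Gen I ∧
        (finrank ℂ (Hm c (fun l => (x l)⁻¹) y) : ℤ) ≤ pair q c - pair q (fun l k => c l (I l k)) := by
  classical
  intro d
  induction d using Nat.strong_induction_on with
  | _ d ih =>
  intro c hc
  obtain ⟨f, hfc, hfl, hfn, hfm⟩ := min_open (q := q) c
  choose F hFc hFl hFn hFm using fun (i : Σ d' : Fin d, (Fin s → Fin d' → Fin d)) =>
    min_open (q := q) (fun l k => c l (i.2 l k))
  choose P hP using hFn
  let X := (Fin s → Matrix (Fin d) (Fin d) ℂ) × (Fin s → Matrix (Fin q) (Fin q) ℂ)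
  let U1 : (Σ d' : Fin d, (Fin s → Fin d' → Fin d)) → Set X := fun i => {p | F i ((P i).1, p.2) ≠ 0}
  let U2 : (Σ d' : Fin d, (Fin s → Fin d' → Fin d)) → Set X := fun i =>
    {p | ((∀ l, StrictMono (i.2 l)) ∧ ¬ Gen i.2) → p.1 ∉ Zset i.2}
  have hU1 := dense_iInter_fin U1 (by
    intro i
    apply isOpen_ne_fun _ continuous_const
    exact (hFc i).comp (continuous_const.prodMk continuous_snd)) (by
    intro i
    have h1 : Dense {b | F i ((P i).1, b) ≠ 0} := by
      apply dense_of_line (fun b => F i ((P i).1, b))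
      · intro a b
        have := hFl i ((P i).1, a) (0, b)
        simpa using this
      · exact ⟨(P i).2, hP i⟩
    exact h1.preimage isOpenMap_snd)
  have hU2 := dense_iInter_fin U2 (by
    intro i
    by_cases h : (∀ l, StrictMono (i.2 l)) ∧ ¬ Gen i.2
    · have : U2 i = Prod.fst ⁻¹' (Zset i.2)ᶜ := by
        ext p; simp [U2, h]
      rw [this]
      exact (isClosed_Zset h.1).isOpen_compl.preimage continuous_fst
    · have : U2 i = Set.univ := by
        ext p; simp only [U2, Set.mem_setOf_eq, Set.mem_univ, iff_true]; intro h'; exact absurd h' h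
      rw [this]; exact isOpen_univ) (by
    intro i
    by_cases h : (∀ l, StrictMono (i.2 l)) ∧ ¬ Gen i.2
    · have : U2 i = Prod.fst ⁻¹' (Zset i.2)ᶜ := by
        ext p; simp [U2, h]
      rw [this]
      have hd : Dense (Zset i.2)ᶜ := by
        rw [← interior_eq_empty_iff_dense_compl]
        by_contra hne
        exact h.2 (gen_of_interior h.1 (Set.nonempty_iff_ne_empty.mpr hne))
      exact hd.preimage isOpenMap_fst
    · have : U2 i = Set.univ := by
        ext p; simp only [U2, Set.mem_setOf_eq, Set.mem_univ, iff_true]; intro h'; exact absurd h' h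
      rw [this]; exact dense_univ)
  let U0 : Set X := {p | f p ≠ 0}
  have hU0o : IsOpen U0 := isOpen_ne_fun hfc continuous_const
  have hU0d : Dense U0 := dense_of_line f hfl hfn
  let Ω : Set X := U0 ∩ ((⋂ i, U1 i) ∩ (⋂ i, U2 i))
  have hΩo : IsOpen Ω := hU0o.inter (hU1.1.inter hU2.1)
  have hΩd : Dense Ω := hU0d.inter_of_isOpen_left (hU1.2.inter_of_isOpen_left hU2.2 hU1.1) hU0o
  have hmin : ∀ p ∈ Ω, IsMin c p.1 p.2 := fun p hp => hfm p hp.1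
  obtain ⟨p1, hp1⟩ := hΩd.nonempty
  let A : Set ℕ := {n | ∃ p ∈ Ω, ∃ φ ∈ Hm c (fun l => (p.1 l)⁻¹) p.2, n = φ.rank}
  have hAn : A.Nonempty := ⟨_, p1, hp1, 0, Submodule.zero_mem _, rfl⟩
  have hAb : BddAbove A := by
    refine ⟨d, ?_⟩
    rintro n ⟨p, hp, φ, hφ, rfl⟩
    simpa using φ.rank_le_width
  obtain ⟨⟨x, y⟩, hxy, φ, hφ, hrk⟩ := Nat.sSup_mem hAn hAb
  have hmax : ∀ p ∈ Ω, ∀ ψ ∈ Hm c (fun l => (p.1 l)⁻¹) p.2, ψ.rank ≤ φ.rank := by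
    intro p hp ψ hψ
    rw [← hrk]
    exact le_csSup hAb ⟨p, hp, ψ, hψ, rfl⟩
  simp only at hφ
  obtain ⟨hx, hy, hxm⟩ := hmin _ hxy
  simp only at hx hy hxm
  refine ⟨x, y, hx, hy, ?_⟩
  rcases Nat.eq_zero_or_pos φ.rank with h0 | hpos
  · refine ⟨d, fun l k => k, fun l => strictMono_id, gen_id, ?_⟩
    have hb : Hm c (fun l => (x l)⁻¹) y = ⊥ := by
      rw [Submodule.eq_bot_iff]
      intro ψ hψ
      have h1 := hmax _ hxy ψ hψ
      rw [h0] at h1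
      have h2 : ψ.rank = 0 := by omega
      have h3 : LinearMap.range ψ.mulVecLin = ⊥ := Submodule.finrank_eq_zero.mp h2
      have h4 : ψ.mulVecLin = 0 := LinearMap.range_eq_bot.mp h3
      apply Matrix.ext_of_mulVec_single
      intro i
      rw [Matrix.zero_mulVec, ← Matrix.mulVecLin_apply, h4]
      rfl
    rw [hb]; simp
  · obtain ⟨hHW, hsurj⟩ := step_W c hΩo hmin hxy hφ hmax
    set K := LinearMap.ker φ.mulVecLin with hK
    set R := LinearMap.range φ.mulVecLin with hR
    have hRr : finrank ℂ R = φ.rank := rfl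
    have hrn : finrank ℂ R + finrank ℂ K = d := by
      have := φ.mulVecLin.finrank_range_add_finrank_ker
      simpa using this
    have hKd : finrank ℂ K < d := by omega
    obtain ⟨D, hD⟩ : ∃ D, D = finrank ℂ K := ⟨_, rfl⟩
    have hDd : D < d := by omega
    have hFx : ∀ l, IsFlag d (Fl (x l)) := fun l => isFlag_Fl (Matrix.mul_nonsing_inv (x l) (isUnit_iff_ne_zero.mpr (hx l)))
    choose I hI using fun l => exists_type (hFx l) K hD.symm
    have hsm : ∀ l, StrictMono (I l) := fun l => (hI l).sm
    let i0 : Σ d' : Fin d, (Fin s → Fin d' → Fin d) := ⟨⟨D, hDd⟩, I⟩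
    have hgen : Gen I := by
      by_contra hng
      have h1 := Set.mem_iInter.mp hxy.2.2 i0
      exact h1 ⟨hsm, hng⟩ ⟨K, hD.symm, fun l => (hI l).pos⟩
    have hmin0 : IsMin (fun l k => c l (I l k)) (P i0).1 y :=
      hFm i0 ((P i0).1, y) (Set.mem_iInter.mp hxy.2.1 i0)
    obtain ⟨x', y', hx', hy', d'', I', hsm', hgen', hle⟩ := ih D hDd (fun l k => c l (I l k))
      (fun l => (hc l).comp (hsm l).monotone)
    refine ⟨d'', fun l k => I l (I' l k), fun l => (hsm l).comp (hsm' l), gen_comp hsm hsm' hgen hgen', ?_⟩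
    have hm1 := hmin0.2.2 x' y' hx' hy'
    have b1 := surj_count (Wsp K R) (fun l => HL (c l) ((x l)⁻¹) (y l)) hHW hsurj
    have b2 := fun l => finrank_W_inf_HL (hc l) (Matrix.mul_nonsing_inv (x l) (isUnit_iff_ne_zero.mpr (hx l)))
      (Matrix.mul_nonsing_inv (y l) (isUnit_iff_ne_zero.mpr (hy l))) K R (hI l)
    have b3 := finrank_Wsp K R
    have b4 := lemma_B (fun l k => c l (I l k)) (fun l => ((P i0).1 l)⁻¹) y R
    have b5 := Finset.sum_le_sum (fun l (_ : l ∈ (Finset.univ : Finset (Fin s))) => b2 l)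
    rw [pair_eq] at hle ⊢
    rw [pair_eq] at hle ⊢
    simp only [Finset.sum_sub_distrib, Finset.sum_add_distrib, Finset.sum_const, Finset.card_univ, Fintype.card_fin, nsmul_eq_mul] at b1 b4 b5 hle ⊢
    have hdD : (d:ℤ) = finrank ℂ R + D := by rw [hD]; exact_mod_cast hrn.symm
    rw [← hD] at b3
    have hs' : (1:ℤ) ≤ s := by exact_mod_cast hs
    have b6 := mul_le_mul_of_nonneg_left b3 (sub_nonneg.mpr hs')
    change (finrank ℂ (Hm c (fun l => (x l)⁻¹) y) : ℤ) ≤ _ at b1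
    have hm2 : (finrank ℂ (Hm (fun l k => c l (I l k)) (fun l => ((P i0).1 l)⁻¹) y) : ℤ) ≤
      finrank ℂ (Hm (fun l k => c l (I l k)) (fun l => (x' l)⁻¹) y') := by exact_mod_cast hm1
    generalize (finrank ℂ (Hm c (fun l => (x l)⁻¹) y) : ℤ) = h0 at *
    generalize (finrank ℂ (Wsp K R) : ℤ) = wd at *
    generalize (finrank ℂ R : ℤ) = rd at *
    nlinarith
end KC

open Module

set_option linter.all false

namespace KC
open Matrix ComplexOrder Filter Topology

/-- incidence map -/
def incid {s d r : ℕ} (J : Fin s → Fin d → Fin r)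
    (p : (Fin s → Fin r → Fin r → ℂ) × (Fin r → Fin d → ℂ) × (Fin s → Fin d → Fin d → ℂ)) :
    (Fin s → Fin r → Fin r → ℂ) × ({q : Fin s × Fin r × Fin d // J q.1 q.2.2 < q.2.1} → ℂ) :=
  (p.1, fun q => ∑ a, p.1 q.1.1 q.1.2.1 a * ∑ b, p.2.1 a b * p.2.2 q.1.1 b q.1.2.2)

theorem contDiff_incid {s d r : ℕ} (J : Fin s → Fin d → Fin r) : ContDiff ℂ 1 (incid J) := by
  unfold incid
  apply ContDiff.prodMk contDiff_fst
  rw [contDiff_pi]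
  intro q
  apply ContDiff.sum
  intro a _
  apply ContDiff.mul
  · exact contDiff_pi.mp (contDiff_pi.mp (contDiff_pi.mp contDiff_fst _) _) _
  · apply ContDiff.sum
    intro b _
    apply ContDiff.mul
    · exact contDiff_pi.mp (contDiff_pi.mp (contDiff_fst.comp contDiff_snd) _) _
    · exact contDiff_pi.mp (contDiff_pi.mp (contDiff_pi.mp (contDiff_snd.comp contDiff_snd) _) _) _

theorem hasDerivAt_incid {s d r : ℕ} (J : Fin s → Fin d → Fin r)
    (p v : (Fin s → Fin r → Fin r → ℂ) × (Fin r → Fin d → ℂ) × (Fin s → Fin d → Fin d → ℂ)) :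
    HasDerivAt (fun t : ℂ => incid J (p + t • v))
      (v.1, fun q => ∑ a, (v.1 q.1.1 q.1.2.1 a * (∑ b, p.2.1 a b * p.2.2 q.1.1 b q.1.2.2) +
        p.1 q.1.1 q.1.2.1 a * ∑ b, (v.2.1 a b * p.2.2 q.1.1 b q.1.2.2 + p.2.1 a b * v.2.2 q.1.1 b q.1.2.2))) 0 := by
  have hlin : ∀ a b : ℂ, HasDerivAt (fun t : ℂ => a + t * b) b 0 := by
    intro a b
    simpa using ((hasDerivAt_id (0:ℂ)).mul_const b).const_add a
  apply HasDerivAt.prodMk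
  · rw [hasDerivAt_pi]; intro l
    rw [hasDerivAt_pi]; intro i
    rw [hasDerivAt_pi]; intro j
    exact hlin _ _
  · rw [hasDerivAt_pi]
    intro q
    apply HasDerivAt.fun_sum
    intro a _
    have h1 := hlin (p.1 q.1.1 q.1.2.1 a) (v.1 q.1.1 q.1.2.1 a)
    have h2 : HasDerivAt (fun t : ℂ => ∑ b, (p.2.1 a b + t * v.2.1 a b) * (p.2.2 q.1.1 b q.1.2.2 + t * v.2.2 q.1.1 b q.1.2.2))
      (∑ b, (v.2.1 a b * p.2.2 q.1.1 b q.1.2.2 + p.2.1 a b * v.2.2 q.1.1 b q.1.2.2)) 0 := by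
      apply HasDerivAt.fun_sum
      intro b _
      have h3 := (hlin (p.2.1 a b) (v.2.1 a b)).fun_mul (hlin (p.2.2 q.1.1 b q.1.2.2) (v.2.2 q.1.1 b q.1.2.2))
      simp only [zero_mul, add_zero] at h3
      exact h3
    have h4 := h1.fun_mul h2
    simp only [zero_mul, add_zero] at h4
    exact h4

theorem gen_of_tangent {s d r : ℕ} {J : Fin s → Fin d → Fin r} (hJ : ∀ l, StrictMono (J l))
    {g : Fin s → Matrix (Fin r) (Fin r) ℂ} {Y : Matrix (Fin r) (Fin d) ℂ} {W : Matrix (Fin d) (Fin r) ℂ}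
    {C D : Fin s → Matrix (Fin d) (Fin d) ℂ} (hY : W * Y = 1) (hC : ∀ l, D l * C l = 1)
    (hz : ∀ l i k, J l k < i → (g l * (Y * C l)) i k = 0)
    (hsurj : ∀ τ : Fin s → Matrix (Fin r) (Fin d) ℂ, ∃ (ψ : Matrix (Fin r) (Fin d) ℂ)
      (C' : Fin s → Matrix (Fin d) (Fin d) ℂ), ∀ l i k, J l k < i → (g l * (ψ * C l + Y * C' l)) i k = τ l i k) :
    Gen J := by
  classical
  let p : (Fin s → Fin r → Fin r → ℂ) × (Fin r → Fin d → ℂ) × (Fin s → Fin d → Fin d → ℂ) := (g, Y, C)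
  have hst : HasStrictFDerivAt (incid J) (fderiv ℂ (incid J) p) p :=
    (contDiff_incid J).contDiffAt.hasStrictFDerivAt (by simp)
  have hder : ∀ v, fderiv ℂ (incid J) p v = (v.1, fun q => ∑ a, (v.1 q.1.1 q.1.2.1 a * (∑ b, p.2.1 a b * p.2.2 q.1.1 b q.1.2.2) +
        p.1 q.1.1 q.1.2.1 a * ∑ b, (v.2.1 a b * p.2.2 q.1.1 b q.1.2.2 + p.2.1 a b * v.2.2 q.1.1 b q.1.2.2))) := by
    intro v
    have h1 : HasDerivAt (fun t : ℂ => p + t • v) v 0 := by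
      simpa using ((hasDerivAt_id (0:ℂ)).smul_const v).const_add p
    have h2 : HasFDerivAt (incid J) (fderiv ℂ (incid J) p) (p + (0:ℂ) • v) := by
      simpa using hst.hasFDerivAt
    have h3 := h2.comp_hasDerivAt (0:ℂ) h1
    exact h3.unique (hasDerivAt_incid J p v)
  have hrange : (fderiv ℂ (incid J) p).range = ⊤ := by
    rw [LinearMap.range_eq_top]
    rintro ⟨h, τ⟩
    obtain ⟨ψ, C', hψ⟩ := hsurj (fun l => Matrix.of fun i k =>
      if hh : J l k < i then τ ⟨(l, i, k), hh⟩ - ∑ a, h l i a * ∑ b, Y a b * C l b k else 0)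
    refine ⟨(h, ψ, C'), ?_⟩
    refine (hder _).trans ?_
    refine Prod.ext rfl ?_
    funext ⟨⟨l, i, k⟩, hq⟩
    have := hψ l i k hq
    simp only [Matrix.of_apply, dif_pos hq] at this
    simp only [Finset.sum_add_distrib]
    simp only [Matrix.mul_apply, Matrix.add_apply] at this
    simp only [p]
    rw [this]
    ring
  have hmap := hst.map_nhds_eq_of_surj hrange
  have hO : {p : (Fin s → Fin r → Fin r → ℂ) × (Fin r → Fin d → ℂ) × (Fin s → Fin d → Fin d → ℂ) |
      (∀ l, (Matrix.of (p.2.2 l)).det ≠ 0) ∧ (W * Matrix.of p.2.1).det ≠ 0} ∈ 𝓝 p := by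
    have o1 : IsOpen {p : (Fin s → Fin r → Fin r → ℂ) × (Fin r → Fin d → ℂ) × (Fin s → Fin d → Fin d → ℂ) |
      (∀ l, (Matrix.of (p.2.2 l)).det ≠ 0)} := by
      have : Continuous (fun p : (Fin s → Fin r → Fin r → ℂ) × (Fin r → Fin d → ℂ) × (Fin s → Fin d → Fin d → ℂ) =>
        (p.2.2 : Fin s → Matrix (Fin d) (Fin d) ℂ)) := continuous_snd.comp continuous_snd
      exact isOpen_dets.preimage this
    have o2 : IsOpen {p : (Fin s → Fin r → Fin r → ℂ) × (Fin r → Fin d → ℂ) × (Fin s → Fin d → Fin d → ℂ) |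
      (W * Matrix.of p.2.1).det ≠ 0} := by
      apply isOpen_ne_fun _ continuous_const
      apply Continuous.matrix_det
      apply Continuous.matrix_mul continuous_const
      exact continuous_fst.comp continuous_snd
    refine (o1.inter o2).mem_nhds ⟨?_, ?_⟩
    · intro l
      have := congrArg Matrix.det (hC l)
      rw [Matrix.det_mul, Matrix.det_one] at this
      exact right_ne_zero_of_mul (this ▸ one_ne_zero)
    · show (W * Y).det ≠ 0
      rw [hY]; simp
  have himg : incid J '' _ ∈ 𝓝 (incid J p) := hmap ▸ image_mem_map hO
  have hval : incid J p = (g, 0) := by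
    refine Prod.ext rfl ?_
    funext ⟨⟨l, i, k⟩, hq⟩
    have := hz l i k hq
    simp only [Matrix.mul_apply] at this
    exact this
  rw [hval] at himg
  have hcont : Tendsto (fun g' : Fin s → Matrix (Fin r) (Fin r) ℂ =>
      ((g', 0) : (Fin s → Fin r → Fin r → ℂ) × ({q : Fin s × Fin r × Fin d // J q.1 q.2.2 < q.2.1} → ℂ)))
      (𝓝 g) (𝓝 (g, 0)) := by
    have : Continuous (fun g' : Fin s → Matrix (Fin r) (Fin r) ℂ =>
      ((g', 0) : (Fin s → Fin r → Fin r → ℂ) × ({q : Fin s × Fin r × Fin d // J q.1 q.2.2 < q.2.1} → ℂ))) :=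
      continuous_id.prodMk continuous_const
    exact this.tendsto g
  apply gen_of_interior hJ
  refine ⟨g, mem_interior_iff_mem_nhds.mpr ?_⟩
  filter_upwards [hcont himg] with g' hg'
  obtain ⟨⟨G, Y', C'⟩, ⟨hC', hY'⟩, he⟩ := hg'
  have e1 : G = g' := congrArg Prod.fst he
  subst e1
  apply mem_Zset_of_frame hJ (Y := Matrix.of Y') (W := (W * Matrix.of Y')⁻¹ * W) (C := fun l => Matrix.of (C' l))
    (D := fun l => (Matrix.of (C' l))⁻¹)
  · rw [Matrix.mul_assoc]
    exact Matrix.nonsing_inv_mul _ (isUnit_iff_ne_zero.mpr hY')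
  · intro l
    exact Matrix.nonsing_inv_mul _ (isUnit_iff_ne_zero.mpr (hC' l))
  · intro l i k hq
    have := congrFun (congrArg Prod.snd he) ⟨(l, i, k), hq⟩
    simp only [incid] at this
    have e : (Matrix.of (G l) * (Matrix.of Y' * Matrix.of (C' l))) i k = 0 := by
      simp only [Matrix.mul_apply, Matrix.of_apply]
      exact this
    exact e

end KC

open Module

set_option linter.all false

namespace KC
open Matrix ComplexOrder Filter Topology

theorem card_ge {q n : ℕ} : (Finset.univ.filter (fun m : Fin q => n ≤ (m:ℕ))).card = q - n := by
  have h1 : (Finset.univ.filter (fun m : Fin q => n ≤ (m:ℕ))).card + (Finset.univ.filter (fun m : Fin q => ¬ n ≤ (m:ℕ))).card = q := by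
    have := Finset.card_filter_add_card_filter_not (s := (Finset.univ : Finset (Fin q))) (fun m : Fin q => n ≤ (m:ℕ))
    simpa using this
  have h2 : (Finset.univ.filter (fun m : Fin q => ¬ n ≤ (m:ℕ))).card = min n q := by
    simp only [not_le]
    rw [Fin.card_filter_val_lt, min_comm]
  omega

theorem split_equiv {d q : ℕ} {J : Fin d → Fin (d + q)} (hJ : StrictMono J) :
    ∃ e : Fin d ⊕ Fin q ≃ Fin (d + q), (∀ k, e (Sum.inl k) = J k) ∧
      ∀ k m, J k < e (Sum.inr m) ↔ (J k : ℕ) - k ≤ m := by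
  classical
  set A : Finset (Fin (d+q)) := Finset.univ.image J with hA
  have hAc : A.card = d := by rw [hA, Finset.card_image_of_injective _ hJ.injective]; simp
  have hAcc : Aᶜ.card = q := by rw [Finset.card_compl, hAc]; simp
  let e := finSumEquivOfFinset hAc hAcc
  have hl : ∀ k, e (Sum.inl k) = J k := by
    intro k
    have h1 := Finset.orderEmbOfFin_unique hAc (f := J) (fun x => Finset.mem_image_of_mem _ (Finset.mem_univ _)) hJ
    rw [h1]
    exact finSumEquivOfFinset_inl hAc hAcc k
  have hr : StrictMono (fun m => e (Sum.inr m)) := by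
    intro a b hab
    simp only [e, finSumEquivOfFinset_inr]
    exact (Finset.orderEmbOfFin Aᶜ hAcc).strictMono hab
  refine ⟨e, hl, ?_⟩
  intro k m
  have hcount : (J k : ℕ) = k + (Finset.univ.filter (fun m' : Fin q => e (Sum.inr m') < J k)).card := by
    have h1 : (Finset.univ.filter (fun x : Fin (d+q) => x < J k)).card = J k := by
      have : (Finset.univ.filter (fun x : Fin (d+q) => x < J k)) = Finset.Iio (J k) := by ext; simp
      rw [this, Fin.card_Iio]
    have h2 : (Finset.univ.filter (fun x : Fin (d+q) => x < J k)).card = (Finset.univ.filter (fun x : Fin d ⊕ Fin q => e x < J k)).card := by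
      apply Finset.card_bij' (fun x _ => e.symm x) (fun x _ => e x) <;> simp
    rw [h2] at h1
    rw [← h1, Finset.card_filter, Fintype.sum_sum_type, ← Finset.card_filter, ← Finset.card_filter]
    simp only [hl, hJ.lt_iff_lt]
    have : (Finset.univ.filter (fun x : Fin d => x < k)) = Finset.Iio k := by ext; simp
    rw [this, Fin.card_Iio]
  have hne : e (Sum.inr m) ≠ J k := by
    rw [← hl k]; intro h; exact absurd (e.injective h) (by simp)
  constructor
  · intro h
    have : (Finset.univ.filter (fun m' : Fin q => e (Sum.inr m') < J k)) ⊆ Finset.Iio m := by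
      intro m' hm'
      simp only [Finset.mem_filter, Finset.mem_univ, true_and] at hm'
      rw [Finset.mem_Iio]
      exact hr.lt_iff_lt.mp (hm'.trans h)
    have := Finset.card_le_card this
    rw [Fin.card_Iio] at this
    omega
  · intro h
    by_contra hcon
    have hlt : e (Sum.inr m) < J k := lt_of_le_of_ne (not_lt.mp hcon) hne
    have : Finset.Iic m ⊆ (Finset.univ.filter (fun m' : Fin q => e (Sum.inr m') < J k)) := by
      intro m' hm'
      simp only [Finset.mem_filter, Finset.mem_univ, true_and]
      exact lt_of_le_of_lt (hr.monotone (Finset.mem_Iic.mp hm')) hlt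
    have := Finset.card_le_card this
    rw [Fin.card_Iic] at this
    omega

theorem le_of_strictMono {d r : ℕ} {J : Fin d → Fin r} (hJ : StrictMono J) (k : Fin d) : (k : ℕ) ≤ J k := by
  obtain ⟨k, hk⟩ := k
  induction k with
  | zero => simp
  | succ k ih =>
    have h1 := ih (by omega)
    have h2 : J ⟨k, by omega⟩ < J ⟨k+1, hk⟩ := hJ (by simp [Fin.lt_def])
    rw [Fin.lt_def] at h2
    simp only at h1 ⊢
    omega

theorem sub_mono {d r : ℕ} {J : Fin d → Fin r} (hJ : StrictMono J) : Monotone (fun k => (J k : ℕ) - k) := by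
  intro a b hab
  simp only
  obtain ⟨n, hn⟩ := Nat.exists_eq_add_of_le (Fin.le_def.mp hab)
  have key : ∀ n (b : Fin d), (b:ℕ) = a + n → (J a : ℕ) + n ≤ J b := by
    intro n
    induction n with
    | zero => intro b hb; have : a = b := by ext; omega
              subst this; simp
    | succ n ih =>
      intro b hb
      have h1 := ih ⟨a + n, by omega⟩ rfl
      have h2 : J ⟨a + n, by omega⟩ < J b := hJ (by rw [Fin.lt_def]; simp; omega)
      rw [Fin.lt_def] at h2
      omega
  have := key n b hn
  omega

theorem masked_surj {s d q : ℕ} {c : Fin s → Fin d → ℕ} {u : Fin s → Matrix (Fin d) (Fin d) ℂ}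
    {y : Fin s → Matrix (Fin q) (Fin q) ℂ} (hH : Hm c u y = ⊥) (hcount : ∑ l, ∑ k, (q - c l k) ≤ d * q)
    (τ : Fin s → Fin q → Fin d → ℂ) : ∃ ψ : Matrix (Fin q) (Fin d) ℂ, ∀ l (m : Fin q) k, c l k ≤ m → (y l * ψ * u l) m k = τ l m k := by
  classical
  let T : Matrix (Fin q) (Fin d) ℂ →ₗ[ℂ] ({p : Fin s × Fin d × Fin q // c p.1 p.2.1 ≤ p.2.2} → ℂ) :=
    { toFun := fun ψ p => (y p.1.1 * ψ * u p.1.1) p.1.2.2 p.1.2.1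
      map_add' := by intro a b; funext p; simp [Matrix.mul_add, Matrix.add_mul]
      map_smul' := by intro a b; funext p; simp }
  have hinj : Function.Injective T := by
    rw [← LinearMap.ker_eq_bot, LinearMap.ker_eq_bot']
    intro ψ hψ
    have : ψ ∈ Hm c u y := by
      rw [mem_Hm]
      intro l
      rw [mem_HL]
      intro i k hk
      exact congrFun hψ ⟨(l, k, i), hk⟩
    rw [hH] at this
    simpa using this
  have hcard : Fintype.card {p : Fin s × Fin d × Fin q // c p.1 p.2.1 ≤ p.2.2} = ∑ l, ∑ k, (q - c l k) := by
    rw [Fintype.card_subtype, Finset.card_filter, Fintype.sum_prod_type]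
    apply Finset.sum_congr rfl
    intro l _
    rw [Fintype.sum_prod_type]
    apply Finset.sum_congr rfl
    intro k _
    rw [← Finset.card_filter]
    exact card_ge (q := q) (n := c l k)
  have hfr : finrank ℂ (Matrix (Fin q) (Fin d) ℂ) = finrank ℂ ({p : Fin s × Fin d × Fin q // c p.1 p.2.1 ≤ p.2.2} → ℂ) := by
    have h1 := LinearMap.finrank_le_finrank_of_injective hinj
    have h2 : finrank ℂ (Matrix (Fin q) (Fin d) ℂ) = q * d := by simp [Module.finrank_matrix]
    have h3 : finrank ℂ ({p : Fin s × Fin d × Fin q // c p.1 p.2.1 ≤ p.2.2} → ℂ) = ∑ l, ∑ k, (q - c l k) := by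
      rw [Module.finrank_fintype_fun_eq_card, hcard]
    have h4 : q * d = d * q := mul_comm _ _
    omega
  have hs := (LinearMap.injective_iff_surjective_of_finrank_eq_finrank hfr).mp hinj
  obtain ⟨ψ, hψ⟩ := hs (fun p => τ p.1.1 p.1.2.2 p.1.2.1)
  exact ⟨ψ, fun l m k h => congrFun hψ ⟨(l, k, m), h⟩⟩

theorem gen_of_Hm {s d q : ℕ} {J : Fin s → Fin d → Fin (d + q)} (hJ : ∀ l, StrictMono (J l))
    {x : Fin s → Matrix (Fin d) (Fin d) ℂ} {y : Fin s → Matrix (Fin q) (Fin q) ℂ} (hx : ∀ l, (x l).det ≠ 0)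
    (hH : Hm (fun l k => (J l k : ℕ) - k) (fun l => (x l)⁻¹) y = ⊥)
    (hcount : ∑ l, ∑ k : Fin d, (q - ((J l k : ℕ) - k)) ≤ d * q) : Gen J := by
  classical
  choose e he1 he2 using fun l => split_equiv (hJ l)
  let e0 : Fin d ⊕ Fin q ≃ Fin (d + q) := finSumFinEquiv
  let mk : Matrix (Fin d) (Fin d) ℂ → Matrix (Fin q) (Fin d) ℂ → Matrix (Fin (d+q)) (Fin d) ℂ :=
    fun Z1 Z2 => (fromRows Z1 Z2).submatrix e0.symm id
  let g : Fin s → Matrix (Fin (d+q)) (Fin (d+q)) ℂ := fun l =>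
    (fromBlocks (x l) 0 0 (y l)).submatrix (e l).symm e0.symm
  have hgm : ∀ l Z1 Z2, g l * mk Z1 Z2 = (fromRows (x l * Z1) (y l * Z2)).submatrix (e l).symm id := by
    intro l Z1 Z2
    simp only [g, mk]
    rw [Matrix.submatrix_mul_equiv, fromBlocks_mul_fromRows]
    simp
  have hg1 : ∀ l Z1 Z2 k' k, (g l * mk Z1 Z2) (J l k') k = (x l * Z1) k' k := by
    intro l Z1 Z2 k' k
    rw [hgm, ← he1]
    simp
  have hg2 : ∀ l Z1 Z2 m k, (g l * mk Z1 Z2) (e l (Sum.inr m)) k = (y l * Z2) m k := by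
    intro l Z1 Z2 k' k
    rw [hgm]
    simp
  have hmk : ∀ Z1 Z2 (C : Matrix (Fin d) (Fin d) ℂ), mk Z1 Z2 * C = mk (Z1 * C) (Z2 * C) := by
    intro Z1 Z2 C
    simp only [mk]
    rw [← fromRows_mul]
    rfl
  have hmka : ∀ Z1 Z2 Z3 Z4, mk Z1 Z2 + mk Z3 Z4 = mk (Z1 + Z3) (Z2 + Z4) := by
    intro Z1 Z2 Z3 Z4
    ext i k
    obtain ⟨i, rfl⟩ := e0.surjective i
    rcases i with i | i <;> simp [mk]
  have hxu : ∀ l, x l * (x l)⁻¹ = 1 := fun l => Matrix.mul_nonsing_inv _ (isUnit_iff_ne_zero.mpr (hx l))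
  apply gen_of_tangent hJ (g := g) (Y := mk 1 0) (W := (fromCols 1 0).submatrix id e0.symm)
    (C := fun l => (x l)⁻¹) (D := x)
  · simp only [mk]
    rw [Matrix.submatrix_mul_equiv, fromCols_mul_fromRows]
    simp
  · exact hxu
  · intro l i k hik
    rw [hmk]
    obtain ⟨i, rfl⟩ := (e l).surjective i
    rcases i with i | i
    · rw [he1, hg1, Matrix.one_mul, hxu]
      rw [he1, (hJ l).lt_iff_lt] at hik
      exact Matrix.one_apply_ne hik.ne'
    · rw [hg2]; simp
  · intro τ
    obtain ⟨ψ, hψ⟩ := masked_surj hH hcount (fun l m k => τ l (e l (Sum.inr m)) k)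
    refine ⟨mk 0 ψ, fun l => (x l)⁻¹ * Matrix.of (fun k' k => τ l (J l k') k), ?_⟩
    intro l i k hik
    rw [hmk, hmk, hmka]
    obtain ⟨i, rfl⟩ := (e l).surjective i
    rcases i with i | i
    · rw [he1, hg1, Matrix.zero_mul, zero_add, Matrix.one_mul, ← Matrix.mul_assoc, hxu, Matrix.one_mul]
      rfl
    · rw [hg2, Matrix.zero_mul, add_zero, ← Matrix.mul_assoc]
      exact hψ l i k ((he2 l k i).mp hik)

theorem gen_of_kirwan {s d r : ℕ} (hs : 1 ≤ s) (hdr : d ≤ r) {J : Fin s → Fin d → Fin r} (hJ : ∀ l, StrictMono (J l))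
    (h : KirwanMem (GammaT J) ((r:ℝ) - (d:ℝ))) : Gen J := by
  obtain ⟨q, rfl⟩ := Nat.exists_eq_add_of_le hdr
  have hle : ∀ l (k : Fin d), (k:ℕ) ≤ J l k := fun l k => le_of_strictMono (hJ l) k
  have hle2 : ∀ l (k : Fin d), (J l k : ℕ) - k ≤ q := by
    intro l k
    have h1 := sub_mono (hJ l) (a := k) (b := ⟨d - 1, by have := k.2; omega⟩) (by rw [Fin.le_def]; have := k.2; simp; omega)
    simp only at h1
    have h2 := (J l ⟨d - 1, by have := k.2; omega⟩).2
    have := k.2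
    omega
  have hG : ∀ l k, GammaT J l k = (((q : ℤ) - (((J l k : ℕ) - (k:ℕ) : ℕ) : ℤ) : ℤ) : ℝ) := by
    intro l k
    simp only [GammaT]
    rw [Nat.cast_sub (hle l k)]
    push_cast
    ring
  obtain ⟨x, y, hx, hy, d', I, hI, hgen, hfr⟩ := schofield (q := q) hs d (fun l k => (J l k : ℕ) - k) (fun l => sub_mono (hJ l))
  have ht := kirwan_trace h
  have hi := kirwan_ineq h hgen
  simp only [TT, hG] at ht
  simp only [TJ, hG] at hi
  have ht' : (∑ l, ∑ k : Fin d, ((q : ℤ) - (((J l k : ℕ) - (k:ℕ) : ℕ) : ℤ))) = d * q := by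
    have : ((∑ l, ∑ k : Fin d, ((q : ℤ) - (((J l k : ℕ) - (k:ℕ) : ℕ) : ℤ)) : ℤ) : ℝ) = ((d * q : ℤ) : ℝ) := by
      push_cast at ht ⊢
      rw [ht]; ring
    exact_mod_cast this
  have hi' : (∑ l, ∑ k : Fin d', ((q : ℤ) - (((J l (I l k) : ℕ) - (I l k:ℕ) : ℕ) : ℤ))) ≤ d' * q := by
    have : ((∑ l, ∑ k : Fin d', ((q : ℤ) - (((J l (I l k) : ℕ) - (I l k:ℕ) : ℕ) : ℤ)) : ℤ) : ℝ) ≤ ((d' * q : ℤ) : ℝ) := by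
      push_cast at hi ⊢
      refine hi.trans (le_of_eq ?_)
      ring
    exact_mod_cast this
  simp only [pair] at hfr
  have hb : Hm (fun l k => (J l k : ℕ) - k) (fun l => (x l)⁻¹) y = ⊥ := by
    apply Submodule.finrank_eq_zero.mp
    omega
  apply gen_of_Hm hJ hx hb
  have : ((∑ l, ∑ k : Fin d, (q - ((J l k : ℕ) - k)) : ℕ) : ℤ) = d * q := by
    rw [← ht']
    push_cast
    apply Finset.sum_congr rfl
    intro l _
    apply Finset.sum_congr rfl
    intro k _
    have := hle l k
    have := hle2 l k
    omega
  have h2 : (∑ l, ∑ k : Fin d, (q - ((J l k : ℕ) - k)) : ℕ) = d * q := by exact_mod_cast this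
  exact h2.le

end KC

open Module

set_option linter.all false

namespace KC
open Matrix ComplexOrder Filter Topology

theorem abel_aux : ∀ (n : ℕ) (lam : Fin (n+1) → ℝ), Antitone lam → ∀ a : ℕ → ℝ, (∀ j, 0 ≤ a j) → a 0 = 0 →
    lam (Fin.last n) * a (n+1) ≤ ∑ j : Fin (n+1), lam j * (a (j+1) - a j) := by
  intro n
  induction n with
  | zero => intro lam hl a ha h0; simp [h0]
  | succ n ih =>
    intro lam hl a ha h0
    rw [Fin.sum_univ_castSucc]
    have h1 := ih (fun j => lam j.castSucc) (fun a b h => hl (by simpa using h)) a ha h0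
    have h2 : lam (Fin.last (n+1)) ≤ lam (Fin.last n).castSucc := hl (Fin.le_last _)
    simp only [Fin.val_castSucc, Fin.val_last] at h1 ⊢
    nlinarith [ha (n+1), mul_nonneg (sub_nonneg.mpr h2) (ha (n+1))]

theorem abel {r : ℕ} {lam : Fin r → ℝ} (hl : Antitone lam) {a : ℕ → ℝ} (ha : ∀ j, 0 ≤ a j) (h0 : a 0 = 0)
    (hr : a r = 0) : 0 ≤ ∑ j : Fin r, lam j * (a (j+1) - a j) := by
  cases r with
  | zero => simp
  | succ n =>
    have := abel_aux n lam hl a ha h0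
    rw [hr, mul_zero] at this
    exact this

section
variable {V : Type} [AddCommGroup V] [Module ℂ V] [FiniteDimensional ℂ V]

theorem deg_le_of_dm {r : ℕ} {F : ℕ → Submodule ℂ V} (hF : IsFlag r F) {lam : Fin r → ℝ} (hl : Antitone lam)
    {S1 S2 S3 S4 : Submodule ℂ V} (h : ∀ j, dm F S1 j + dm F S2 j ≤ dm F S3 j + dm F S4 j)
    (hf : finrank ℂ S1 + finrank ℂ S2 = finrank ℂ S3 + finrank ℂ S4) :
    deg F lam S1 + deg F lam S2 ≤ deg F lam S3 + deg F lam S4 := by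
  have := abel hl (a := fun j => ((dm F S3 j : ℝ) + dm F S4 j - dm F S1 j - dm F S2 j)) (by
    intro j
    have := h j
    have : ((dm F S1 j + dm F S2 j : ℕ) : ℝ) ≤ ((dm F S3 j + dm F S4 j : ℕ) : ℝ) := by exact_mod_cast this
    push_cast at this
    linarith) (by simp [dm_zero hF]) (by
    simp only [dm_top hF _ le_rfl]
    have : ((finrank ℂ S1 + finrank ℂ S2 : ℕ) : ℝ) = ((finrank ℂ S3 + finrank ℂ S4 : ℕ) : ℝ) := by exact_mod_cast hf
    push_cast at this
    linarith)
  unfold deg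
  rw [← Finset.sum_add_distrib, ← Finset.sum_add_distrib, ← sub_nonneg, ← Finset.sum_sub_distrib]
  refine this.trans (le_of_eq ?_)
  apply Finset.sum_congr rfl
  intro j _
  ring

theorem deg_super {r : ℕ} {F : ℕ → Submodule ℂ V} (hF : IsFlag r F) {lam : Fin r → ℝ} (hl : Antitone lam)
    (S S' : Submodule ℂ V) :
    deg F lam S + deg F lam S' ≤ deg F lam (S ⊔ S') + deg F lam (S ⊓ S') := by
  apply deg_le_of_dm hF hl
  · intro j
    unfold dm
    have h1 := Submodule.finrank_sup_add_finrank_inf_eq (S ⊓ F j) (S' ⊓ F j)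
    have h2 : finrank ℂ ↥((S ⊓ F j) ⊔ (S' ⊓ F j)) ≤ finrank ℂ ↥((S ⊔ S') ⊓ F j) :=
      Submodule.finrank_mono (sup_le (inf_le_inf_right _ le_sup_left) (inf_le_inf_right _ le_sup_right))
    have h3 : (S ⊓ F j) ⊓ (S' ⊓ F j) = (S ⊓ S') ⊓ F j := by
      rw [inf_inf_inf_comm, inf_idem]
    rw [h3] at h1
    omega
  · exact (Submodule.finrank_sup_add_finrank_inf_eq S S').symm

end

/-- excess of a subspace -/
noncomputable def exc {s r : ℕ} (g : Fin s → Matrix (Fin r) (Fin r) ℂ) (Λ : Fin s → Fin r → ℝ) (t : ℝ)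
    (S : Submodule ℂ (Fin r → ℂ)) : ℝ := ∑ l, deg (Fl (g l)) (Λ l) S - finrank ℂ S * t

theorem exc_super {s r : ℕ} {g : Fin s → Matrix (Fin r) (Fin r) ℂ} {Λ : Fin s → Fin r → ℝ} {t : ℝ}
    (hF : ∀ l, IsFlag r (Fl (g l))) (hΛ : ∀ l, Antitone (Λ l)) (S S' : Submodule ℂ (Fin r → ℂ)) :
    exc g Λ t S + exc g Λ t S' ≤ exc g Λ t (S ⊔ S') + exc g Λ t (S ⊓ S') := by
  have h1 := Finset.sum_le_sum (fun l (_ : l ∈ (Finset.univ : Finset (Fin s))) => deg_super (hF l) (hΛ l) S S')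
  have h2 : ((finrank ℂ ↥(S ⊔ S') + finrank ℂ ↥(S ⊓ S') : ℕ) : ℝ) = ((finrank ℂ S + finrank ℂ S' : ℕ) : ℝ) := by
    rw [Submodule.finrank_sup_add_finrank_inf_eq S S']
  push_cast at h2
  simp only [Finset.sum_add_distrib] at h1
  unfold exc
  have h3 : ((finrank ℂ ↥(S ⊔ S') : ℝ) + finrank ℂ ↥(S ⊓ S')) * t = ((finrank ℂ S : ℝ) + finrank ℂ S') * t := by rw [h2]
  linarith

theorem exc_of_type {s d r : ℕ} {g : Fin s → Matrix (Fin r) (Fin r) ℂ} {Λ : Fin s → Fin r → ℝ} {t : ℝ}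
    {S : Submodule ℂ (Fin r → ℂ)} {J : Fin s → Fin d → Fin r} (hd : finrank ℂ S = d)
    (hJ : ∀ l, IsType (Fl (g l)) S (J l)) : exc g Λ t S = TJ J Λ - d * t := by
  unfold exc TJ
  rw [hd]
  simp_rw [fun l => (hJ l).deg_eq (Λ l)]

/-- `S` is the maximal destabilizing subspace -/
structure IsHN {s r : ℕ} (g : Fin s → Matrix (Fin r) (Fin r) ℂ) (Λ : Fin s → Fin r → ℝ) (t : ℝ)
    (S : Submodule ℂ (Fin r → ℂ)) : Prop where
  max : ∀ S', exc g Λ t S' ≤ exc g Λ t S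
  le : ∀ S', exc g Λ t S ≤ exc g Λ t S' → S' ≤ S

theorem exists_HN {s r : ℕ} {g : Fin s → Matrix (Fin r) (Fin r) ℂ} {Λ : Fin s → Fin r → ℝ} {t : ℝ}
    (hF : ∀ l, IsFlag r (Fl (g l))) (hΛ : ∀ l, Antitone (Λ l)) : ∃ S, IsHN g Λ t S := by
  classical
  -- finitely many values
  have hfin : (Set.range (exc g Λ t)).Finite := by
    apply Set.Finite.subset (Set.finite_range (fun i : Σ d : Fin (r+1), (Fin s → Fin d → Fin r) => TJ i.2 Λ - ((i.1 : ℕ) : ℝ) * t))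
    rintro _ ⟨S, rfl⟩
    have hd : finrank ℂ S < r + 1 := by
      have := Submodule.finrank_le S
      simp at this
      omega
    choose J hJ using fun l => exists_type (hF l) S rfl
    exact ⟨⟨⟨_, hd⟩, J⟩, (exc_of_type rfl hJ).symm⟩
  obtain ⟨_, ⟨⟨S0, rfl⟩, hS0⟩⟩ := hfin.exists_maximal ⟨_, ⊥, rfl⟩
  have hmax : ∀ S', exc g Λ t S' ≤ exc g Λ t S0 := by
    intro S'
    rcases le_total (exc g Λ t S') (exc g Λ t S0) with h | h
    · exact h
    · exact hS0 ⟨S', rfl⟩ h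
  let A : Set ℕ := {n | ∃ S, exc g Λ t S = exc g Λ t S0 ∧ n = finrank ℂ S}
  have hAn : A.Nonempty := ⟨_, S0, rfl, rfl⟩
  have hAb : BddAbove A := by
    refine ⟨r, ?_⟩
    rintro n ⟨S, _, rfl⟩
    simpa using Submodule.finrank_le S
  obtain ⟨S, hS, hSr⟩ := Nat.sSup_mem hAn hAb
  refine ⟨S, fun S' => hS ▸ hmax S', ?_⟩
  intro S' hS'
  have h1 := exc_super (t := t) hF hΛ S S'
  have h2 := hmax (S ⊓ S')
  have h3 := hmax (S ⊔ S')
  have h4 : exc g Λ t (S ⊔ S') = exc g Λ t S0 := by linarith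
  have h5 : finrank ℂ ↥(S ⊔ S') ≤ finrank ℂ S := by
    rw [← hSr]
    exact le_csSup hAb ⟨_, h4, rfl⟩
  have h6 : S = S ⊔ S' := Submodule.eq_of_le_of_finrank_le le_sup_left h5
  rw [h6]
  exact le_sup_right

end KC

open Module

set_option linter.all false

namespace KC
open Matrix ComplexOrder Filter Topology

theorem finrank_map_ker {V W : Type} [AddCommGroup V] [Module ℂ V] [FiniteDimensional ℂ V]
    [AddCommGroup W] [Module ℂ W] (f : V →ₗ[ℂ] W) (p : Submodule ℂ V) :
    finrank ℂ (p.map f) + finrank ℂ ↥(p ⊓ LinearMap.ker f) = finrank ℂ p := by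
  have h := LinearMap.finrank_range_add_finrank_ker (f.domRestrict p)
  have h1 : LinearMap.range (f.domRestrict p) = p.map f := by
    rw [LinearMap.range_domRestrict]
  have h2 : finrank ℂ ↥(p ⊓ LinearMap.ker f) = finrank ℂ (LinearMap.ker (f.domRestrict p)) := by
    have e : (LinearMap.ker (f.domRestrict p)).map p.subtype = p ⊓ LinearMap.ker f := by
      exact (congrArg (Submodule.map p.subtype) (LinearMap.ker_domRestrict p f)).trans (Submodule.map_comap_subtype p _)
    rw [← e]
    exact (LinearEquiv.finrank_eq (Submodule.equivMapOfInjective _ p.injective_subtype _)).symm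
  rw [h1] at h
  omega

theorem hom_zero {s r : ℕ} {g : Fin s → Matrix (Fin r) (Fin r) ℂ} {Λ : Fin s → Fin r → ℝ} {t : ℝ}
    (hF : ∀ l, IsFlag r (Fl (g l))) (hΛ : ∀ l, Antitone (Λ l)) {S : Submodule ℂ (Fin r → ℂ)}
    (hS : IsHN g Λ t S) (Φ : (Fin r → ℂ) →ₗ[ℂ] ((Fin r → ℂ) ⧸ S))
    (h : ∀ l j, ∀ u ∈ S, u ∈ Fl (g l) j → Φ u ∈ (Fl (g l) j).map S.mkQ) : ∀ u ∈ S, Φ u = 0 := by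
  set K := S ⊓ LinearMap.ker Φ with hK
  set M := (S.map Φ).comap S.mkQ with hM
  have hSM : S ≤ M := by
    intro u hu
    rw [hM, Submodule.mem_comap, Submodule.mkQ_apply, (Submodule.Quotient.mk_eq_zero S).mpr hu]
    exact zero_mem _
  have hMm : M.map S.mkQ = S.map Φ := by
    rw [hM, Submodule.map_comap_eq, Submodule.range_mkQ, top_inf_eq]
  have d1 := finrank_map_ker S.mkQ M
  have d2 := finrank_map_ker Φ S
  rw [Submodule.ker_mkQ, inf_eq_right.mpr hSM, hMm] at d1
  have hdim : finrank ℂ S + finrank ℂ S = finrank ℂ M + finrank ℂ K := by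
    rw [← hK] at d2
    omega
  have hdeg : ∀ l, deg (Fl (g l)) (Λ l) S + deg (Fl (g l)) (Λ l) S ≤
      deg (Fl (g l)) (Λ l) M + deg (Fl (g l)) (Λ l) K := by
    intro l
    apply deg_le_of_dm (hF l) (hΛ l) _ hdim
    intro j
    unfold dm
    have e1 := finrank_map_ker S.mkQ (M ⊓ Fl (g l) j)
    have e2 := finrank_map_ker Φ (S ⊓ Fl (g l) j)
    have e3 : (M ⊓ Fl (g l) j) ⊓ LinearMap.ker S.mkQ = S ⊓ Fl (g l) j := by
      rw [Submodule.ker_mkQ, inf_right_comm, inf_eq_right.mpr hSM]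
    have e4 : (S ⊓ Fl (g l) j) ⊓ LinearMap.ker Φ = K ⊓ Fl (g l) j := by
      rw [inf_right_comm]
    have e5 : (S ⊓ Fl (g l) j).map Φ ≤ (M ⊓ Fl (g l) j).map S.mkQ := by
      rintro _ ⟨u, ⟨hu1, hu2⟩, rfl⟩
      obtain ⟨w, hw, hwe⟩ := h l j u hu1 hu2
      refine ⟨w, ⟨?_, hw⟩, hwe⟩
      show S.mkQ w ∈ S.map Φ
      rw [hwe]
      exact ⟨u, hu1, rfl⟩
    have e6 := Submodule.finrank_mono e5
    rw [e3] at e1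
    rw [e4] at e2
    omega
  have h1 := Finset.sum_le_sum (fun l (_ : l ∈ (Finset.univ : Finset (Fin s))) => hdeg l)
  have h2 : ((finrank ℂ S + finrank ℂ S : ℕ) : ℝ) = ((finrank ℂ M + finrank ℂ K : ℕ) : ℝ) := by
    rw [hdim]
  push_cast at h2
  simp only [Finset.sum_add_distrib] at h1
  have h3 : ((finrank ℂ S : ℝ) + finrank ℂ S) * t = ((finrank ℂ M : ℝ) + finrank ℂ K) * t := by rw [h2]
  have h4 : exc g Λ t S + exc g Λ t S ≤ exc g Λ t M + exc g Λ t K := by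
    unfold exc
    linarith
  have h5 := hS.max K
  have h6 := hS.le M (by linarith)
  have h7 := Submodule.finrank_mono h6
  have h8 : finrank ℂ (S.map Φ) = 0 := by omega
  have h9 : S.map Φ = ⊥ := Submodule.finrank_eq_zero.mp h8
  intro u hu
  have : Φ u ∈ S.map Φ := ⟨u, hu, rfl⟩
  rwa [h9, Submodule.mem_bot] at this

theorem frame_span {s d r : ℕ} {J : Fin s → Fin d → Fin r} {g : Fin s → Matrix (Fin r) (Fin r) ℂ}
    {Y : Matrix (Fin r) (Fin d) ℂ} {C : Fin s → Matrix (Fin d) (Fin d) ℂ} (hf : Frame J g Y C) (l : Fin s)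
    (hJ : IsType (Fl (g l)) (LinearMap.range Y.mulVecLin) (J l)) (j : ℕ) (u : Fin r → ℂ)
    (hu : u ∈ LinearMap.range Y.mulVecLin) (huj : u ∈ Fl (g l) j) :
    ∃ z : Fin d → ℂ, u = Y *ᵥ (C l *ᵥ z) ∧ ∀ k, j ≤ J l k → z k = 0 := by
  classical
  have hinj : Function.Injective (fun z : Fin d → ℂ => (Y * C l) *ᵥ z) := by
    intro a b hab
    have h1 : ((C l)ᴴ * Yᴴ) * (Y * C l) = 1 := by
      rw [Matrix.mul_assoc, ← Matrix.mul_assoc Yᴴ, hf.hY, Matrix.one_mul, hf.hC]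
    have := congrArg (fun v => ((C l)ᴴ * Yᴴ) *ᵥ v) hab
    simpa only [mulVec_mulVec, h1, one_mulVec] using this
  have hli : LinearIndependent ℂ (fun k => (Y * C l).col k) := (Matrix.mulVec_injective_iff).mp hinj
  have hli2 : LinearIndependent ℂ (fun k : {k : Fin d // (J l k : ℕ) < j} => (Y * C l).col k) :=
    hli.comp _ Subtype.val_injective
  have hcard := finrank_span_eq_card hli2
  set W := Submodule.span ℂ (Set.range (fun k : {k : Fin d // (J l k : ℕ) < j} => (Y * C l).col k)) with hW
  have hle : W ≤ LinearMap.range Y.mulVecLin ⊓ Fl (g l) j := by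
    rw [hW, Submodule.span_le]
    rintro _ ⟨⟨k, hk⟩, rfl⟩
    refine ⟨⟨(C l).col k, rfl⟩, ?_⟩
    intro i hi
    exact hf.hz l i k (Fin.lt_def.mpr (by omega))
  have heq : W = LinearMap.range Y.mulVecLin ⊓ Fl (g l) j := by
    apply Submodule.eq_of_le_of_finrank_eq hle
    rw [hcard]
    have := hJ.cnt j
    unfold dm at this
    rw [this, Fintype.card_subtype]
  have hu' : u ∈ W := by rw [heq]; exact ⟨hu, huj⟩
  rw [hW, Submodule.mem_span_range_iff_exists_fun] at hu'
  obtain ⟨c, hc⟩ := hu'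
  refine ⟨fun k => if hk : (J l k : ℕ) < j then c ⟨k, hk⟩ else 0, ?_, ?_⟩
  · rw [mulVec_mulVec, ← hc, Matrix.mulVec_eq_sum]
    simp only [op_smul_eq_smul]
    have : ∀ k : Fin d, (if hk : (J l k : ℕ) < j then c ⟨k, hk⟩ else 0) • (Y * C l)ᵀ k =
        if hk : (J l k : ℕ) < j then c ⟨k, hk⟩ • (Y * C l)ᵀ k else 0 := by
      intro k; split_ifs <;> simp
    simp_rw [this]
    rw [Finset.sum_dite]
    simp only [Finset.sum_const_zero, add_zero]
    refine Fintype.sum_equiv (Equiv.subtypeEquivRight (fun k => by simp)) _ _ ?_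
    rintro ⟨k, hk⟩
    rfl
  · intro k hk
    simp [not_lt.mpr hk]

end KC

open Module

set_option linter.all false

namespace KC
open Matrix ComplexOrder Filter Topology

/-- matrices that can be corrected to the echelon shape -/
def maskSub {d r : ℕ} (J : Fin d → Fin r) (G : Matrix (Fin r) (Fin d) ℂ) :
    Submodule ℂ (Matrix (Fin r) (Fin d) ℂ) where
  carrier := {X | ∃ A : Matrix (Fin d) (Fin d) ℂ, ∀ i k, J k < i → (G * A + X) i k = 0}
  add_mem' := by
    rintro X X' ⟨A, hA⟩ ⟨A', hA'⟩
    refine ⟨A + A', fun i k h => ?_⟩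
    have h1 := hA i k h
    have h2 := hA' i k h
    rw [Matrix.add_apply] at h1 h2
    rw [Matrix.mul_add, Matrix.add_apply, Matrix.add_apply, Matrix.add_apply]
    linear_combination h1 + h2
  zero_mem' := ⟨0, fun i k h => by simp⟩
  smul_mem' := by
    rintro c X ⟨A, hA⟩
    refine ⟨c • A, fun i k h => ?_⟩
    have h1 := hA i k h
    rw [Matrix.mul_smul, ← smul_add, Matrix.smul_apply, h1, smul_zero]

theorem isClosed_maskSub {d r : ℕ} (J : Fin d → Fin r) (G : Matrix (Fin r) (Fin d) ℂ) :
    IsClosed (maskSub J G : Set (Matrix (Fin r) (Fin d) ℂ)) :=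
  Submodule.closed_of_finiteDimensional _

theorem frame_free {s d r : ℕ} {J : Fin s → Fin d → Fin r} {g : Fin s → Matrix (Fin r) (Fin r) ℂ}
    {Y P : Matrix (Fin r) (Fin d) ℂ} {C A : Fin s → Matrix (Fin d) (Fin d) ℂ} (hf : Frame J g Y C)
    {S : Submodule ℂ (Fin r → ℂ)} (hY : LinearMap.range Y.mulVecLin = S)
    (hJ : ∀ l, IsType (Fl (g l)) S (J l)) {ζ : Fin s → Matrix (Fin r) (Fin r) ℂ} {e : ℂ}
    (hA : ∀ l i k, J l k < i → (g l * Y * A l + (g l * P * C l + e • (g l * ζ l * (Y * C l)))) i k = 0)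
    (l : Fin s) (j : ℕ) (u : Fin r → ℂ) (hu : u ∈ S) (huj : u ∈ Fl (g l) j) :
    S.mkQ ((P * Yᴴ) *ᵥ u) + e • S.mkQ (ζ l *ᵥ u) ∈ (Fl (g l) j).map S.mkQ := by
  subst hY
  obtain ⟨z, hz, hz0⟩ := frame_span hf l (hJ l) j u hu huj
  refine ⟨(Y * A l + P * C l + e • (ζ l * (Y * C l))) *ᵥ z, ?_, ?_⟩
  · intro i hi
    rw [mulVec_mulVec]
    show ∑ k, _ * z k = 0
    apply Finset.sum_eq_zero
    intro k _
    by_cases hk : j ≤ J l k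
    · rw [hz0 k hk, mul_zero]
    · have h1 := hA l i k (Fin.lt_def.mpr (by omega))
      have h2 : g l * (Y * A l + P * C l + e • (ζ l * (Y * C l))) =
          g l * Y * A l + (g l * P * C l + e • (g l * ζ l * (Y * C l))) := by
        rw [Matrix.mul_add, Matrix.mul_add, Matrix.mul_smul, add_assoc]
        simp only [Matrix.mul_assoc]
      rw [h2, h1, zero_mul]
  · have h3 : (Y * A l + P * C l + e • (ζ l * (Y * C l))) *ᵥ z =
        Y *ᵥ (A l *ᵥ z) + ((P * Yᴴ) *ᵥ u + e • (ζ l *ᵥ u)) := by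
      have h4 : (P * Yᴴ) *ᵥ u = P *ᵥ (C l *ᵥ z) := by
        rw [hz, mulVec_mulVec, Matrix.mul_assoc, hf.hY, Matrix.mul_one]
      rw [h4, hz]
      simp only [add_mulVec, smul_mulVec, mulVec_mulVec, add_assoc, Matrix.mul_assoc]
    rw [h3, map_add, map_add, map_smul]
    have h5 : (LinearMap.range Y.mulVecLin).mkQ (Y *ᵥ (A l *ᵥ z)) = 0 := by
      rw [Submodule.mkQ_apply, Submodule.Quotient.mk_eq_zero]
      exact ⟨_, rfl⟩
    rw [h5, zero_add]

theorem range_eq_HN {s d r : ℕ} {g : Fin s → Matrix (Fin r) (Fin r) ℂ} {Λ : Fin s → Fin r → ℝ} {t : ℝ}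
    (hF : ∀ l, IsFlag r (Fl (g l))) (hΛ : ∀ l, Antitone (Λ l)) {S S' : Submodule ℂ (Fin r → ℂ)}
    (hS : IsHN g Λ t S) (hd : finrank ℂ S = d) (hd' : finrank ℂ S' = d) {J J' : Fin s → Fin d → Fin r}
    (hJ : ∀ l, IsType (Fl (g l)) S (J l)) (hp : ∀ l, Pos (Fl (g l)) S' (J' l))
    (hT : TJ J Λ = TJ J' Λ) : S' = S := by
  apply Submodule.eq_of_le_of_finrank_eq _ (hd'.trans hd.symm)
  apply hS.le
  rw [exc_of_type hd hJ, hT]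
  unfold exc TJ
  rw [hd']
  exact sub_le_sub_right (Finset.sum_le_sum (fun l _ => sum_le_deg_of_pos (hF l) hd' (hp l) (hΛ l))) _

end KC

open Module

set_option linter.all false

namespace KC
open Matrix ComplexOrder Filter Topology

/-- normalised limit -/
theorem norm_limit {r d : ℕ} (Z : ℕ → Matrix (Fin r) (Fin d) ℂ) (ε : ℕ → ℝ) (hε : ∀ n, 0 < ε n) :
    ∃ (φ : ℕ → ℕ) (P : Matrix (Fin r) (Fin d) ℂ) (e : ℝ) (a : ℕ → ℝ), StrictMono φ ∧ (∀ n, 0 < a n) ∧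
      Tendsto (fun n => ((a (φ n) : ℂ))⁻¹ • Z (φ n)) atTop (𝓝 P) ∧
      Tendsto (fun n => (a (φ n))⁻¹ * ε (φ n)) atTop (𝓝 e) ∧ (e = 0 → P ≠ 0) := by
  let nz : ℕ → ℝ := fun n => ‖(fun i j => Z n i j : Fin r → Fin d → ℂ)‖
  have hnz : ∀ n, 0 ≤ nz n := fun n => norm_nonneg _
  let a : ℕ → ℝ := fun n => ε n + nz n
  have ha : ∀ n, 0 < a n := fun n => add_pos_of_pos_of_nonneg (hε n) (hnz n)
  let w : ℕ → (Fin r → Fin d → ℂ) × ℝ := fun n =>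
    (((a n : ℂ))⁻¹ • (fun i j => Z n i j : Fin r → Fin d → ℂ), (a n)⁻¹ * ε n)
  have hw1 : ∀ n, ‖(w n).1‖ + (w n).2 = 1 := by
    intro n
    show ‖((a n : ℂ))⁻¹ • (fun i j => Z n i j : Fin r → Fin d → ℂ)‖ + (a n)⁻¹ * ε n = 1
    rw [norm_smul, norm_inv, Complex.norm_real, Real.norm_of_nonneg (ha n).le, ← mul_add]
    show (a n)⁻¹ * (nz n + ε n) = 1
    rw [add_comm]
    exact inv_mul_cancel₀ (ha n).ne'
  have hw2 : ∀ n, 0 ≤ (w n).2 := fun n => mul_nonneg (inv_nonneg.mpr (ha n).le) (hε n).le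
  have hwb : ∀ n, w n ∈ Metric.closedBall (0 : (Fin r → Fin d → ℂ) × ℝ) 1 := by
    intro n
    rw [mem_closedBall_zero_iff, Prod.norm_def]
    apply max_le
    · linarith [hw1 n, hw2 n]
    · rw [Real.norm_of_nonneg (hw2 n)]
      linarith [hw1 n, norm_nonneg (w n).1]
  obtain ⟨⟨P, e⟩, _, φ, hφ, hlim⟩ := (isCompact_closedBall _ _).tendsto_subseq hwb
  have l1 : Tendsto (fun n => (w (φ n)).1) atTop (𝓝 P) := (continuous_fst.tendsto _).comp hlim
  have l2 : Tendsto (fun n => (w (φ n)).2) atTop (𝓝 e) := (continuous_snd.tendsto _).comp hlim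
  refine ⟨φ, Matrix.of P, e, a, hφ, ha, l1, l2, ?_⟩
  intro he hP
  have l3 : Tendsto (fun n => ‖(w (φ n)).1‖ + (w (φ n)).2) atTop (𝓝 (‖P‖ + e)) := l1.norm.add l2
  simp only [hw1] at l3
  have := tendsto_nhds_unique tendsto_const_nhds l3
  have hP' : P = 0 := hP
  rw [he, hP', norm_zero] at this
  norm_num at this

theorem stepC {s d r : ℕ} {g : Fin s → Matrix (Fin r) (Fin r) ℂ} {Λ : Fin s → Fin r → ℝ} {t : ℝ}
    (hF : ∀ l, IsFlag r (Fl (g l))) (hΛ : ∀ l, Antitone (Λ l)) {S : Submodule ℂ (Fin r → ℂ)}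
    (hS : IsHN g Λ t S) (hd : finrank ℂ S = d) {J : Fin s → Fin d → Fin r}
    (hJ : ∀ l, IsType (Fl (g l)) S (J l)) (hG : Gen J) (ζ : Fin s → Matrix (Fin r) (Fin r) ℂ) :
    ∃ Ψ : (Fin r → ℂ) →ₗ[ℂ] ((Fin r → ℂ) ⧸ S), ∀ l j, ∀ u ∈ S, u ∈ Fl (g l) j →
      Ψ u + S.mkQ (ζ l *ᵥ u) ∈ (Fl (g l) j).map S.mkQ := by
  let e0 : ℕ → ℝ := fun n => 1 / ((n : ℝ) + 1)
  have he0 : ∀ n, 0 < e0 n := fun n => Nat.one_div_pos_of_nat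
  have he0l : Tendsto e0 atTop (𝓝 0) := tendsto_one_div_add_atTop_nhds_zero_nat
  let gn : ℕ → Fin s → Matrix (Fin r) (Fin r) ℂ := fun n l => g l + (e0 n : ℂ) • (g l * ζ l)
  have hgn : Tendsto gn atTop (𝓝 g) := by
    rw [tendsto_pi_nhds]
    intro l
    have h1 : Tendsto (fun n => (e0 n : ℂ)) atTop (𝓝 ((0:ℝ):ℂ)) :=
      (Complex.continuous_ofReal.tendsto _).comp he0l
    have h2 : Tendsto (fun n => g l + (e0 n : ℂ) • (g l * ζ l)) atTop (𝓝 (g l + ((0:ℝ):ℂ) • (g l * ζ l))) :=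
      tendsto_const_nhds.add (h1.smul tendsto_const_nhds)
    rw [Complex.ofReal_zero, zero_smul, add_zero] at h2
    exact h2
  have hfr : ∀ n, ∃ Y C, Frame J (gn n) Y C := by
    intro n
    have : gn n ∈ Zset J := by rw [hG]; trivial
    obtain ⟨S', hS', hp⟩ := this
    obtain ⟨Y, C, h, _⟩ := exists_frame hS' hp
    exact ⟨Y, C, h⟩
  choose Yn Cn hfn using hfr
  obtain ⟨φ, Y0, C0, hφ, hY0, hC0, hf⟩ := frame_limit hgn hfn
  have hrange : LinearMap.range Y0.mulVecLin = S := by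
    have := hf.mem (fun l => (hJ l).sm)
    exact range_eq_HN hF hΛ hS hd this.1 hJ this.2 rfl
  let Q : Matrix (Fin r) (Fin r) ℂ := 1 - Y0 * Y0ᴴ
  have hQY : Q * Y0 = 0 := by
    show (1 - Y0 * Y0ᴴ) * Y0 = 0
    rw [Matrix.sub_mul, Matrix.mul_assoc, hf.hY, Matrix.one_mul, Matrix.mul_one, sub_self]
  have hQQ : Q * Q = Q := by
    show Q * (1 - Y0 * Y0ᴴ) = Q
    rw [Matrix.mul_sub, ← Matrix.mul_assoc, hQY, Matrix.zero_mul, Matrix.mul_one, sub_zero]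
  obtain ⟨ρ, P, e, a, hρ, ha, hP, he, hPe⟩ := norm_limit (fun n => Q * Yn (φ n)) (fun n => e0 (φ n)) (fun n => he0 _)
  have hQP : Q * P = P := by
    have h1 : Tendsto (fun n => Q * (((a (ρ n) : ℂ))⁻¹ • (Q * Yn (φ (ρ n))))) atTop (𝓝 (Q * P)) :=
      ((continuous_const.matrix_mul continuous_id).tendsto P).comp hP
    have h2 : (fun n => Q * (((a (ρ n) : ℂ))⁻¹ • (Q * Yn (φ (ρ n))))) =
        (fun n => (((a (ρ n) : ℂ))⁻¹ • (Q * Yn (φ (ρ n))))) := by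
      funext n
      rw [Matrix.mul_smul, ← Matrix.mul_assoc, hQQ]
    rw [h2] at h1
    exact tendsto_nhds_unique h1 hP
  have hY0' : Tendsto (fun n => Yn (φ (ρ n))) atTop (𝓝 Y0) := hY0.comp hρ.tendsto_atTop
  have hC0' : Tendsto (fun n => Cn (φ (ρ n))) atTop (𝓝 C0) := hC0.comp hρ.tendsto_atTop
  have hA : ∀ l, ∃ A : Matrix (Fin d) (Fin d) ℂ, ∀ i k, J l k < i →
      (g l * Y0 * A + (g l * P * C0 l + (e : ℂ) • (g l * ζ l * (Y0 * C0 l)))) i k = 0 := by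
    intro l
    have hCl : Tendsto (fun n => Cn (φ (ρ n)) l) atTop (𝓝 (C0 l)) := (tendsto_pi_nhds.mp hC0') l
    have he' : Tendsto (fun n => ((((a (ρ n))⁻¹ * e0 (φ (ρ n)) : ℝ)) : ℂ)) atTop (𝓝 (e : ℂ)) :=
      (Complex.continuous_ofReal.tendsto _).comp he
    have hcm : Continuous (fun p : Matrix (Fin r) (Fin d) ℂ × Matrix (Fin d) (Fin d) ℂ × ℂ × Matrix (Fin r) (Fin d) ℂ =>
        g l * p.1 * p.2.1 + p.2.2.1 • (g l * ζ l * (p.2.2.2 * p.2.1))) := by fun_prop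
    have hlim := (hcm.tendsto (P, C0 l, (e:ℂ), Y0)).comp
      (hP.prodMk_nhds (hCl.prodMk_nhds (he'.prodMk_nhds hY0')))
    have hmem : g l * P * C0 l + (e : ℂ) • (g l * ζ l * (Y0 * C0 l)) ∈ maskSub (J l) (g l * Y0) := by
      refine (isClosed_maskSub (J l) (g l * Y0)).mem_of_tendsto hlim (Eventually.of_forall ?_)
      intro n
      set m := φ (ρ n) with hm
      refine ⟨((a (ρ n) : ℂ))⁻¹ • (Y0ᴴ * Yn m * Cn m l), ?_⟩
      intro i k hik
      have h1 := (hfn m).hz l i k hik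
      have h2 : (g l * Y0 * (((a (ρ n) : ℂ))⁻¹ • (Y0ᴴ * Yn m * Cn m l)) +
          (g l * (((a (ρ n) : ℂ))⁻¹ • (Q * Yn m)) * Cn m l +
            ((((a (ρ n))⁻¹ * e0 m : ℝ)) : ℂ) • (g l * ζ l * (Yn m * Cn m l)))) =
          ((a (ρ n) : ℂ))⁻¹ • (gn m l * (Yn m * Cn m l)) := by
        show _ = ((a (ρ n) : ℂ))⁻¹ • ((g l + (e0 m : ℂ) • (g l * ζ l)) * (Yn m * Cn m l))
        have h3 : (1 - Y0 * Y0ᴴ) * Yn m = Yn m - Y0 * (Y0ᴴ * Yn m) := by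
          rw [Matrix.sub_mul, Matrix.one_mul, Matrix.mul_assoc]
        show (g l * Y0 * (((a (ρ n) : ℂ))⁻¹ • (Y0ᴴ * Yn m * Cn m l)) +
          (g l * (((a (ρ n) : ℂ))⁻¹ • ((1 - Y0 * Y0ᴴ) * Yn m)) * Cn m l +
            ((((a (ρ n))⁻¹ * e0 m : ℝ)) : ℂ) • (g l * ζ l * (Yn m * Cn m l)))) = _
        rw [h3]
        push_cast
        rw [Matrix.add_mul, smul_add, Matrix.mul_smul, Matrix.mul_smul, Matrix.smul_mul, Matrix.smul_mul,
          mul_smul, ← add_assoc, ← smul_add, Matrix.mul_sub, Matrix.sub_mul]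
        simp only [Matrix.mul_assoc]
        congr 2
        abel_nf
      exact (congrFun (congrFun h2 i) k).trans (by rw [Matrix.smul_apply, h1, smul_zero])
    exact hmem
  choose A hA using hA
  have key := frame_free hf hrange hJ hA
  by_cases hez : e = 0
  · exfalso
    apply hPe hez
    have h0 := hom_zero hF hΛ hS (S.mkQ ∘ₗ (P * Y0ᴴ).mulVecLin) (by
      intro l j u hu huj
      have := key l j u hu huj
      simpa [hez] using this)
    have h1 : ∀ x : Fin d → ℂ, P *ᵥ x = 0 := by
      intro x
      have h2 := h0 (Y0 *ᵥ x) (by rw [← hrange]; exact ⟨x, rfl⟩)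
      have h3 : (P * Y0ᴴ) *ᵥ (Y0 *ᵥ x) = P *ᵥ x := by
        rw [mulVec_mulVec, Matrix.mul_assoc, hf.hY, Matrix.mul_one]
      have h4 : S.mkQ ((P * Y0ᴴ) *ᵥ (Y0 *ᵥ x)) = 0 := h2
      rw [h3, Submodule.mkQ_apply, Submodule.Quotient.mk_eq_zero, ← hrange] at h4
      obtain ⟨y, hy⟩ := h4
      have hy' : Y0 *ᵥ y = P *ᵥ x := hy
      rw [← hQP, ← mulVec_mulVec, ← hy', mulVec_mulVec, hQY, zero_mulVec]
    ext i k
    have := congrFun (h1 (Pi.single k 1)) i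
    simpa using this
  · refine ⟨(e : ℂ)⁻¹ • (S.mkQ ∘ₗ (P * Y0ᴴ).mulVecLin), ?_⟩
    intro l j u hu huj
    have := Submodule.smul_mem _ ((e : ℂ)⁻¹) (key l j u hu huj)
    have hez' : (e : ℂ) ≠ 0 := by exact_mod_cast hez
    rw [smul_add, smul_smul, inv_mul_cancel₀ hez', one_smul] at this
    exact this

end KC

open Module

set_option linter.all false

namespace KC
open Matrix ComplexOrder Filter Topology

theorem finrank_R {s d r : ℕ} {g : Fin s → Matrix (Fin r) (Fin r) ℂ} 
    (hF : ∀ l, IsFlag r (Fl (g l))) {S : Submodule ℂ (Fin r → ℂ)}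
    {J : Fin s → Fin d → Fin r} (hJ : ∀ l, IsType (Fl (g l)) S (J l)) (l : Fin s) (k : Fin d) :
    finrank ℂ ((Fl (g l) (J l k + 1)).map S.mkQ) + k = J l k := by
  have h1 := finrank_map_ker S.mkQ (Fl (g l) (J l k + 1))
  rw [Submodule.ker_mkQ, inf_comm, (hF l).rank] at h1
  have h2 : finrank ℂ ↥(S ⊓ Fl (g l) (J l k + 1)) = k + 1 := by
    have := (hJ l).cnt (J l k + 1)
    unfold dm at this
    rw [this]
    have : (Finset.univ.filter (fun k' : Fin d => (J l k' : ℕ) < J l k + 1)) = Finset.Iic k := by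
      ext k'
      simp only [Finset.mem_filter, Finset.mem_univ, true_and, Finset.mem_Iic]
      rw [← (hJ l).sm.le_iff_le, Fin.le_def]
      omega
    rw [this, Fin.card_Iic]
  rw [h2] at h1
  have := (J l k).2
  omega

/-- dimension of the target -/
theorem finrank_target {s e r : ℕ} {N : Type} [AddCommGroup N] [Module ℂ N] [FiniteDimensional ℂ N]
    (R : Fin s → Fin e → Submodule ℂ N) :
    ((finrank ℂ (∀ p : Fin s × Fin e, N ⧸ R p.1 p.2) : ℕ) : ℝ) =
      ∑ l, ∑ k, ((finrank ℂ N : ℝ) - finrank ℂ (R l k)) := by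
  rw [Module.finrank_pi_fintype, Fintype.sum_prod_type]
  push_cast
  refine Finset.sum_congr rfl fun l _ => Finset.sum_congr rfl fun k _ => ?_
  have := Submodule.finrank_quotient_add_finrank (R l k)
  rw [← this]
  push_cast
  ring

theorem stepD {s d r : ℕ} {g : Fin s → Matrix (Fin r) (Fin r) ℂ} {Λ : Fin s → Fin r → ℝ} {t : ℝ}
    (hF : ∀ l, IsFlag r (Fl (g l))) (hΛ : ∀ l, Antitone (Λ l)) {S : Submodule ℂ (Fin r → ℂ)}
    (hS : IsHN g Λ t S) (hd : finrank ℂ S = d) {J : Fin s → Fin d → Fin r}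
    (hJ : ∀ l, IsType (Fl (g l)) S (J l)) (hG : Gen J) : KirwanMem (GammaT J) ((r:ℝ) - (d:ℝ)) := by
  classical
  obtain ⟨Y, C, hf, hY⟩ := exists_frame hd (fun l => (hJ l).pos)
  have hJY : ∀ l, IsType (Fl (g l)) (LinearMap.range Y.mulVecLin) (J l) := by rw [hY]; exact hJ
  have hYS : ∀ x, Y *ᵥ x ∈ S := by intro x; rw [← hY]; exact ⟨x, rfl⟩
  have hYY : ∀ x, Yᴴ *ᵥ (Y *ᵥ x) = x := by
    intro x; rw [mulVec_mulVec, hf.hY, one_mulVec]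
  have hCC : ∀ l, C l * (C l)ᴴ = 1 := fun l => mul_eq_one_comm.mp (hf.hC l)
  have hN : finrank ℂ ((Fin r → ℂ) ⧸ S) + d = r := by
    have := Submodule.finrank_quotient_add_finrank S
    rw [hd] at this
    simpa using this
  have hNr : (finrank ℂ ((Fin r → ℂ) ⧸ S) : ℝ) = (r:ℝ) - d := by
    have : ((finrank ℂ ((Fin r → ℂ) ⧸ S) + d : ℕ) : ℝ) = r := by rw [hN]
    push_cast at this
    linarith
  let R : Fin s → Fin d → Submodule ℂ ((Fin r → ℂ) ⧸ S) := fun l k => (Fl (g l) (J l k + 1)).map S.mkQ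
  have hGR : ∀ l k, GammaT J l k = (finrank ℂ ((Fin r → ℂ) ⧸ S) : ℝ) - finrank ℂ (R l k) := by
    intro l k
    have h1 := finrank_R hF hJ l k
    have h2 : ((finrank ℂ (R l k) + k : ℕ) : ℝ) = (J l k : ℕ) := by exact_mod_cast h1
    push_cast at h2
    unfold GammaT
    rw [hNr]
    linarith
  have hflagC : ∀ l, IsFlag d (Fl (C l)ᴴ) := fun l => isFlag_Fl (hf.hC l)
  have hFC : ∀ l (k : Fin d) z, z ∈ Fl (C l)ᴴ (k+1) → Y *ᵥ z ∈ Fl (g l) (J l k + 1) := by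
    intro l k z hz i hi
    have h1 : Y *ᵥ z = (Y * C l) *ᵥ ((C l)ᴴ *ᵥ z) := by
      rw [mulVec_mulVec, Matrix.mul_assoc, hCC, Matrix.mul_one]
    rw [h1, mulVec_mulVec]
    show ∑ k', _ * ((C l)ᴴ *ᵥ z) k' = 0
    apply Finset.sum_eq_zero
    intro k' _
    by_cases hk : (k:ℕ) + 1 ≤ k'
    · rw [hz k' hk, mul_zero]
    · have : J l k' ≤ J l k := (hJ l).sm.monotone (Fin.le_def.mpr (by omega))
      rw [hf.hz l i k' (Fin.lt_def.mpr (by have := Fin.le_def.mp this; omega)), zero_mul]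
  -- semistability inequality
  have hss : ∀ S' : Submodule ℂ (Fin d → ℂ), ∑ l, deg (Fl (C l)ᴴ) (GammaT J l) S' ≤ finrank ℂ S' * ((r:ℝ) - d) := by
    intro S'
    choose I hI using fun l => exists_type (hflagC l) S' rfl
    choose b hbS hb1 hb2 using fun l => (hI l).ex
    have hbli : ∀ l, LinearIndependent ℂ (b l) := fun l =>
      linearIndependent_of_echelon (Fl_mono _) (fun k => (I l k : ℕ)) (fun x y h => (hI l).sm h) (b l) (hb1 l) (hb2 l)
    have hYli : ∀ l, LinearIndependent ℂ (fun k => Y *ᵥ b l k) := by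
      intro l
      refine (hbli l).map' Y.mulVecLin (LinearMap.ker_eq_bot.mpr ?_)
      intro x y hxy
      have := congrArg (fun v => Yᴴ *ᵥ v) hxy
      simpa [hYY, -mulVec_mulVec] using this
    let Θ : (S' →ₗ[ℂ] ((Fin r → ℂ) ⧸ S)) →ₗ[ℂ] (∀ p : Fin s × Fin (finrank ℂ S'), ((Fin r → ℂ) ⧸ S) ⧸ R p.1 (I p.1 p.2)) :=
      LinearMap.pi fun p => (R p.1 (I p.1 p.2)).mkQ ∘ₗ LinearMap.applyₗ (⟨b p.1 p.2, hbS p.1 p.2⟩ : S')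
    have hsurj : Function.Surjective Θ := by
      intro n
      choose n1 hn1 using fun p => Submodule.mkQ_surjective _ (n p)
      choose n2 hn2 using fun p => Submodule.mkQ_surjective _ (n1 p)
      have hz : ∀ l, ∃ ζ : (Fin r → ℂ) →ₗ[ℂ] (Fin r → ℂ), ∀ k, ζ (Y *ᵥ b l k) = - n2 (l, k) := by
        intro l
        obtain ⟨f, hf'⟩ := LinearMap.exists_extend ((Basis.span (hYli l)).constr ℂ (fun k => - n2 (l, k)))
        refine ⟨f, fun k => ?_⟩
        have h1 := LinearMap.congr_fun hf' (Basis.span (hYli l) k)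
        rw [Basis.constr_basis] at h1
        rw [← h1]
        simp [Basis.span_apply]
      choose ζ hζ using hz
      obtain ⟨Ψ, hΨ⟩ := stepC hF hΛ hS hd hJ hG (fun l => LinearMap.toMatrix' (ζ l))
      refine ⟨Ψ ∘ₗ Y.mulVecLin ∘ₗ S'.subtype, ?_⟩
      funext p
      obtain ⟨l, k⟩ := p
      rw [← hn1 (l, k)]
      show (R l (I l k)).mkQ (Ψ (Y *ᵥ b l k)) = (R l (I l k)).mkQ (n1 (l, k))
      rw [← sub_eq_zero, ← map_sub, Submodule.mkQ_apply, Submodule.Quotient.mk_eq_zero]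
      have h2 := hΨ l (J l (I l k) + 1) (Y *ᵥ b l k) (hYS _) (hFC l (I l k) _ (hb1 l k))
      rw [LinearMap.toMatrix'_mulVec, hζ, map_neg, hn2, ← sub_eq_add_neg] at h2
      exact h2
    have h3 := LinearMap.finrank_le_finrank_of_surjective hsurj
    rw [Module.finrank_linearMap] at h3
    have h4 := finrank_target (r := r) (fun l k => R l (I l k))
    have h5 : ∑ l, deg (Fl (C l)ᴴ) (GammaT J l) S' = ∑ l, ∑ k, ((finrank ℂ ((Fin r → ℂ) ⧸ S) : ℝ) - finrank ℂ (R l (I l k))) := by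
      refine Finset.sum_congr rfl fun l _ => ?_
      rw [(hI l).deg_eq]
      exact Finset.sum_congr rfl fun k _ => hGR l _
    rw [h5, ← h4, ← hNr]
    exact_mod_cast h3
  have hΓ : ∀ l, Antitone (GammaT J l) := by
    intro l a b hab
    rw [hGR, hGR]
    have : finrank ℂ (R l a) ≤ finrank ℂ (R l b) := by
      apply Submodule.finrank_mono
      apply Submodule.map_mono
      apply Fl_mono
      have := Fin.le_def.mp ((hJ l).sm.monotone hab)
      omega
    have : ((finrank ℂ (R l a) : ℕ) : ℝ) ≤ finrank ℂ (R l b) := by exact_mod_cast this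
    linarith
  refine kirwan_of_semistable (x := fun l => (C l)ᴴ) (B := C) hf.hC hΓ ?_ hss
  apply le_antisymm
  · have := hss ⊤
    rw [finrank_top, Module.finrank_fin_fun] at this
    refine le_trans (le_of_eq ?_) this
    unfold TT
    refine Finset.sum_congr rfl fun l _ => ?_
    unfold deg
    refine Finset.sum_congr rfl fun k _ => ?_
    rw [dm_full (hflagC l), dm_full (hflagC l)]
    have := k.2
    rw [min_eq_left (by omega), min_eq_left (by omega)]
    push_cast
    ring
  · let Θ : ((Fin d → ℂ) →ₗ[ℂ] ((Fin r → ℂ) ⧸ S)) →ₗ[ℂ] (∀ p : Fin s × Fin d, ((Fin r → ℂ) ⧸ S) ⧸ R p.1 p.2) :=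
      LinearMap.pi fun p => (R p.1 p.2).mkQ ∘ₗ LinearMap.applyₗ ((C p.1).col p.2)
    have hinj : Function.Injective Θ := by
      apply (injective_iff_map_eq_zero Θ).mpr
      intro ψ hψ
      have hψ' : ∀ l k, ψ ((C l).col k) ∈ R l k := by
        intro l k
        have h1 : (R l k).mkQ (ψ ((C l).col k)) = 0 := congrFun hψ (l, k)
        rwa [Submodule.mkQ_apply, Submodule.Quotient.mk_eq_zero] at h1
      have h0 := hom_zero hF hΛ hS (ψ ∘ₗ Yᴴ.mulVecLin) (by
        intro l j u hu huj
        obtain ⟨z, hz, hz0⟩ := frame_span hf l (hJY l) j u (by rw [hY]; exact hu) huj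
        show ψ (Yᴴ *ᵥ u) ∈ _
        rw [hz, hYY, Matrix.mulVec_eq_sum, map_sum]
        apply Submodule.sum_mem
        intro k _
        simp only [op_smul_eq_smul]
        rw [map_smul]
        by_cases hk : j ≤ J l k
        · rw [hz0 k hk, zero_smul]; exact zero_mem _
        · apply Submodule.smul_mem
          have : R l k ≤ (Fl (g l) j).map S.mkQ := Submodule.map_mono (Fl_mono _ (by omega))
          exact this (hψ' l k))
      ext1 k
      ext
      have h2 := h0 (Y *ᵥ Pi.single k 1) (hYS _)
      have h3 : ψ (Yᴴ *ᵥ (Y *ᵥ Pi.single k 1)) = 0 := h2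
      rw [hYY] at h3
      simpa using h3
    have h3 := LinearMap.finrank_le_finrank_of_injective hinj
    rw [Module.finrank_linearMap, Module.finrank_fin_fun] at h3
    have h4 := finrank_target (r := r) R
    have h5 : TT (GammaT J) = ∑ l, ∑ k, ((finrank ℂ ((Fin r → ℂ) ⧸ S) : ℝ) - finrank ℂ (R l k)) := by
      unfold TT
      exact Finset.sum_congr rfl fun l _ => Finset.sum_congr rfl fun k _ => hGR l _
    rw [h5, ← h4, ← hNr]
    exact_mod_cast h3

end KC

open Module

set_option linter.all false

namespace KC
open Matrix ComplexOrder Filter Topology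

theorem exists_generic (s r : ℕ) : ∃ g : Fin s → Matrix (Fin r) (Fin r) ℂ, (∀ l, (g l).det ≠ 0) ∧
    ∀ (d : ℕ) (J : Fin s → Fin d → Fin r), d ≤ r → (∀ l, StrictMono (J l)) → g ∈ Zset J → Gen J := by
  classical
  let U2 : (Σ d' : Fin (r+1), (Fin s → Fin d' → Fin r)) → Set (Fin s → Matrix (Fin r) (Fin r) ℂ) := fun i =>
    {p | ((∀ l, StrictMono (i.2 l)) ∧ ¬ Gen i.2) → p ∉ Zset i.2}
  have hU2 := dense_iInter_fin U2 (by
    intro i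
    by_cases h : (∀ l, StrictMono (i.2 l)) ∧ ¬ Gen i.2
    · have : U2 i = (Zset i.2)ᶜ := by
        ext p; simp [U2, h]
      rw [this]
      exact (isClosed_Zset h.1).isOpen_compl
    · have : U2 i = Set.univ := by
        ext p; simp only [U2, Set.mem_setOf_eq, Set.mem_univ, iff_true]; intro h'; exact absurd h' h
      rw [this]; exact isOpen_univ) (by
    intro i
    by_cases h : (∀ l, StrictMono (i.2 l)) ∧ ¬ Gen i.2
    · have : U2 i = (Zset i.2)ᶜ := by
        ext p; simp [U2, h]
      rw [this, ← interior_eq_empty_iff_dense_compl]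
      by_contra hne
      exact h.2 (gen_of_interior h.1 (Set.nonempty_iff_ne_empty.mpr hne))
    · have : U2 i = Set.univ := by
        ext p; simp only [U2, Set.mem_setOf_eq, Set.mem_univ, iff_true]; intro h'; exact absurd h' h
      rw [this]; exact dense_univ)
  obtain ⟨g, hg1, hg2⟩ := hU2.2.inter_open_nonempty _ (isOpen_dets (s := s) (n := r)) ⟨fun _ => 1, by simp⟩
  refine ⟨g, hg1, ?_⟩
  intro d J hd hJ hgJ
  by_contra hG
  have h1 := Set.mem_iInter.mp hg2 (⟨⟨d, by omega⟩, J⟩ : Σ d' : Fin (r+1), (Fin s → Fin d' → Fin r))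
  exact h1 ⟨hJ, hG⟩ hgJ

theorem gen_perm {s d r : ℕ} {J : Fin s → Fin d → Fin r} (hG : Gen J) (σ : Equiv.Perm (Fin s)) :
    Gen (fun l => J (σ⁻¹ l)) := by
  rw [Gen, Set.eq_univ_iff_forall]
  intro g
  have h : (fun l => g (σ l)) ∈ Zset J := by rw [hG]; trivial
  obtain ⟨S, hS, hp⟩ := h
  refine ⟨S, hS, fun l => ?_⟩
  have := hp (σ⁻¹ l)
  simpa using this

theorem exc_bot {s r : ℕ} (g : Fin s → Matrix (Fin r) (Fin r) ℂ) (Λ : Fin s → Fin r → ℝ) (t : ℝ) :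
    exc g Λ t ⊥ = 0 := by
  have h : ∀ F : ℕ → Submodule ℂ (Fin r → ℂ), ∀ j, dm F ⊥ j = 0 := by
    intro F j
    unfold dm
    rw [bot_inf_eq, finrank_bot]
  simp [exc, deg, h]

theorem exc_top {s r : ℕ} {g : Fin s → Matrix (Fin r) (Fin r) ℂ} (hF : ∀ l, IsFlag r (Fl (g l)))
    (Λ : Fin s → Fin r → ℝ) (t : ℝ) : exc g Λ t ⊤ = TT Λ - r * t := by
  unfold exc TT
  rw [finrank_top, Module.finrank_fin_fun]
  congr 1
  refine Finset.sum_congr rfl fun l _ => ?_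
  unfold deg
  refine Finset.sum_congr rfl fun k _ => ?_
  rw [dm_full (hF l), dm_full (hF l)]
  have := k.2
  rw [min_eq_left (by omega), min_eq_left (by omega)]
  push_cast
  ring

theorem exists_destab {s r : ℕ} (σ : Equiv.Perm (Fin s))
    (Λ : Fin s → Fin r → ℝ) (t : ℝ) (hΛ : ∀ l, Antitone (Λ l))
    (hσ : (fun l => Λ (σ⁻¹ l)) = Λ) (hT : TT Λ = (r : ℝ) * t) (hK : ¬ KirwanMem Λ t) :
    ∃ (d : ℕ) (J : Fin s → Fin d → Fin r), 1 ≤ d ∧ d < r ∧ (∀ l, StrictMono (J l)) ∧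
      (fun l => J (σ⁻¹ l)) = J ∧ KirwanMem (GammaT J) ((r : ℝ) - (d : ℝ)) ∧ (d : ℝ) * t < TJ J Λ := by
  obtain ⟨g, hdet, hgen⟩ := exists_generic s r
  have hinv : ∀ l, g l * (g l)⁻¹ = 1 := fun l => Matrix.mul_nonsing_inv _ (isUnit_iff_ne_zero.mpr (hdet l))
  have hF : ∀ l, IsFlag r (Fl (g l)) := fun l => isFlag_Fl (hinv l)
  obtain ⟨S, hS⟩ := exists_HN (t := t) hF hΛ
  have hpos : 0 < exc g Λ t S := by
    by_contra hcon
    apply hK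
    apply kirwan_of_semistable hinv hΛ hT
    intro S'
    have := hS.max S'
    unfold exc at this hcon
    linarith
  obtain ⟨d, hd⟩ : ∃ d, finrank ℂ S = d := ⟨_, rfl⟩
  choose J hJ using fun l => exists_type (hF l) S hd
  have hdr : d ≤ r := by
    have := Submodule.finrank_le S
    rw [Module.finrank_fin_fun] at this
    omega
  have hG : Gen J := hgen d J hdr (fun l => (hJ l).sm) ⟨S, hd, fun l => (hJ l).pos⟩
  refine ⟨d, J, ?_, ?_, fun l => (hJ l).sm, ?_, stepD hF hΛ hS hd hJ hG, ?_⟩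
  · by_contra hcon
    have h0 : finrank ℂ S = 0 := by omega
    rw [Submodule.finrank_eq_zero.mp h0, exc_bot] at hpos
    exact lt_irrefl _ hpos
  · by_contra hcon
    have h0 : S = ⊤ := by
      apply Submodule.eq_top_of_finrank_eq
      rw [Module.finrank_fin_fun]
      omega
    rw [h0, exc_top hF, hT, sub_self] at hpos
    exact lt_irrefl _ hpos
  · have hG' := gen_perm hG σ
    have hmem : g ∈ Zset (fun l => J (σ⁻¹ l)) := by rw [hG']; trivial
    obtain ⟨S', hS', hp⟩ := hmem
    have hTJ : TJ J Λ = TJ (fun l => J (σ⁻¹ l)) Λ := by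
      unfold TJ
      rw [← Equiv.sum_comp σ⁻¹]
      refine Finset.sum_congr rfl fun l _ => ?_
      have := congrFun hσ l
      rw [← this]
    have heq := range_eq_HN hF hΛ hS hd hS' hJ hp hTJ
    rw [heq] at hp
    have hle : ∀ l k, J l k ≤ J (σ⁻¹ l) k := fun l k => (hJ l).le_of_pos (hp l) k
    funext l k
    have hsum : ∑ l, ((J l k : Fin r) : ℕ) = ∑ l, ((J (σ⁻¹ l) k : Fin r) : ℕ) :=
      (Equiv.sum_comp σ⁻¹ (fun l => ((J l k : Fin r) : ℕ))).symm
    have := (Finset.sum_eq_sum_iff_of_le (fun l _ => Fin.le_def.mp (hle l k))).mp hsum l (Finset.mem_univ _)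
    exact (Fin.ext this).symm
  · rw [exc_of_type hd hJ] at hpos
    linarith

end KC

/-- **Inductive description of the σ-stable Kirwan cone.** For `σ`-stable
`(Λ, t) ∈ E(r,s)`: `(Λ,t) ∈ 𝒦(r,s)^σ` iff `T(Λ) = r t` and, for every
`d ∈ [r-1]` and every `σ`-stable `𝐉 ∈ Subsets(d,r,s)` with
`(Γ(𝐉), r-d) ∈ 𝒦(d,s)^σ`, `T_𝐉(Λ) ≤ d t`. -/
theorem kirwan_cone_induction_sym (s r : ℕ) (hs : 2 ≤ s) (hr : 1 ≤ r)
    (σ : Equiv.Perm (Fin s))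
    (Λ : Fin s → Fin r → ℝ) (t : ℝ) (hΛ : ∀ l, Antitone (Λ l))
    (hσ : (fun l => Λ (σ⁻¹ l)) = Λ) :
    KirwanMem Λ t ↔
      (TT Λ = (r : ℝ) * t ∧
        ∀ (d : ℕ), 1 ≤ d → d < r →
          ∀ J : Fin s → Fin d → Fin r, (∀ l, StrictMono (J l)) →
            (fun l => J (σ⁻¹ l)) = J →
            KirwanMem (GammaT J) ((r : ℝ) - (d : ℝ)) →
            (fun l => GammaT J (σ⁻¹ l)) = GammaT J →
            TJ J Λ ≤ (d : ℝ) * t) := by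
  constructor
  · intro h
    refine ⟨KC.kirwan_trace h, ?_⟩
    intro d _ hdr J hJ _ hK _
    exact KC.kirwan_ineq h (KC.gen_of_kirwan (by omega) hdr.le hJ hK)
  · rintro ⟨hT, h⟩
    by_contra hK
    obtain ⟨d, J, h1, h2, h3, h4, h5, h6⟩ := KC.exists_destab σ Λ t hΛ hσ hT hK
    have h7 := h d h1 h2 J h3 h4 h5 (by
      funext l k
      have := congrFun (congrFun h4 l) k
      simp only [GammaT]
      rw [this])
    linarith
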